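/- arXiv:2310.12888 — 4 statements merged into one kernel-verified Lean document; each statement's English description precedes it below -/
import Mathlib

section
/- Let F be a field, let 1 ≤ b ≤ k and n ≥ 1, and let K := FractionField (MvPolynomial ((Fin k × Fin b) ⊕ (Fin k × Fin n)) F). Let W ∈ K^{k×b} be the matrix with W_{i,j} the image of the variable indexed by inl(i,j), and W' ∈ K^{k×n} the matrix with W'_{i,j} the image of the variable indexed by inr(i,j) (so the entries of W and W' are jointly algebraically independent over F). Let (σ_1, A_1), …, (σ_ℓ, A_ℓ) be a proper configuration: σ_i ∈ {0,…,b}, A_i ⊆ {1,…,n}, and σ_i + |A_i| ≤ k for all i. Then the dimension over K of ⋂_{i=1}^ℓ (W_{≤σ_i} + W'_{A_i}) equals max over all partitions of {1,…,ℓ} into nonempty parts P_1,…,P_s of (−k(s−1) + Σ_{i=1}^s (min_{j∈P_i} σ_j + |⋂_{j∈P_i} A_j|)). -/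
open Finset Matrix

noncomputable section

/-- The intersection `⋂_{j ∈ p} A j`, as a `Finset (Fin n)`. -/
def interSet {ℓ n : ℕ} (A : Fin ℓ → Finset (Fin n)) (p : Finset (Fin ℓ)) : Finset (Fin n) :=
  Finset.univ.filter fun x => ∀ j ∈ p, x ∈ A j

/-- The dimension-`m` null intersection property: for every partition of `{1,…,ℓ}`
(presented as a `Finpartition` of `Finset.univ : Finset (Fin ℓ)`) into nonempty parts
`P_1,…,P_s`, we have `Σ_i |⋂_{j ∈ P_i} A_j| ≤ (s-1)·m`. -/
def NullInter {ℓ n : ℕ} (m : ℕ) (A : Fin ℓ → Finset (Fin n)) : Prop :=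
  ∀ P : Finpartition (Finset.univ : Finset (Fin ℓ)),
    ∑ p ∈ P.parts, (interSet A p).card ≤ (P.parts.card - 1) * m

/-- Span of the columns of `M` indexed by `A`. -/
def colSpan {K : Type*} [Field K] {k n : ℕ} (M : Matrix (Fin k) (Fin n) K)
    (A : Finset (Fin n)) : Submodule K (Fin k → K) :=
  Submodule.span K ((fun j i => M i j) '' (A : Set (Fin n)))

/-- Span of the first `σ` columns of `M`. -/
def colSpanLT {K : Type*} [Field K] {k b : ℕ} (M : Matrix (Fin k) (Fin b) K)
    (σ : ℕ) : Submodule K (Fin k → K) :=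
  Submodule.span K ((fun j i => M i j) '' {j : Fin b | (j : ℕ) < σ})

/-- The minimum of `σ` over the set `p` (for nonempty `p`, this is `min_{j ∈ p} σ j`). -/
def partMin {ℓ : ℕ} (σ : Fin ℓ → ℕ) (p : Finset (Fin ℓ)) : ℕ :=
  sInf (σ '' (p : Set (Fin ℓ)))

/-- The generic intersection dimension `gid_m((σ_i, A_i)_i)`: the maximum over all
partitions of `{1,…,ℓ}` into nonempty parts `P_1,…,P_s` of
`-m(s-1) + Σ_i (min_{j ∈ P_i} σ_j + |⋂_{j ∈ P_i} A_j|)`. -/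
def gid {ℓ n : ℕ} (m : ℕ) (σ : Fin ℓ → ℕ) (A : Fin ℓ → Finset (Fin n)) : ℤ :=
  sSup { v : ℤ | ∃ P : Finpartition (Finset.univ : Finset (Fin ℓ)),
    v = -(m : ℤ) * ((P.parts.card : ℤ) - 1)
      + ∑ p ∈ P.parts, ((partMin σ p : ℤ) + ((interSet A p).card : ℤ)) }

section GenericAux

variable {K : Type*} [Field K] {ι : Type*} [Fintype ι] [DecidableEq ι] {k : ℕ}

/-- Elements of a span of finitely many vectors as full sums with support condition. -/
lemma aux_mem_span (w : ι → Fin k → K) (B : Finset ι) (x : Fin k → K) :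
    x ∈ Submodule.span K (w '' (B : Set ι)) ↔
      ∃ y : ι → K, (∀ c, c ∉ B → y c = 0) ∧ ∑ c, y c • w c = x := by
  constructor
  · intro hx
    induction hx using Submodule.span_induction with
    | mem x hx =>
      obtain ⟨c, hc, rfl⟩ := hx
      refine ⟨Pi.single c 1, ?_, ?_⟩
      · intro d hd
        rw [Pi.single_apply, if_neg]
        rintro rfl
        exact hd hc
      · simp [Pi.single_apply]
    | zero => exact ⟨0, by simp, by simp⟩
    | add x y _ _ hx hy =>
      obtain ⟨a, ha, rfl⟩ := hx
      obtain ⟨b, hb, rfl⟩ := hy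
      exact ⟨a + b, fun c hc => by simp [ha c hc, hb c hc],
        by simp [add_smul, Finset.sum_add_distrib]⟩
    | smul t x _ hx =>
      obtain ⟨a, ha, rfl⟩ := hx
      exact ⟨t • a, fun c hc => by simp [ha c hc], by simp [Finset.smul_sum, mul_smul]⟩
  · rintro ⟨y, hy, rfl⟩
    refine Submodule.sum_mem _ fun c _ => ?_
    by_cases hc : c ∈ B
    · exact Submodule.smul_mem _ _ (Submodule.subset_span ⟨c, hc, rfl⟩)
    · rw [hy c hc, zero_smul]
      exact Submodule.zero_mem _

/-- The key identity obtained by differentiating a relation between annihilators. -/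
lemma aux_key {J : Type*} (w : ι → Fin k → K)
    (hD : ∀ (c : ι) (r : Fin k), ∃ D : K →+ K, (∀ a b, D (a * b) = a * D b + D a * b) ∧
      ∀ c' r', D (w c' r') = if c' = c ∧ r' = r then 1 else 0)
    (B : J → Finset ι) (S : Finset J)
    (z : J → Module.Dual K (Fin k → K)) (hz : ∀ i ∈ S, ∀ c ∈ B i, z i (w c) = 0)
    (hsum : ∑ i ∈ S, z i = 0)
    (x : Fin k → K) (y : J → ι → K) (hy : ∀ i ∈ S, ∀ c, c ∉ B i → y i c = 0)
    (hyx : ∀ i ∈ S, ∑ c, y i c • w c = x) (c : ι) :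
    ∑ i ∈ S, y i c • z i = 0 := by
  have hexp : ∀ (f : Module.Dual K (Fin k → K)) (v : Fin k → K),
      f v = ∑ r, v r * f (Pi.single r 1) := by
    intro f v
    conv_lhs => rw [pi_eq_sum_univ' v]
    simp [Pi.single]
  refine LinearMap.pi_ext' fun r => LinearMap.ext_ring ?_
  obtain ⟨D, hDm, hDw⟩ := hD c r
  set dz : J → Fin k → K := fun i r' => D (z i (Pi.single r' 1)) with hdz
  -- derivative of the sum relation
  have h1 : ∀ r', ∑ i ∈ S, dz i r' = 0 := by
    intro r'
    have := congrArg (fun f => D (f (Pi.single r' 1))) hsum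
    simpa [hdz, LinearMap.sum_apply] using this
  -- derivative of the annihilation relation
  have h2 : ∀ i ∈ S, ∀ d ∈ B i,
      ∑ r', w d r' * dz i r' = - if d = c then z i (Pi.single r 1) else 0 := by
    intro i hi d hd
    have h := congrArg D ((hexp (z i) (w d)).symm.trans (hz i hi d hd))
    rw [map_sum, map_zero] at h
    simp only [hDm, hDw, Finset.sum_add_distrib] at h
    rw [eq_neg_iff_add_eq_zero]
    have h5 : (if d = c then z i (Pi.single r 1) else 0) =
        ∑ r', (if d = c ∧ r' = r then 1 else 0) * z i (Pi.single r' 1) := by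
      by_cases hdc : d = c <;> simp [hdc]
    rw [h5]
    exact h
  have h3 : ∀ i ∈ S, ∑ r', x r' * dz i r' = - (y i c * z i (Pi.single r 1)) := by
    intro i hi
    rw [← hyx i hi]
    simp only [Finset.sum_apply, Pi.smul_apply, smul_eq_mul, Finset.sum_mul]
    rw [Finset.sum_comm]
    have : ∀ d, ∑ r', y i d * w d r' * dz i r' =
        if d = c then - (y i c * z i (Pi.single r 1)) else 0 := by
      intro d
      simp only [mul_assoc, ← Finset.mul_sum]
      by_cases hd : d ∈ B i
      · rw [h2 i hi d hd]
        by_cases hdc : d = c <;> simp [hdc]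
      · rw [hy i hi d hd]
        by_cases hdc : d = c
        · subst hdc
          simp [hy i hi d hd]
        · simp [hdc]
    simp [this]
  have h4 : ∑ i ∈ S, ∑ r', x r' * dz i r' = 0 := by
    rw [Finset.sum_comm]
    simp [← Finset.mul_sum, h1]
  rw [Finset.sum_congr rfl h3, Finset.sum_neg_distrib, neg_eq_zero] at h4
  simpa [LinearMap.sum_apply] using h4

/-- Iterating `aux_key`: relations split along the level sets of `y · c`. -/
lemma aux_split {J : Type*} (w : ι → Fin k → K)
    (hD : ∀ (c : ι) (r : Fin k), ∃ D : K →+ K, (∀ a b, D (a * b) = a * D b + D a * b) ∧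
      ∀ c' r', D (w c' r') = if c' = c ∧ r' = r then 1 else 0)
    (B : J → Finset ι) (S : Finset J)
    (z : J → Module.Dual K (Fin k → K)) (hz : ∀ i ∈ S, ∀ c ∈ B i, z i (w c) = 0)
    (hsum : ∑ i ∈ S, z i = 0)
    (x : Fin k → K) (y : J → ι → K) (hy : ∀ i ∈ S, ∀ c, c ∉ B i → y i c = 0)
    (hyx : ∀ i ∈ S, ∑ c, y i c • w c = x) (c : ι) (a : K) [DecidableEq K] :
    ∑ i ∈ S with y i c = a, z i = 0 := by
  have hstep : ∀ T : Finset K,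
      ∑ i ∈ S, (∏ t ∈ T, (y i c - t)) • z i = 0 := by
    intro T
    induction T using Finset.induction_on with
    | empty => simpa using hsum
    | insert t T ht ih =>
      have h := aux_key w hD B S (fun i => (∏ t ∈ T, (y i c - t)) • z i)
        (fun i hi d hd => by simp [hz i hi d hd]) ih x y hy hyx c
      have h' : ∑ i ∈ S, (∏ t ∈ insert t T, (y i c - t)) • z i =
          ∑ i ∈ S, y i c • (∏ t ∈ T, (y i c - t)) • z i -
            t • ∑ i ∈ S, (∏ t ∈ T, (y i c - t)) • z i := by
        rw [Finset.smul_sum, ← Finset.sum_sub_distrib]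
        refine Finset.sum_congr rfl fun i _ => ?_
        rw [Finset.prod_insert ht, mul_smul, sub_smul]
      rw [h', h, ih]
      simp
  have h := hstep ((S.image fun i => y i c).erase a)
  set T := (S.image fun i => y i c).erase a with hT
  have hne : ∏ t ∈ T, (a - t) ≠ 0 := by
    rw [Finset.prod_ne_zero_iff]
    intro t ht
    rw [sub_ne_zero]
    exact (Finset.ne_of_mem_erase ht).symm
  have h2 : ∑ i ∈ S, (∏ t ∈ T, (y i c - t)) • z i =
      (∏ t ∈ T, (a - t)) • ∑ i ∈ S with y i c = a, z i := by
    rw [Finset.smul_sum, Finset.sum_filter]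
    refine Finset.sum_congr rfl fun i hi => ?_
    split_ifs with hia
    · rw [hia]
    · rw [Finset.prod_eq_zero (i := y i c), zero_smul]
      · rw [hT, Finset.mem_erase]
        exact ⟨hia, Finset.mem_image_of_mem _ hi⟩
      · simp
  rw [h2] at h
  exact (smul_eq_zero.mp h).resolve_left hne

/-- Annihilator of a finite intersection. -/
lemma aux_ann_iInf {J : Type*} [DecidableEq J] (X : J → Submodule K (Fin k → K)) (S : Finset J) :
    (⨅ i ∈ S, X i).dualAnnihilator = ⨆ i ∈ S, (X i).dualAnnihilator := by
  induction S using Finset.induction_on with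
  | empty => simp
  | insert a S ha ih =>
    rw [Finset.iInf_insert, Finset.iSup_insert, ← ih]
    exact Subspace.dualAnnihilator_inf_eq _ _

/-- Gluing partitions of two disjoint sets. -/
def auxGlue {J : Type*} [DecidableEq J] {S p q : Finset J} (hpq : Disjoint p q)
    (hS : p ∪ q = S) (P : Finpartition p) (Q : Finpartition q) : Finpartition S where
  parts := P.parts ∪ Q.parts
  supIndep := by
    rw [Finset.supIndep_iff_pairwiseDisjoint]
    intro a ha b hb hab
    simp only [Finset.coe_union, Set.mem_union, Finset.mem_coe] at ha hb
    rcases ha with ha | ha <;> rcases hb with hb | hb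
    · exact P.disjoint ha hb hab
    · exact hpq.mono (P.le ha) (Q.le hb)
    · exact hpq.symm.mono (Q.le ha) (P.le hb)
    · exact Q.disjoint ha hb hab
  sup_parts := by
    rw [Finset.sup_union, P.sup_parts, Q.sup_parts]
    exact hS
  bot_notMem := by
    rw [Finset.mem_union, not_or]
    exact ⟨P.bot_notMem, Q.bot_notMem⟩

lemma auxGlue_disj {J : Type*} [DecidableEq J] {p q : Finset J} (hpq : Disjoint p q)
    (P : Finpartition p) (Q : Finpartition q) : Disjoint P.parts Q.parts := by
  rw [Finset.disjoint_left]
  intro a ha hb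
  have := hpq (P.le ha) (Q.le hb)
  exact P.bot_notMem ((le_bot_iff.mp this) ▸ ha)

/-- The intersection of the sets `B j` for `j ∈ p`. -/
def auxInter {J : Type*} (B : J → Finset ι) (p : Finset J) : Finset ι :=
  Finset.univ.filter fun c => ∀ j ∈ p, c ∈ B j

lemma aux_mem_inter {J : Type*} (B : J → Finset ι) (p : Finset J) (c : ι) :
    c ∈ auxInter B p ↔ ∀ j ∈ p, c ∈ B j := by
  simp [auxInter]

/-- Upper bound. -/
lemma aux_upper {J : Type*} [DecidableEq J] (w : ι → Fin k → K)
    (hD : ∀ (c : ι) (r : Fin k), ∃ D : K →+ K, (∀ a b, D (a * b) = a * D b + D a * b) ∧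
      ∀ c' r', D (w c' r') = if c' = c ∧ r' = r then 1 else 0)
    (B : J → Finset ι) (S : Finset J) : S.Nonempty →
    ∃ P : Finpartition S,
      (Module.finrank K ↥(⨅ i ∈ S, Submodule.span K (w '' (B i : Set ι))) : ℤ) ≤
        -(k : ℤ) * ((P.parts.card : ℤ) - 1) +
          ∑ p ∈ P.parts, ((auxInter B p).card : ℤ) := by
  classical
  induction S using Finset.strongInduction with
  | H S ih =>
  intro hS
  by_cases htriv : ∀ (x : Fin k → K) (y : J → ι → K), (∀ i ∈ S, ∀ c, c ∉ B i → y i c = 0) →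
      (∀ i ∈ S, ∑ c, y i c • w c = x) → ∀ c, ∀ i ∈ S, ∀ j ∈ S, y i c = y j c
  · refine ⟨Finpartition.indiscrete hS.ne_empty, ?_⟩
    simp only [Finpartition.indiscrete_parts, Finset.card_singleton, Nat.cast_one, sub_self,
      mul_zero, zero_add, Finset.sum_singleton, Nat.cast_le]
    set C := auxInter B S with hC
    have hle : (⨅ i ∈ S, Submodule.span K (w '' (B i : Set ι))) ≤
        Submodule.span K ((C.image w : Finset (Fin k → K)) : Set (Fin k → K)) := by
      intro x hx
      simp only [Submodule.mem_iInf] at hx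
      have hx' : ∀ i, ∃ y : ι → K, i ∈ S → (∀ c, c ∉ B i → y c = 0) ∧ ∑ c, y c • w c = x := by
        intro i
        by_cases hi : i ∈ S
        · obtain ⟨y, hy⟩ := (aux_mem_span w (B i) x).1 (hx i hi)
          exact ⟨y, fun _ => hy⟩
        · exact ⟨0, fun h => absurd h hi⟩
      choose y hy using hx'
      obtain ⟨i0, hi0⟩ := hS
      rw [Finset.coe_image, aux_mem_span]
      refine ⟨y i0, ?_, (hy i0 hi0).2⟩
      intro c hc
      simp only [hC, auxInter, Finset.mem_filter, Finset.mem_univ, true_and, not_forall] at hc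
      obtain ⟨j, hj, hcj⟩ := hc
      rw [htriv x y (fun i hi => (hy i hi).1) (fun i hi => (hy i hi).2) c i0 hi0 j hj]
      exact (hy j hj).1 c hcj
    exact (Submodule.finrank_mono hle).trans ((finrank_span_finset_le_card _).trans
      Finset.card_image_le)
  · push Not at htriv
    obtain ⟨x, y, hy, hyx, c, i0, hi0, j0, hj0, hne⟩ := htriv
    set p := S.filter fun i => y i c = y i0 c with hp
    set q := S.filter fun i => ¬ (y i c = y i0 c) with hq
    have hpq : Disjoint p q := Finset.disjoint_filter_filter_not _ _ _
    have hU : p ∪ q = S := Finset.filter_union_filter_not_eq _ _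
    have hpne : p.Nonempty := ⟨i0, by simp [hp, hi0]⟩
    have hqne : q.Nonempty := ⟨j0, by simp [hq, hj0, Ne.symm hne]⟩
    have hpS : p ⊂ S := by
      refine ⟨Finset.filter_subset _ _, fun h => ?_⟩
      have := h hj0
      simp [hp, Ne.symm hne] at this
    have hqS : q ⊂ S := by
      refine ⟨Finset.filter_subset _ _, fun h => ?_⟩
      have := h hi0
      simp [hq] at this
    obtain ⟨P, hP⟩ := ih p hpS hpne
    obtain ⟨Q, hQ⟩ := ih q hqS hqne
    refine ⟨auxGlue hpq hU P Q, ?_⟩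
    have hparts : (auxGlue hpq hU P Q).parts = P.parts ∪ Q.parts := rfl
    have hd := auxGlue_disj hpq P Q
    rw [hparts, Finset.card_union_of_disjoint hd, Finset.sum_union hd]
    set X : J → Submodule K (Fin k → K) := fun i => Submodule.span K (w '' (B i : Set ι)) with hX
    have hinf : (⨅ i ∈ S, X i) = (⨅ i ∈ p, X i) ⊓ ⨅ i ∈ q, X i := by
      rw [← hU, Finset.iInf_union]
    have htop : (⨅ i ∈ p, X i) ⊔ (⨅ i ∈ q, X i) = ⊤ := by
      rw [← Submodule.dualAnnihilator_eq_bot_iff, Submodule.dualAnnihilator_sup_eq,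
        aux_ann_iInf, aux_ann_iInf, eq_bot_iff]
      rintro ζ ⟨h1, h2⟩
      rw [SetLike.mem_coe, Submodule.mem_iSup_finset_iff_exists_sum] at h1 h2
      obtain ⟨z1, hz1⟩ := h1
      obtain ⟨z2, hz2⟩ := h2
      set z : J → Module.Dual K (Fin k → K) :=
        fun i => if y i c = y i0 c then (z1 i : Module.Dual K (Fin k → K)) else -(z2 i) with hzdef
      have hs1 : ∑ i ∈ p, z i = ζ := by
        rw [← hz1]
        refine Finset.sum_congr rfl fun i hi => ?_
        simp only [hzdef]
        rw [if_pos (Finset.mem_filter.1 hi).2]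
      have hs2 : ∑ i ∈ q, z i = -ζ := by
        rw [← hz2, ← Finset.sum_neg_distrib]
        refine Finset.sum_congr rfl fun i hi => ?_
        simp only [hzdef]
        rw [if_neg (Finset.mem_filter.1 hi).2]
      have hmem : ∀ i, ∀ d ∈ B i, z i (w d) = 0 := by
        intro i d hd
        have hwd : w d ∈ X i := Submodule.subset_span ⟨d, hd, rfl⟩
        simp only [hzdef]
        split_ifs
        · exact (Submodule.mem_dualAnnihilator _).1 (z1 i).2 _ hwd
        · rw [LinearMap.neg_apply, (Submodule.mem_dualAnnihilator _).1 (z2 i).2 _ hwd, neg_zero]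
      have hs : ∑ i ∈ S, z i = 0 := by
        rw [← hU, Finset.sum_union hpq, hs1, hs2, add_neg_cancel]
      have := aux_split w hD B S z (fun i _ => hmem i) hs x y hy hyx c (y i0 c)
      rw [← hp, hs1] at this
      exact this
    have hdim := Submodule.finrank_sup_add_finrank_inf_eq (⨅ i ∈ p, X i) (⨅ i ∈ q, X i)
    rw [htop, ← hinf, finrank_top, Module.finrank_fintype_fun_eq_card, Fintype.card_fin] at hdim
    have hdim' : (k : ℤ) + Module.finrank K ↥(⨅ i ∈ S, X i) =
        Module.finrank K ↥(⨅ i ∈ p, X i) + Module.finrank K ↥(⨅ i ∈ q, X i) := by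
      exact_mod_cast hdim
    push_cast
    linarith

lemma aux_upper_univ {J : Type*} [Fintype J] [DecidableEq J] (w : ι → Fin k → K)
    (hD : ∀ (c : ι) (r : Fin k), ∃ D : K →+ K, (∀ a b, D (a * b) = a * D b + D a * b) ∧
      ∀ c' r', D (w c' r') = if c' = c ∧ r' = r then 1 else 0)
    (B : J → Finset ι) (hne : (Finset.univ : Finset J).Nonempty) :
    ∃ P : Finpartition (Finset.univ : Finset J),
      (Module.finrank K ↥(⨅ i, Submodule.span K (w '' (B i : Set ι))) : ℤ) ≤
        -(k : ℤ) * ((P.parts.card : ℤ) - 1) +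
          ∑ p ∈ P.parts, ((auxInter B p).card : ℤ) := by
  obtain ⟨P, hP⟩ := aux_upper w hD B Finset.univ hne
  have h : (⨅ i ∈ (Finset.univ : Finset J), Submodule.span K (w '' (B i : Set ι))) =
      ⨅ i, Submodule.span K (w '' (B i : Set ι)) := by simp
  rw [h] at hP
  exact ⟨P, hP⟩

/-- Dimension of an intersection is at least the expected one. -/
lemma aux_lower_dim {T : Type*} [DecidableEq T] (Y : T → Submodule K (Fin k → K)) (S : Finset T) :
    ∑ p ∈ S, Module.finrank K (Y p) + k ≤ Module.finrank K ↥(⨅ p ∈ S, Y p) + k * S.card := by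
  induction S using Finset.induction_on with
  | empty =>
    have : (⨅ p ∈ (∅ : Finset T), Y p) = ⊤ := by simp
    rw [this, finrank_top, Module.finrank_fintype_fun_eq_card]
    simp
  | insert a S ha ih =>
    rw [Finset.sum_insert ha, Finset.iInf_insert, Finset.card_insert_of_notMem ha]
    have hdim := Submodule.finrank_sup_add_finrank_inf_eq (Y a) (⨅ i ∈ S, Y i)
    have hle := Submodule.finrank_le (Y a ⊔ (⨅ i ∈ S, Y i))
    rw [Module.finrank_fintype_fun_eq_card, Fintype.card_fin] at hle
    rw [mul_add, mul_one]
    omega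

lemma aux_lower {J : Type*} [Fintype J] [DecidableEq J] (w : ι → Fin k → K)
    (hind : ∀ C : Finset ι, C.card ≤ k → LinearIndependent K (fun c : C => w c))
    (B : J → Finset ι) (hB : ∀ i, (B i).card ≤ k) (P : Finpartition (Finset.univ : Finset J)) :
      -(k : ℤ) * ((P.parts.card : ℤ) - 1) +
          ∑ p ∈ P.parts, ((auxInter B p).card : ℤ) ≤
      (Module.finrank K ↥(⨅ i, Submodule.span K (w '' (B i : Set ι))) : ℤ) := by
  classical
  set C : Finset J → Finset ι := fun p => auxInter B p with hC
  have hle : (⨅ p ∈ P.parts, Submodule.span K (w '' (C p : Set ι))) ≤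
      ⨅ i, Submodule.span K (w '' (B i : Set ι)) := by
    refine le_iInf fun i => ?_
    obtain ⟨p, hp, hip⟩ := P.exists_mem (Finset.mem_univ i)
    refine (iInf₂_le p hp).trans (Submodule.span_mono (Set.image_mono ?_))
    intro c hc
    exact (aux_mem_inter B p c).1 hc i hip
  have h1 := Submodule.finrank_mono hle
  have h2 := aux_lower_dim (fun p => Submodule.span K (w '' (C p : Set ι))) P.parts
  have h3 : ∀ p ∈ P.parts, Module.finrank K (Submodule.span K (w '' (C p : Set ι))) =
      (C p).card := by
    intro p hp
    obtain ⟨j, hj⟩ := P.nonempty_of_mem_parts hp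
    have hsub : C p ⊆ B j := fun c hc => (aux_mem_inter B p c).1 hc j hj
    have := finrank_span_eq_card (hind (C p) ((Finset.card_le_card hsub).trans (hB j)))
    rw [Fintype.card_coe] at this
    rw [← this, Set.image_eq_range]
    rfl
  rw [Finset.sum_congr rfl h3] at h2
  have h4 : (∑ p ∈ P.parts, ((C p).card : ℤ)) + k ≤
      Module.finrank K ↥(⨅ i, Submodule.span K (w '' (B i : Set ι))) + k * P.parts.card := by
    have := h2.trans (Nat.add_le_add_right h1 _)
    exact_mod_cast this
  linarith

end GenericAux

/-- Partial derivatives on a field of rational functions. -/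
lemma aux_deriv (F : Type*) [Field F] {V : Type*} [DecidableEq V] (v : V) :
    ∃ D : FractionRing (MvPolynomial V F) →+ FractionRing (MvPolynomial V F),
      (∀ a b, D (a * b) = a * D b + D a * b) ∧
      ∀ u, D (algebraMap (MvPolynomial V F) _ (MvPolynomial.X u)) = if u = v then 1 else 0 := by
  set R := MvPolynomial V F
  set K := FractionRing R
  let g : R →ₐ[F] TrivSqZeroExt K K := MvPolynomial.aeval fun u =>
    TrivSqZeroExt.inl (algebraMap R K (MvPolynomial.X u)) +
      TrivSqZeroExt.inr (if u = v then 1 else 0)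
  have hfst : ∀ a, (g a).fst = algebraMap R K a := by
    intro a
    have : ((TrivSqZeroExt.fstHom F K K).comp g) = IsScalarTower.toAlgHom F R K := by
      refine MvPolynomial.algHom_ext fun u => ?_
      simp [g]
      rfl
    exact congrArg (fun f => f a) this
  have hunit : ∀ s : nonZeroDivisors R, IsUnit (g.toRingHom s) := by
    intro s
    rw [TrivSqZeroExt.isUnit_iff_isUnit_fst]
    have : (g.toRingHom (s : R)).fst = algebraMap R K s := hfst s
    rw [this]
    exact IsLocalization.map_units K s
  let G : K →+* TrivSqZeroExt K K := IsLocalization.lift hunit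
  have hG : ∀ a : R, G (algebraMap R K a) = g a := fun a => IsLocalization.lift_eq hunit a
  have hGfst : ∀ a, (G a).fst = a := by
    intro a
    have : ((TrivSqZeroExt.fstHom F K K).toRingHom.comp G) = RingHom.id K := by
      refine IsLocalization.ringHom_ext (nonZeroDivisors R) ?_
      ext a
      · simp [hG, hfst]
      · simp [hG, hfst]
    exact congrArg (fun f => f a) this
  refine ⟨{ toFun := fun a => (G a).snd, map_zero' := by simp, map_add' := by simp }, ?_, ?_⟩
  · intro a b
    simp [hGfst, mul_comm]
  · intro u
    have h : (G (algebraMap R K (MvPolynomial.X u))).snd = if u = v then 1 else 0 := by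
      have h6 : g (MvPolynomial.X u) = TrivSqZeroExt.inl (algebraMap R K (MvPolynomial.X u)) +
          TrivSqZeroExt.inr (if u = v then 1 else 0) := MvPolynomial.aeval_X _ _
      rw [hG, h6]
      simp
    exact h

/-- Columns of a matrix of independent variables are independent. -/
lemma aux_indep (F : Type*) [Field F] {V ι : Type*} [DecidableEq ι] [DecidableEq V] {k : ℕ}
    (e : ι → Fin k → V) (he : ∀ c r c' r', e c r = e c' r' → c = c' ∧ r = r')
    (C : Finset ι) (hC : C.card ≤ k) :
    LinearIndependent (FractionRing (MvPolynomial V F)) (fun c : C => fun r =>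
      algebraMap (MvPolynomial V F) (FractionRing (MvPolynomial V F))
        (MvPolynomial.X (e c r))) := by
  classical
  obtain ⟨ρ⟩ : Nonempty (C ↪ Fin k) := by
    rw [Function.Embedding.nonempty_iff_card_le]
    simpa using hC
  let M : Matrix C C (MvPolynomial V F) := fun c d => MvPolynomial.X (e c (ρ d))
  have hdet : M.det ≠ 0 := by
    intro h0
    let ev : MvPolynomial V F →ₐ[F] F := MvPolynomial.aeval fun u =>
      if ∃ c : C, u = e c (ρ c) then (1 : F) else 0
    have h1 : ev.toRingHom.mapMatrix M = 1 := by
      ext c d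
      have : (∃ a : C, e c (ρ d) = e a (ρ a)) ↔ c = d := by
        constructor
        · rintro ⟨a, ha⟩
          obtain ⟨h1, h2⟩ := he _ _ _ _ ha
          rw [Subtype.ext h1, ρ.injective h2]
        · rintro rfl
          exact ⟨c, rfl⟩
      have h3 : ev (M c d) = if c = d then 1 else 0 := by
        simp only [M, ev, MvPolynomial.aeval_X]
        exact if_congr this rfl rfl
      rw [Matrix.one_apply, ← h3]
      rfl
    have h2 := RingHom.map_det ev.toRingHom M
    rw [h1, h0, map_zero, Matrix.det_one] at h2
    exact zero_ne_one h2
  have hdet' : ((algebraMap (MvPolynomial V F) (FractionRing (MvPolynomial V F))).mapMatrix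
      M).det ≠ 0 := by
    rw [← RingHom.map_det]
    exact (map_ne_zero_iff _ (IsFractionRing.injective _ _)).2 hdet
  have hli := Matrix.linearIndependent_rows_of_det_ne_zero hdet'
  exact LinearIndependent.of_comp
    (LinearMap.funLeft (FractionRing (MvPolynomial V F)) (FractionRing (MvPolynomial V F)) ρ) hli

/-- Generic intersection dimension formula: for jointly generic matrices `W ∈ K^{k×b}`
and `W' ∈ K^{k×n}` and a proper configuration `(σ_i, A_i)_i`, the dimension of
`⋂_i (W_{≤σ_i} + W'_{A_i})` equals `gid_k((σ_i, A_i)_i)`. -/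
theorem generic_MDSb_intersection_formula
    (F : Type*) [Field F] (b k n : ℕ) (hb : 1 ≤ b) (hbk : b ≤ k) (hn : 1 ≤ n)
    (W : Matrix (Fin k) (Fin b)
      (FractionRing (MvPolynomial ((Fin k × Fin b) ⊕ (Fin k × Fin n)) F)))
    (W' : Matrix (Fin k) (Fin n)
      (FractionRing (MvPolynomial ((Fin k × Fin b) ⊕ (Fin k × Fin n)) F)))
    (hW : ∀ i j, W i j =
      algebraMap (MvPolynomial ((Fin k × Fin b) ⊕ (Fin k × Fin n)) F)
        (FractionRing (MvPolynomial ((Fin k × Fin b) ⊕ (Fin k × Fin n)) F))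
        (MvPolynomial.X (Sum.inl (i, j))))
    (hW' : ∀ i j, W' i j =
      algebraMap (MvPolynomial ((Fin k × Fin b) ⊕ (Fin k × Fin n)) F)
        (FractionRing (MvPolynomial ((Fin k × Fin b) ⊕ (Fin k × Fin n)) F))
        (MvPolynomial.X (Sum.inr (i, j))))
    (ℓ : ℕ) (hℓ : 1 ≤ ℓ)
    (σ : Fin ℓ → ℕ) (A : Fin ℓ → Finset (Fin n))
    (hσ : ∀ i, σ i ≤ b) (hproper : ∀ i, σ i + (A i).card ≤ k) :
    (Module.finrank (FractionRing (MvPolynomial ((Fin k × Fin b) ⊕ (Fin k × Fin n)) F))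
      ↥(⨅ i, colSpanLT W (σ i) ⊔ colSpan W' (A i)) : ℤ) = gid k σ A := by
  classical
  let e : Fin b ⊕ Fin n → Fin k → ((Fin k × Fin b) ⊕ (Fin k × Fin n)) := fun c r =>
    Sum.elim (fun j => Sum.inl (r, j)) (fun j => Sum.inr (r, j)) c
  have he : ∀ c r c' r', e c r = e c' r' → c = c' ∧ r = r' := by
    rintro (c | c) r (c' | c') r' h <;> simp [e] at h <;> simp [h]
  let w : Fin b ⊕ Fin n → Fin k → (FractionRing (MvPolynomial ((Fin k × Fin b) ⊕ (Fin k × Fin n)) F)) := fun c r =>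
    algebraMap (MvPolynomial ((Fin k × Fin b) ⊕ (Fin k × Fin n)) F) (FractionRing (MvPolynomial ((Fin k × Fin b) ⊕ (Fin k × Fin n)) F)) (MvPolynomial.X (e c r))
  have hD : ∀ (c : Fin b ⊕ Fin n) (r : Fin k), ∃ D : (FractionRing (MvPolynomial ((Fin k × Fin b) ⊕ (Fin k × Fin n)) F)) →+ (FractionRing (MvPolynomial ((Fin k × Fin b) ⊕ (Fin k × Fin n)) F)),
      (∀ a b, D (a * b) = a * D b + D a * b) ∧
      ∀ c' r', D (w c' r') = if c' = c ∧ r' = r then 1 else 0 := by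
    intro c r
    obtain ⟨D, h1, h2⟩ := aux_deriv F (e c r)
    refine ⟨D, h1, fun c' r' => (h2 (e c' r')).trans (if_congr ?_ rfl rfl)⟩
    constructor
    · exact he _ _ _ _
    · rintro ⟨rfl, rfl⟩
      rfl
  have hind : ∀ C : Finset (Fin b ⊕ Fin n), C.card ≤ k →
      LinearIndependent (FractionRing (MvPolynomial ((Fin k × Fin b) ⊕ (Fin k × Fin n)) F)) (fun c : C => w c) := fun C hC => aux_indep F e he C hC
  let B : Fin ℓ → Finset (Fin b ⊕ Fin n) := fun i =>
    (Finset.univ.filter fun j : Fin b => (j : ℕ) < σ i).disjSum (A i)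
  have hcard : ∀ m, m ≤ b → (Finset.univ.filter fun j : Fin b => (j : ℕ) < m).card = m := by
    intro m hm
    rw [Fin.card_filter_val_lt]
    omega
  have hB : ∀ i, (B i).card ≤ k := by
    intro i
    simp only [B, Finset.card_disjSum, hcard _ (hσ i)]
    exact hproper i
  have hspan : ∀ i, colSpanLT W (σ i) ⊔ colSpan W' (A i) =
      Submodule.span (FractionRing (MvPolynomial ((Fin k × Fin b) ⊕ (Fin k × Fin n)) F)) (w '' (B i : Set (Fin b ⊕ Fin n))) := by
    intro i
    rw [colSpanLT, colSpan, ← Submodule.span_union]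
    congr 1
    ext x
    simp only [Set.mem_union, Set.mem_image, Finset.mem_coe, B, Sum.exists, Finset.inl_mem_disjSum,
      Finset.inr_mem_disjSum, Finset.mem_filter, Finset.mem_univ, true_and, Set.mem_ofPred_eq]
    have h1 : ∀ j, (fun i => W i j) = w (Sum.inl j) := fun j => funext fun i => hW i j
    have h2 : ∀ j, (fun i => W' i j) = w (Sum.inr j) := fun j => funext fun i => hW' i j
    simp only [h1, h2]
  have hinter : ∀ p : Finset (Fin ℓ), p.Nonempty →
      (auxInter B p).card =
        partMin σ p + (interSet A p).card := by
    intro p hp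
    have hne : (σ '' (p : Set (Fin ℓ))).Nonempty := hp.to_set.image σ
    have hmin : ∀ x : ℕ, x < partMin σ p ↔ ∀ j ∈ p, x < σ j := by
      intro x
      constructor
      · intro hx j hj
        exact hx.trans_le (Nat.sInf_le ⟨j, hj, rfl⟩)
      · intro h
        obtain ⟨j, hj, hjj⟩ := Nat.sInf_mem hne
        rw [partMin, ← hjj]
        exact h j hj
    have hle : partMin σ p ≤ b := by
      obtain ⟨j, hj⟩ := hp
      have h : partMin σ p ≤ σ j := Nat.sInf_le ⟨j, hj, rfl⟩
      exact h.trans (hσ j)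
    have : (auxInter B p) =
        (Finset.univ.filter fun j : Fin b => (j : ℕ) < partMin σ p).disjSum (interSet A p) := by
      ext c
      rcases c with c | c
      · simp [auxInter, B, hmin]
      · simp [auxInter, B, interSet]
    rw [this, Finset.card_disjSum, hcard _ hle]
  have hval : ∀ P : Finpartition (Finset.univ : Finset (Fin ℓ)),
      ∑ p ∈ P.parts, ((auxInter B p).card : ℤ) =
        ∑ p ∈ P.parts, ((partMin σ p : ℤ) + ((interSet A p).card : ℤ)) := by
    intro P
    refine Finset.sum_congr rfl fun p hp => ?_
    rw [hinter p (P.nonempty_of_mem_parts hp)]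
    push_cast
    rfl
  have hne : (Finset.univ : Finset (Fin ℓ)).Nonempty := ⟨⟨0, hℓ⟩, Finset.mem_univ _⟩
  rw [iInf_congr hspan]
  have hlow := aux_lower w hind B hB
  obtain ⟨P, hP⟩ := aux_upper_univ w hD B hne
  have hPeq := le_antisymm hP (hlow P)
  simp only [hval] at hlow hPeq
  rw [gid]
  symm
  apply IsGreatest.csSup_eq
  constructor
  · exact ⟨P, hPeq⟩
  · rintro v ⟨Q, rfl⟩
    exact hlow Q
end
end

section
/- Let F be a field, 1 ≤ b ≤ k, n ≥ 1, U ∈ F^{k×b}, V ∈ F^{k×n}, and suppose (U,V) is MDSb(1), i.e. for every σ ∈ {0,…,b} and A ⊆ {1,…,n}, dim(U_{≤σ} + V_A) = min(σ + |A|, k). Fix ℓ ≥ 1. Then the following are equivalent: (a) for every proper configuration (σ_1,A_1),…,(σ_ℓ,A_ℓ) (σ_i ∈ {0,…,b}, σ_i + |A_i| ≤ k), dim(⋂_{i=1}^ℓ (U_{≤σ_i} + V_{A_i})) = gid_k((σ_i,A_i)_i); (b) for every maximal configuration (σ_1,A_1),…,(σ_ℓ,A_ℓ) — that is, a proper configuration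 with Σ_{i=1}^ℓ (σ_i + |A_i|) = (ℓ−1)·k and such that for every partition of {1,…,ℓ} into nonempty parts P_1,…,P_s, Σ_{i=1}^s (min_{j∈P_i} σ_j + |⋂_{j∈P_i} A_j|) ≤ (s−1)·k — we have ⋂_{i=1}^ℓ (U_{≤σ_i} + V_{A_i}) = 0. -/
open Finset Matrix

noncomputable section

/-- The combinatorial size of the part `J`. -/
def csz {ℓ n : ℕ} (σ : Fin ℓ → ℕ) (A : Fin ℓ → Finset (Fin n)) (J : Finset (Fin ℓ)) : ℕ :=
  partMin σ J + (interSet A J).card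

/-- Feasibility of a weight vector `δ`. -/
def Feas {ℓ n : ℕ} (k : ℕ) (σ : Fin ℓ → ℕ) (A : Fin ℓ → Finset (Fin n)) (δ : Fin ℓ → ℕ) : Prop :=
  ∀ J : Finset (Fin ℓ), J.Nonempty → csz σ A J + ∑ i ∈ J, δ i ≤ k

section comb
variable {ℓ n : ℕ} {k : ℕ} {σ : Fin ℓ → ℕ} {A : Fin ℓ → Finset (Fin n)} {δ : Fin ℓ → ℕ}

lemma partMin_le {J : Finset (Fin ℓ)} {j : Fin ℓ} (h : j ∈ J) : partMin σ J ≤ σ j :=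
  Nat.sInf_le ⟨j, by simpa using h, rfl⟩

lemma exists_partMin {J : Finset (Fin ℓ)} (h : J.Nonempty) : ∃ j ∈ J, σ j = partMin σ J := by
  have : (σ '' (J : Set (Fin ℓ))).Nonempty := by
    obtain ⟨j, hj⟩ := h
    exact ⟨σ j, j, by simpa using hj, rfl⟩
  obtain ⟨j, hj, e⟩ := Nat.sInf_mem this
  exact ⟨j, by simpa using hj, e⟩

lemma le_partMin {J : Finset (Fin ℓ)} (h : J.Nonempty) {m : ℕ} (hm : ∀ j ∈ J, m ≤ σ j) :
    m ≤ partMin σ J := by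
  obtain ⟨j, hj, e⟩ := exists_partMin (σ := σ) h
  rw [← e]; exact hm j hj

lemma mem_interSet {J : Finset (Fin ℓ)} {x : Fin n} :
    x ∈ interSet A J ↔ ∀ j ∈ J, x ∈ A j := by
  simp [interSet]

lemma interSet_anti {J K : Finset (Fin ℓ)} (h : J ⊆ K) : interSet A K ⊆ interSet A J := by
  intro x hx
  rw [mem_interSet] at *
  exact fun j hj => hx j (h hj)

lemma partMin_anti {J K : Finset (Fin ℓ)} (hJ : J.Nonempty) (h : J ⊆ K) :
    partMin σ K ≤ partMin σ J :=
  le_partMin hJ fun _ hj => partMin_le (h hj)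

lemma csz_le {J : Finset (Fin ℓ)} {j : Fin ℓ} (h : j ∈ J) : csz σ A J ≤ σ j + (A j).card := by
  apply Nat.add_le_add (partMin_le h)
  apply Finset.card_le_card
  intro x hx
  exact mem_interSet.1 hx j h

lemma csz_super {J K : Finset (Fin ℓ)} (h : (J ∩ K).Nonempty) :
    csz σ A J + csz σ A K ≤ csz σ A (J ∪ K) + csz σ A (J ∩ K) := by
  have hJ : J.Nonempty := h.mono Finset.inter_subset_left
  have hK : K.Nonempty := h.mono Finset.inter_subset_right
  have e : interSet A (J ∪ K) = interSet A J ∩ interSet A K := by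
    ext x
    simp only [mem_interSet, Finset.mem_inter, Finset.mem_union]
    constructor
    · intro h; exact ⟨fun j hj => h j (Or.inl hj), fun j hj => h j (Or.inr hj)⟩
    · rintro ⟨h1, h2⟩ j (hj | hj)
      exacts [h1 j hj, h2 j hj]
  have s : interSet A J ∪ interSet A K ⊆ interSet A (J ∩ K) :=
    Finset.union_subset (interSet_anti Finset.inter_subset_left)
      (interSet_anti Finset.inter_subset_right)
  have s' := Finset.card_le_card s
  have c := Finset.card_union_add_card_inter (interSet A J) (interSet A K)
  have a1 := partMin_anti (σ := σ) h Finset.inter_subset_left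
  have a2 := partMin_anti (σ := σ) h Finset.inter_subset_right
  have a3 : min (partMin σ J) (partMin σ K) ≤ partMin σ (J ∪ K) := by
    apply le_partMin (hJ.mono Finset.subset_union_left)
    intro j hj
    rcases Finset.mem_union.1 hj with hj | hj
    · exact (min_le_left _ _).trans (partMin_le hj)
    · exact (min_le_right _ _).trans (partMin_le hj)
  unfold csz
  rw [e]
  omega

lemma tight_union_inter (hF : Feas k σ A δ) {J K : Finset (Fin ℓ)} (h : (J ∩ K).Nonempty)
    (hJ : csz σ A J + ∑ i ∈ J, δ i = k) (hK : csz σ A K + ∑ i ∈ K, δ i = k) :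
    csz σ A (J ∪ K) + ∑ i ∈ J ∪ K, δ i = k ∧ csz σ A (J ∩ K) + ∑ i ∈ J ∩ K, δ i = k := by
  have h1 := hF _ h
  have h2 := hF (J ∪ K) (h.mono (Finset.inter_subset_left.trans Finset.subset_union_left))
  have h3 := csz_super (σ := σ) (A := A) h
  have h4 := Finset.sum_union_inter (s₁ := J) (s₂ := K) (f := δ)
  omega

lemma sum_update_add_one (J : Finset (Fin ℓ)) (i : Fin ℓ) (δ : Fin ℓ → ℕ) :
    ∑ j ∈ J, (δ j + if j = i then 1 else 0) = ∑ j ∈ J, δ j + if i ∈ J then 1 else 0 := by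
  rw [Finset.sum_add_distrib]
  simp

lemma sum_parts (P : Finpartition (Finset.univ : Finset (Fin ℓ))) (f : Fin ℓ → ℕ) :
    ∑ p ∈ P.parts, ∑ i ∈ p, f i = ∑ i, f i := by
  have := Finset.sum_biUnion (f := f) (s := P.parts) (t := id) P.disjoint
  simp only [id] at this
  rw [← this]
  congr 1
  exact P.biUnion_parts

lemma exists_tight_partition (hp : ∀ i, σ i + (A i).card ≤ k) :
    ∃ (δ : Fin ℓ → ℕ) (P : Finpartition (Finset.univ : Finset (Fin ℓ))), Feas k σ A δ ∧
      (∀ p ∈ P.parts, csz σ A p + ∑ i ∈ p, δ i = k) ∧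
      (∀ J : Finset (Fin ℓ), J.Nonempty → csz σ A J + ∑ i ∈ J, δ i = k →
        ∃ p ∈ P.parts, J ⊆ p) := by
  classical
  obtain ⟨δ, hF, hmax⟩ : ∃ δ, Feas k σ A δ ∧ ∀ δ', Feas k σ A δ' → ∑ i, δ' i ≤ ∑ i, δ i := by
    let S : Set ℕ := {m | ∃ δ, Feas k σ A δ ∧ ∑ i, δ i = m}
    have hne : S.Nonempty := by
      refine ⟨_, fun _ => 0, ?_, rfl⟩
      rintro J ⟨j, hj⟩
      have := csz_le (σ := σ) (A := A) hj
      have := hp j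
      simp; omega
    have hb : BddAbove S := by
      refine ⟨ℓ * k, ?_⟩
      rintro m ⟨δ, hδ, rfl⟩
      calc ∑ i, δ i ≤ ∑ _i : Fin ℓ, k := by
            apply Finset.sum_le_sum
            intro i _
            have := hδ {i} (by simp)
            simp at this; omega
        _ = ℓ * k := by simp
    obtain ⟨δ, hδ, e⟩ := Nat.sSup_mem hne hb
    refine ⟨δ, hδ, fun δ' h' => ?_⟩
    rw [e]
    exact le_csSup hb ⟨δ', h', rfl⟩
  have htight : ∀ i, ∃ J : Finset (Fin ℓ), i ∈ J ∧ csz σ A J + ∑ j ∈ J, δ j = k := by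
    intro i
    by_contra hcon
    push Not at hcon
    have hF' : Feas k σ A (fun j => δ j + if j = i then 1 else 0) := by
      intro J hJ
      rw [sum_update_add_one]
      have h1 := hF J hJ
      split_ifs with h
      · have := hcon J h
        omega
      · omega
    have := hmax _ hF'
    rw [sum_update_add_one] at this
    simp at this
  have hM : ∀ i, ∃ M : Finset (Fin ℓ), (i ∈ M ∧ csz σ A M + ∑ j ∈ M, δ j = k) ∧
      ∀ J : Finset (Fin ℓ), (J ∩ M).Nonempty → csz σ A J + ∑ j ∈ J, δ j = k → J ⊆ M := by
    intro i
    let T := (Finset.univ : Finset (Finset (Fin ℓ))).filter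
      fun J => i ∈ J ∧ csz σ A J + ∑ j ∈ J, δ j = k
    have hT : T.Nonempty := by
      obtain ⟨J, hJ⟩ := htight i
      exact ⟨J, by simpa [T] using hJ⟩
    obtain ⟨M, hMT, hMmax⟩ := Finset.exists_max_image T Finset.card hT
    have hM1 : i ∈ M ∧ csz σ A M + ∑ j ∈ M, δ j = k := by simpa [T] using hMT
    refine ⟨M, hM1, fun J hJM hJ => ?_⟩
    have hu := (tight_union_inter hF hJM hJ hM1.2).1
    have hle := hMmax (J ∪ M) (by simp [T, hM1.1, hu])
    have := Finset.eq_of_subset_of_card_le (Finset.subset_union_right (s₁ := J) (s₂ := M)) hle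
    rw [this]; exact Finset.subset_union_left
  choose M hM1 hM2 using hM
  have hMM : ∀ i j, (M i ∩ M j).Nonempty → M i = M j := by
    intro i j h
    refine Finset.Subset.antisymm (hM2 j _ h (hM1 i).2) (hM2 i _ ?_ (hM1 j).2)
    rwa [Finset.inter_comm]
  let P : Finpartition (Finset.univ : Finset (Fin ℓ)) :=
    { parts := Finset.univ.image M
      supIndep := by
        rw [Finset.supIndep_iff_pairwiseDisjoint]
        intro p hp q hq hne
        simp only [Finset.coe_image, Finset.coe_univ, Set.image_univ, Set.mem_range] at hp hq
        obtain ⟨i, rfl⟩ := hp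
        obtain ⟨j, rfl⟩ := hq
        by_contra hd
        apply hne
        apply hMM
        simp only [Function.onFun, id] at hd
        rwa [Finset.not_disjoint_iff_nonempty_inter] at hd
      sup_parts := by
        ext i
        simp only [Finset.mem_sup, Finset.mem_univ, iff_true]
        exact ⟨M i, by simp, (hM1 i).1⟩
      bot_notMem := by
        intro h
        simp only [Finset.mem_image] at h
        obtain ⟨i, _, e⟩ := h
        have := (hM1 i).1
        rw [e] at this
        simp at this }
  refine ⟨δ, P, hF, ?_, ?_⟩
  · intro p hp
    simp only [P, Finset.mem_image] at hp
    obtain ⟨i, _, rfl⟩ := hp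
    exact (hM1 i).2
  · rintro J ⟨j, hj⟩ hJ
    refine ⟨M j, by simp [P], hM2 j J ⟨j, ?_⟩ hJ⟩
    simp [hj, (hM1 j).1]

lemma interSet_update_of_notMem {J : Finset (Fin ℓ)} {i : Fin ℓ} (h : i ∉ J)
    (B : Finset (Fin n)) : interSet (Function.update A i B) J = interSet A J := by
  ext x
  simp only [mem_interSet]
  refine forall₂_congr fun j hj => ?_
  rw [Function.update_of_ne]
  rintro rfl; exact h hj

lemma partMin_update_of_notMem {J : Finset (Fin ℓ)} {i : Fin ℓ} (h : i ∉ J)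
    (m : ℕ) : partMin (Function.update σ i m) J = partMin σ J := by
  unfold partMin
  congr 1
  apply Set.image_congr
  intro j hj
  rw [Function.update_of_ne]
  rintro rfl; exact h (by simpa using hj)

lemma interSet_update_subset {J : Finset (Fin ℓ)} {i : Fin ℓ}
    {B : Finset (Fin n)} (hB : B ⊆ A i) : interSet (Function.update A i B) J ⊆ interSet A J := by
  intro x hx
  rw [mem_interSet] at *
  intro j hj
  have := hx j hj
  by_cases e : j = i
  · subst e; simp at this; exact hB this
  · rwa [Function.update_of_ne e] at this

lemma partMin_update_le {J : Finset (Fin ℓ)} {i : Fin ℓ} (hJ : J.Nonempty)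
    {m : ℕ} (hm : m ≤ σ i) : partMin (Function.update σ i m) J ≤ partMin σ J := by
  obtain ⟨j, hj, e⟩ := exists_partMin (σ := σ) hJ
  rw [← e]
  refine (partMin_le hj).trans ?_
  by_cases e : j = i
  · subst e; simpa using hm
  · rw [Function.update_of_ne e]

lemma exists_extension {i0 : Fin ℓ} (hi0 : ∀ j, j ≠ i0 → k - n ≤ σ j)
    (hF : Feas k σ A δ) (hδ : ∑ i, δ i = k) :
    ∃ A' : Fin ℓ → Finset (Fin n), (∀ i, A i ⊆ A' i) ∧ Feas k σ A' δ ∧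
      ∀ i, σ i + (A' i).card + δ i = k := by
  classical
  let T := (Finset.univ : Finset (Fin ℓ → Finset (Fin n))).filter
    fun A' => (∀ i, A i ⊆ A' i) ∧ Feas k σ A' δ
  obtain ⟨A', hA'T, hmax⟩ := Finset.exists_max_image T (fun A' => ∑ i, (A' i).card)
    ⟨A, by simp [T, hF]⟩
  have hA' : (∀ i, A i ⊆ A' i) ∧ Feas k σ A' δ := by simpa [T] using hA'T
  obtain ⟨hsub, hF'⟩ := hA'
  refine ⟨A', hsub, hF', ?_⟩
  by_contra hcon
  push Not at hcon
  obtain ⟨i, hi⟩ := hcon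
  have c1 : csz σ A' {i} = σ i + (A' i).card := by
    simp [csz, partMin, interSet]
  have hlt : σ i + (A' i).card + δ i < k := by
    have := hF' {i} (by simp)
    rw [c1] at this
    simp at this
    omega
  let TT := (Finset.univ : Finset (Finset (Fin ℓ))).filter
      fun J => i ∈ J ∧ csz σ A' J + ∑ j ∈ J, δ j = k
  have hT : TT.Nonempty := by
    refine ⟨Finset.univ, ?_⟩
    have := hF' Finset.univ ⟨i, by simp⟩
    simp only [TT, Finset.mem_filter, Finset.mem_univ, true_and]
    omega
  obtain ⟨J0, hJ0T, hmin⟩ := Finset.exists_min_image TT Finset.card hT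
  have hJ0 : i ∈ J0 ∧ csz σ A' J0 + ∑ j ∈ J0, δ j = k := by simpa [TT] using hJ0T
  have hJmin : ∀ J : Finset (Fin ℓ), i ∈ J → csz σ A' J + ∑ j ∈ J, δ j = k → J0 ⊆ J := by
    intro J hiJ hJ
    have hne : (J ∩ J0).Nonempty := ⟨i, by simp [hiJ, hJ0.1]⟩
    have hu := (tight_union_inter hF' hne hJ hJ0.2).2
    have hle := hmin (J ∩ J0) (by simp [TT, hiJ, hJ0.1, hu])
    have := Finset.eq_of_subset_of_card_le (Finset.inter_subset_right (s₁ := J) (s₂ := J0)) hle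
    rw [← this]; exact Finset.inter_subset_left
  have hK : (J0.erase i).Nonempty := by
    rw [Finset.nonempty_iff_ne_empty]
    intro he
    have : J0 = {i} := by
      rw [← Finset.insert_erase hJ0.1, he]
      rfl
    have h2 := hJ0.2
    rw [this, c1] at h2
    simp at h2
    omega
  have hx : ∃ x, x ∉ interSet A' (J0.erase i) ∪ A' i := by
    by_contra hall
    push Not at hall
    have hall' : interSet A' (J0.erase i) ∪ A' i = Finset.univ := by
      ext x; simpa using hall x
    have hcard := Finset.card_union_add_card_inter (interSet A' (J0.erase i)) (A' i)
    rw [hall', Finset.card_univ, Fintype.card_fin] at hcard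
    have e : interSet A' (J0.erase i) ∩ A' i = interSet A' J0 := by
      ext x
      simp only [Finset.mem_inter, mem_interSet, Finset.mem_erase]
      constructor
      · rintro ⟨h1, h2⟩ j hj
        by_cases e : j = i
        · rw [e]; exact h2
        · exact h1 j ⟨e, hj⟩
      · intro h
        exact ⟨fun j hj => h j hj.2, h i hJ0.1⟩
    rw [e] at hcard
    have f1 := hF' _ hK
    have f2 := hJ0.2
    rw [← Finset.add_sum_erase _ _ hJ0.1] at f2
    have f3 : partMin σ J0 ≤ σ i := partMin_le hJ0.1
    have f4 : partMin σ J0 ≤ partMin σ (J0.erase i) := partMin_anti hK (Finset.erase_subset _ _)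
    have f5 : k - n ≤ σ i ∨ k - n ≤ partMin σ (J0.erase i) := by
      by_cases e : i = i0
      · right
        apply le_partMin hK
        intro j hj
        apply hi0
        rw [← e]; exact Finset.ne_of_mem_erase hj
      · left; exact hi0 i e
    unfold csz at f1 f2
    omega
  obtain ⟨x, hx⟩ := hx
  rw [Finset.mem_union, not_or] at hx
  obtain ⟨hxK, hxi⟩ := hx
  let B := Function.update A' i (insert x (A' i))
  have hFB : Feas k σ B δ := by
    intro J hJ
    by_cases hiJ : i ∈ J
    · by_cases ht : csz σ A' J + ∑ j ∈ J, δ j = k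
      · have hs := hJmin J hiJ ht
        have : interSet B J ⊆ interSet A' J := by
          intro y hy
          rw [mem_interSet] at *
          have hyx : y ≠ x := by
            rintro rfl
            apply hxK
            intro j hj
            have := hy j (hs (Finset.mem_of_mem_erase hj))
            simp only [B] at this
            rwa [Function.update_of_ne (Finset.ne_of_mem_erase hj)] at this
          intro j hj
          have := hy j hj
          simp only [B] at this
          by_cases e : j = i
          · subst e
            simpa [hyx] using this
          · rwa [Function.update_of_ne e] at this
        have := Finset.card_le_card this
        unfold csz at *
        omega
      · have h1 := hF' J hJ
        have : interSet B J ⊆ insert x (interSet A' J) := by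
          intro y hy
          rw [Finset.mem_insert]
          by_cases hyx : y = x
          · left; exact hyx
          right
          rw [mem_interSet] at *
          intro j hj
          have := hy j hj
          simp only [B] at this
          by_cases e : j = i
          · subst e
            simpa [hyx] using this
          · rwa [Function.update_of_ne e] at this
        have := (Finset.card_le_card this).trans (Finset.card_insert_le _ _)
        unfold csz at *
        omega
    · unfold csz
      simp only [B]
      rw [interSet_update_of_notMem hiJ]
      exact hF' J hJ
  have hBs : ∀ j, A' j ⊆ B j := by
    intro j
    by_cases e : j = i
    · subst e; simp [B]
    · simp [B, Function.update_of_ne e]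
  have hle := hmax B (by
    simp only [T, Finset.mem_filter, Finset.mem_univ, true_and]
    exact ⟨fun j => (hsub j).trans (hBs j), hFB⟩)
  have hlt : ∑ j, (A' j).card < ∑ j, (B j).card := by
    apply Finset.sum_lt_sum
    · exact fun j _ => Finset.card_le_card (hBs j)
    · refine ⟨i, Finset.mem_univ _, ?_⟩
      simp [B, Finset.card_insert_of_notMem hxi]
  omega

lemma exists_reduce {δ : Fin ℓ → ℕ} (h : k ≤ ∑ i, δ i) :
    ∃ δ' : Fin ℓ → ℕ, (∀ i, δ' i ≤ δ i) ∧ ∑ i, δ' i = k := by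
  classical
  obtain ⟨m, hm⟩ := Nat.exists_eq_add_of_le h
  induction m generalizing δ with
  | zero => exact ⟨δ, fun _ => le_rfl, by omega⟩
  | succ m ih =>
    obtain ⟨i, hi⟩ : ∃ i, 0 < δ i := by
      by_contra hc
      push Not at hc
      have : ∑ i, δ i = 0 := Finset.sum_eq_zero fun i _ => Nat.le_zero.1 (hc i)
      omega
    have hs := Finset.sum_update_of_mem (Finset.mem_univ i) δ (δ i - 1)
    have hs2 := Finset.add_sum_erase Finset.univ δ (Finset.mem_univ i)
    rw [← Finset.erase_eq] at hs
    obtain ⟨δ', h1, h2⟩ := ih (δ := Function.update δ i (δ i - 1)) (by omega) (by omega)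
    refine ⟨δ', fun j => (h1 j).trans ?_, h2⟩
    by_cases e : j = i
    · subst e; simp
    · simp [Function.update_of_ne e]

lemma Feas.mono {δ' : Fin ℓ → ℕ} (hF : Feas k σ A δ) (h : ∀ i, δ' i ≤ δ i) : Feas k σ A δ' :=
  fun J hJ => (Nat.add_le_add_left (Finset.sum_le_sum fun i _ => h i) _).trans (hF J hJ)

lemma sum_csz_le (hF : Feas k σ A δ) (P : Finpartition (Finset.univ : Finset (Fin ℓ))) :
    ∑ p ∈ P.parts, csz σ A p + ∑ i, δ i ≤ P.parts.card * k := by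
  rw [← sum_parts P, ← Finset.sum_add_distrib, ← smul_eq_mul]
  apply Finset.sum_le_card_nsmul
  intro p hp
  exact hF p (P.nonempty_of_mem_parts hp)

/-- Raising the `σ`'s. -/
lemma exists_raise (hp : ∀ i, σ i + (A i).card ≤ k) (hF : Feas k σ A δ) (hδ : k ≤ ∑ i, δ i)
    {i0 : Fin ℓ} (hi0 : σ i0 = 0) :
    ∃ δ', Feas k (fun j => if j = i0 then 0 else max (σ j) (k - n)) A δ' ∧ k ≤ ∑ i, δ' i := by
  classical
  set τ : Fin ℓ → ℕ := fun j => if j = i0 then 0 else max (σ j) (k - n) with hτ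
  have hAn : ∀ B : Finset (Fin n), B.card ≤ n := fun B => by
    simpa using Finset.card_le_univ B
  have hp' : ∀ i, τ i + (A i).card ≤ k := by
    intro i
    have := hp i
    have := hAn (A i)
    simp only [hτ]
    split_ifs <;> omega
  obtain ⟨δ', P, hF', hP, hmax⟩ := exists_tight_partition hp'
  refine ⟨δ', hF', ?_⟩
  obtain ⟨p0, hp0, hi0p⟩ := P.exists_mem (Finset.mem_univ i0)
  have hτ0 : τ i0 = 0 := by simp [hτ]
  have hkey : ∀ p ∈ P.parts, csz τ A p ≤ csz σ A p := by
    intro p hpP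
    have hpne := P.nonempty_of_mem_parts hpP
    by_cases e : p = p0
    · subst e
      have h1 := partMin_le (σ := τ) hi0p
      unfold csz
      omega
    have hdis : Disjoint p p0 := P.disjoint hpP hp0 e
    have hgt : k - n < partMin τ p ∨ k - n = 0 := by
      by_contra hcon
      have hcon1 : partMin τ p ≤ k - n := by omega
      have hcon2 : k - n ≠ 0 := by omega
      have t1 := hP p hpP
      have t2 := hP p0 hp0
      have t3 := hF' (p ∪ p0) (hpne.mono Finset.subset_union_left)
      have t4 := Finset.sum_union hdis (f := δ')
      have t5 : partMin τ p0 ≤ 0 := hτ0 ▸ partMin_le hi0p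
      have t6 := Finset.card_union_add_card_inter (interSet A p) (interSet A p0)
      have t7 := hAn (interSet A p ∪ interSet A p0)
      have t8 : interSet A p ∩ interSet A p0 ⊆ interSet A (p ∪ p0) := by
        intro x hx
        rw [Finset.mem_inter, mem_interSet, mem_interSet] at hx
        rw [mem_interSet]
        intro j hj
        rcases Finset.mem_union.1 hj with hj | hj
        exacts [hx.1 j hj, hx.2 j hj]
      have t9 := Finset.card_le_card t8
      have tt : csz τ A (p ∪ p0) + ∑ i ∈ p ∪ p0, δ' i = k := by
        unfold csz at *
        omega
      obtain ⟨q, hq, hsub⟩ := hmax _ (hpne.mono Finset.subset_union_left) tt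
      have q1 : p = q := by
        by_contra hne
        obtain ⟨j, hj⟩ := hpne
        exact Finset.disjoint_left.1 (P.disjoint hpP hq hne) hj
          (hsub (Finset.mem_union_left _ hj))
      have q2 : p0 = q := by
        by_contra hne
        exact Finset.disjoint_left.1 (P.disjoint hp0 hq hne) hi0p
          (hsub (Finset.mem_union_right _ hi0p))
      exact e (q1.trans q2.symm)
    obtain ⟨j, hj, ej⟩ := exists_partMin (σ := σ) hpne
    have h1 := partMin_le (σ := τ) hj
    have h2 : τ j ≤ max (σ j) (k - n) := by
      simp only [hτ]; split_ifs <;> omega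
    have h3 : partMin τ p ≤ partMin σ p := by
      rw [← ej]
      rcases hgt with hgt | hgt <;> rcases max_cases (σ j) (k - n) with hm | hm <;> omega
    unfold csz
    omega
  have h1 := sum_csz_le hF P
  have h2 := Finset.sum_le_sum hkey
  have h3 : ∑ p ∈ P.parts, csz τ A p + ∑ i, δ' i = P.parts.card * k := by
    rw [← sum_parts P, ← Finset.sum_add_distrib, ← smul_eq_mul]
    exact Finset.sum_const_nat hP
  omega

/-- Removing one element. -/
lemma exists_removal (hℓ : 1 ≤ ℓ) {P : Finpartition (Finset.univ : Finset (Fin ℓ))}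
    (hF : Feas k σ A δ) (hP : ∀ p ∈ P.parts, csz σ A p + ∑ i ∈ p, δ i = k)
    (hmax : ∀ J : Finset (Fin ℓ), J.Nonempty → csz σ A J + ∑ i ∈ J, δ i = k →
        ∃ p ∈ P.parts, J ⊆ p) (hlt : ∑ i, δ i < k) :
    ∃ (i : Fin ℓ) (s : ℕ) (B : Finset (Fin n)), s ≤ σ i ∧ B ⊆ A i ∧
      s + B.card + 1 = σ i + (A i).card ∧
      Feas k (Function.update σ i s) (Function.update A i B)
        (fun j => δ j + if j = i then 1 else 0) := by
  classical
  obtain ⟨p, hp, _⟩ := P.exists_mem (Finset.mem_univ (⟨0, hℓ⟩ : Fin ℓ))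
  have hpos : 0 < csz σ A p := by
    have h1 := hP p hp
    have h2 : ∑ i ∈ p, δ i ≤ ∑ i, δ i := Finset.sum_le_sum_of_subset (Finset.subset_univ _)
    omega
  have hpne := P.nonempty_of_mem_parts hp
  have hin : ∀ i ∈ p, ∀ J : Finset (Fin ℓ), i ∈ J → csz σ A J + ∑ i ∈ J, δ i = k → J ⊆ p := by
    intro i hi J hiJ hJ
    obtain ⟨q, hq, hs⟩ := hmax J ⟨i, hiJ⟩ hJ
    have : q = p := by
      by_contra hne
      exact Finset.disjoint_left.1 (P.disjoint hq hp hne) (hs hiJ) hi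
    rwa [← this]
  by_cases hI : (interSet A p).Nonempty
  · obtain ⟨x, hx⟩ := hI
    obtain ⟨i, hi⟩ := hpne
    have hxi : x ∈ A i := mem_interSet.1 hx i hi
    refine ⟨i, σ i, (A i).erase x, le_rfl, Finset.erase_subset _ _, ?_, ?_⟩
    · have := Finset.card_erase_add_one hxi
      omega
    rw [Function.update_eq_self]
    intro J hJ
    rw [sum_update_add_one]
    have h1 := hF J hJ
    by_cases hiJ : i ∈ J
    · rw [if_pos hiJ]
      have hs := interSet_update_subset (A := A) (J := J) (Finset.erase_subset x (A i))
      have hs1 := Finset.card_le_card hs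
      by_cases ht : csz σ A J + ∑ i ∈ J, δ i = k
      · have hsub := hin i hi J hiJ ht
        have hxJ : x ∈ interSet A J := interSet_anti hsub hx
        have hss : interSet (Function.update A i ((A i).erase x)) J ⊂ interSet A J := by
          refine Finset.ssubset_iff_of_subset hs |>.2 ⟨x, hxJ, fun hx' => ?_⟩
          have := mem_interSet.1 hx' i hiJ
          simp at this
        have := Finset.card_lt_card hss
        unfold csz at *
        omega
      · unfold csz at *
        omega
    · rw [if_neg hiJ]
      unfold csz
      rw [interSet_update_of_notMem hiJ]
      exact h1
  · obtain ⟨i, hi, ei⟩ := exists_partMin (σ := σ) hpne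
    have hpm : 0 < partMin σ p := by
      rw [Finset.not_nonempty_iff_eq_empty] at hI
      simpa [csz, hI] using hpos
    refine ⟨i, σ i - 1, A i, by omega, subset_rfl, by omega, ?_⟩
    rw [Function.update_eq_self]
    intro J hJ
    rw [sum_update_add_one]
    have h1 := hF J hJ
    by_cases hiJ : i ∈ J
    · rw [if_pos hiJ]
      have hs := partMin_update_le (σ := σ) (i := i) hJ (Nat.sub_le (σ i) 1)
      by_cases ht : csz σ A J + ∑ i ∈ J, δ i = k
      · have hsub := hin i hi J hiJ ht
        have h2 := partMin_anti (σ := σ) hJ hsub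
        have h3 := partMin_le (σ := Function.update σ i (σ i - 1)) hiJ
        simp at h3
        unfold csz at *
        omega
      · unfold csz at *
        omega
    · rw [if_neg hiJ]
      unfold csz
      rw [partMin_update_of_notMem hiJ]
      exact h1

end comb

section lin
variable {F : Type*} [Field F] {b k n ℓ : ℕ}
  {U : Matrix (Fin k) (Fin b) F} {V : Matrix (Fin k) (Fin n) F}

lemma colSpanLT_mono {s t : ℕ} (h : s ≤ t) : colSpanLT U s ≤ colSpanLT U t :=
  Submodule.span_mono (Set.image_mono fun _ hj => lt_of_lt_of_le hj h)

lemma colSpan_mono {B C : Finset (Fin n)} (h : B ⊆ C) : colSpan V B ≤ colSpan V C :=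
  Submodule.span_mono (Set.image_mono (by exact_mod_cast h))

lemma codim_inf_le {ι : Type*} [DecidableEq ι] (s : Finset ι)
    (X : ι → Submodule F (Fin k → F)) :
    (k : ℤ) - Module.finrank F ↥(s.inf X) ≤ ∑ p ∈ s, ((k : ℤ) - Module.finrank F ↥(X p)) := by
  induction s using Finset.induction_on with
  | empty => rw [Finset.inf_empty, finrank_top]; simp
  | insert a s ha ih =>
    rw [Finset.sum_insert ha, Finset.inf_insert]
    have h1 := Submodule.finrank_sup_add_finrank_inf_eq (X a) (s.inf X)
    have h2 : Module.finrank F ↥(X a ⊔ s.inf X) ≤ k := by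
      simpa using Submodule.finrank_le (X a ⊔ s.inf X)
    omega

lemma boolean_case
    (h : Module.finrank F ↥(colSpanLT U b ⊔ colSpan V Finset.univ) = b + n)
    {σ : Fin ℓ → ℕ} {A : Fin ℓ → Finset (Fin n)} {i0 : Fin ℓ} (h0 : σ i0 = 0)
    (hA : interSet A Finset.univ = ∅) :
    (⨅ i, colSpanLT U (σ i) ⊔ colSpan V (A i)) = ⊥ := by
  classical
  let w : Fin b ⊕ Fin n → (Fin k → F) := Sum.elim (fun j i => U i j) (fun j i => V i j)
  have hspan : ∀ (s : ℕ) (B : Finset (Fin n)), colSpanLT U s ⊔ colSpan V B =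
      Submodule.span F (w '' (Sum.inl '' {j : Fin b | (j : ℕ) < s} ∪ Sum.inr '' (B : Set (Fin n)))) := by
    intro s B
    rw [Set.image_union, Submodule.span_union, Set.image_image, Set.image_image]
    rfl
  have hli : LinearIndependent F w := by
    rw [linearIndependent_iff_card_eq_finrank_span]
    rw [hspan] at h
    have e : (Sum.inl '' {j : Fin b | (j : ℕ) < b} ∪ Sum.inr '' ((Finset.univ : Finset (Fin n)) : Set (Fin n)))
        = (Set.univ : Set (Fin b ⊕ Fin n)) := by
      ext x; rcases x with x | x <;> simp
    rw [e, Set.image_univ] at h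
    rw [Set.finrank, h]
    simp
  rw [eq_bot_iff]
  intro x hx
  rw [Submodule.mem_iInf] at hx
  have hx' : ∀ i, ∃ l ∈ Finsupp.supported F F (Sum.inl '' {j : Fin b | (j : ℕ) < σ i} ∪
      Sum.inr '' (A i : Set (Fin n))), Finsupp.linearCombination F w l = x := by
    intro i
    have := hx i
    rw [hspan, Finsupp.mem_span_image_iff_linearCombination] at this
    exact this
  choose l hl1 hl2 using hx'
  have heq : ∀ i, l i = l i0 := fun i => hli ((hl2 i).trans (hl2 i0).symm)
  have hz : l i0 = 0 := by
    ext y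
    by_contra hy
    have hy' : y ∈ (l i0).support := by simpa using hy
    have hall : ∀ i, y ∈ (Sum.inl '' {j : Fin b | (j : ℕ) < σ i} ∪
      Sum.inr '' (A i : Set (Fin n)) : Set (Fin b ⊕ Fin n)) := by
      intro i
      have := hl1 i
      rw [heq i, Finsupp.mem_supported] at this
      exact this hy'
    rcases y with y | y
    · have := hall i0
      simp [h0] at this
    · have : y ∈ interSet A Finset.univ := by
        rw [mem_interSet]
        intro j _
        simpa using hall j
      rw [hA] at this
      simp at this
  rw [← hl2 i0, hz]
  simp

/-- The hypothesis `MDSb(1)`. -/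
def MDS1 (U : Matrix (Fin k) (Fin b) F) (V : Matrix (Fin k) (Fin n) F) : Prop :=
  ∀ σ : ℕ, σ ≤ b → ∀ A : Finset (Fin n),
      Module.finrank F ↥(colSpanLT U σ ⊔ colSpan V A) = min (σ + A.card) k

/-- Vanishing for maximal configurations. -/
def MaxVan (ℓ : ℕ) (U : Matrix (Fin k) (Fin b) F) (V : Matrix (Fin k) (Fin n) F) : Prop :=
  ∀ (σ : Fin ℓ → ℕ) (A : Fin ℓ → Finset (Fin n)),
        (∀ i, σ i ≤ b) → (∀ i, σ i + (A i).card ≤ k) →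
        (∑ i, (σ i + (A i).card)) = (ℓ - 1) * k →
        (∀ P : Finpartition (Finset.univ : Finset (Fin ℓ)),
          ∑ p ∈ P.parts, (partMin σ p + (interSet A p).card) ≤ (P.parts.card - 1) * k) →
        (⨅ i, colSpanLT U (σ i) ⊔ colSpan V (A i)) = ⊥

lemma base_case (hℓ : 1 ≤ ℓ) (h1 : MDS1 U V) (h2 : MaxVan ℓ U V)
    {σ : Fin ℓ → ℕ} {A : Fin ℓ → Finset (Fin n)} {δ : Fin ℓ → ℕ}
    (hσ : ∀ i, σ i ≤ b) (hp : ∀ i, σ i + (A i).card ≤ k)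
    (hF : Feas k σ A δ) (hδ : k ≤ ∑ i, δ i) :
    (⨅ i, colSpanLT U (σ i) ⊔ colSpan V (A i)) = ⊥ := by
  classical
  have hne : (Finset.univ : Finset (Fin ℓ)).Nonempty := ⟨⟨0, hℓ⟩, by simp⟩
  have hu := hF Finset.univ hne
  obtain ⟨i0, _, hi0⟩ := exists_partMin (σ := σ) hne
  have hc : csz σ A Finset.univ = 0 := by omega
  have h0 : σ i0 = 0 := by unfold csz at hc; omega
  have hA0 : interSet A Finset.univ = ∅ := by
    rw [← Finset.card_eq_zero]; unfold csz at hc; omega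
  by_cases hbn : b + n < k
  · refine boolean_case ?_ h0 hA0
    rw [h1 b le_rfl]
    simp; omega
  obtain ⟨δ1, hF1, hδ1⟩ := exists_raise hp hF hδ h0
  obtain ⟨δ2, hle, hδ2⟩ := exists_reduce hδ1
  obtain ⟨A', hAA, hF3, heq⟩ := exists_extension (i0 := i0)
    (fun j hj => by simp [hj]) (hF1.mono hle) hδ2
  obtain ⟨τ, hτ⟩ : ∃ τ : Fin ℓ → ℕ, τ = fun j => if j = i0 then 0 else max (σ j) (k - n) :=
    ⟨_, rfl⟩
  rw [← hτ] at hF3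
  replace heq : ∀ i, τ i + (A' i).card + δ2 i = k := by rw [hτ]; exact heq
  have hστ : ∀ i, σ i ≤ τ i := by
    intro i
    simp only [hτ]
    split_ifs with e
    · rw [e, h0]
    · exact le_max_left _ _
  have hbot := h2 τ A' (by
      intro i
      have := hσ i
      simp only [hτ]
      split_ifs <;> omega) (fun i => by have := heq i; omega) (by
      have : ∑ i, (τ i + (A' i).card) + ∑ i, δ2 i = ℓ * k := by
        rw [← Finset.sum_add_distrib, Finset.sum_congr rfl fun i _ => heq i]
        simp
      rw [Nat.sub_mul]; omega) (by
      intro P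
      have := sum_csz_le hF3 P
      unfold csz at this
      rw [Nat.sub_mul]; omega)
  rw [eq_bot_iff, ← hbot]
  exact iInf_mono fun i => sup_le_sup (colSpanLT_mono (hστ i)) (colSpan_mono (hAA i))

lemma upper (hℓ : 1 ≤ ℓ) (h1 : MDS1 U V) (h2 : MaxVan ℓ U V) (d : ℕ) :
    ∀ {σ : Fin ℓ → ℕ} {A : Fin ℓ → Finset (Fin n)} {δ : Fin ℓ → ℕ}
    (_ : ∀ i, σ i ≤ b) (_ : ∀ i, σ i + (A i).card ≤ k)
    (_ : Feas k σ A δ) (_ : k ≤ ∑ i, δ i + d),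
    Module.finrank F ↥(⨅ i, colSpanLT U (σ i) ⊔ colSpan V (A i)) ≤ d := by
  classical
  induction d with
  | zero =>
    intro σ A δ hσ hp hF hδ
    rw [base_case hℓ h1 h2 hσ hp hF (by omega)]
    simp
  | succ d ih =>
    intro σ A δ hσ hp hF hδ
    obtain ⟨δ', P, hF', hP, hmax⟩ := exists_tight_partition hp
    have hge : ∑ i, δ i ≤ ∑ i, δ' i := by
      have h3 : ∑ p ∈ P.parts, csz σ A p + ∑ i, δ' i = P.parts.card * k := by
        rw [← sum_parts P, ← Finset.sum_add_distrib]
        exact Finset.sum_const_nat hP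
      have := sum_csz_le hF P
      omega
    by_cases hk : k ≤ ∑ i, δ' i
    · exact (ih hσ hp hF' (by omega)).trans (by omega)
    obtain ⟨i, s, B, hs, hB, hc, hF''⟩ := exists_removal hℓ hF' hP hmax (by omega)
    set σ' := Function.update σ i s with hσ'
    set A' := Function.update A i B with hA'
    have hσle : ∀ j, σ' j ≤ σ j := by
      intro j
      by_cases e : j = i
      · subst e; simpa [hσ'] using hs
      · simp [hσ', Function.update_of_ne e]
    have hAle : ∀ j, A' j ⊆ A j := by
      intro j
      by_cases e : j = i
      · subst e; simpa [hA'] using hB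
      · simp [hA', Function.update_of_ne e]
    have key := ih (σ := σ') (A := A') (fun j => (hσle j).trans (hσ j))
      (fun j => (Nat.add_le_add (hσle j) (Finset.card_le_card (hAle j))).trans (hp j)) hF'' (by
        rw [sum_update_add_one]; simp; omega)
    set D := ⨅ i, colSpanLT U (σ i) ⊔ colSpan V (A i) with hD
    set Y := colSpanLT U s ⊔ colSpan V B with hY
    have hYX : Y ≤ colSpanLT U (σ i) ⊔ colSpan V (A i) :=
      sup_le_sup (colSpanLT_mono hs) (colSpan_mono hB)
    have hDX : D ≤ colSpanLT U (σ i) ⊔ colSpan V (A i) := iInf_le _ i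
    have e1 := Submodule.finrank_sup_add_finrank_inf_eq D Y
    have e2 : Module.finrank F ↥(D ⊔ Y) ≤ σ i + (A i).card := by
      have := Submodule.finrank_mono (sup_le hDX hYX)
      rw [h1 _ (hσ i)] at this
      omega
    have e3 : Module.finrank F ↥Y = min (s + B.card) k := h1 s (hs.trans (hσ i)) B
    have e4 : D ⊓ Y ≤ ⨅ j, colSpanLT U (σ' j) ⊔ colSpan V (A' j) := by
      refine le_iInf fun j => ?_
      by_cases e : j = i
      · subst e
        simp only [hσ', hA', Function.update_self]
        exact inf_le_right
      · simp only [hσ', hA', Function.update_of_ne e]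
        exact inf_le_left.trans (iInf_le _ j)
    have e5 := Submodule.finrank_mono e4
    have := hp i
    omega

lemma gid_bdd (m : ℕ) (σ : Fin ℓ → ℕ) (A : Fin ℓ → Finset (Fin n)) :
    BddAbove { v : ℤ | ∃ P : Finpartition (Finset.univ : Finset (Fin ℓ)),
    v = -(m : ℤ) * ((P.parts.card : ℤ) - 1)
      + ∑ p ∈ P.parts, ((partMin σ p : ℤ) + ((interSet A p).card : ℤ)) } := by
  have : { v : ℤ | ∃ P : Finpartition (Finset.univ : Finset (Fin ℓ)),
    v = -(m : ℤ) * ((P.parts.card : ℤ) - 1)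
      + ∑ p ∈ P.parts, ((partMin σ p : ℤ) + ((interSet A p).card : ℤ)) } =
      Set.range (fun P : Finpartition (Finset.univ : Finset (Fin ℓ)) =>
        -(m : ℤ) * ((P.parts.card : ℤ) - 1)
      + ∑ p ∈ P.parts, ((partMin σ p : ℤ) + ((interSet A p).card : ℤ))) := by
    ext v; simp [eq_comm]
  rw [this]
  exact (Set.finite_range _).bddAbove

lemma le_gid (m : ℕ) (σ : Fin ℓ → ℕ) (A : Fin ℓ → Finset (Fin n))
    (P : Finpartition (Finset.univ : Finset (Fin ℓ))) :
    (m : ℤ) + ∑ p ∈ P.parts, (csz σ A p : ℤ) - P.parts.card * m ≤ gid m σ A := by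
  refine le_csSup (gid_bdd m σ A) ⟨P, ?_⟩
  simp only [csz]
  push_cast
  ring

lemma gid_le (m : ℕ) (σ : Fin ℓ → ℕ) (A : Fin ℓ → Finset (Fin n)) {c : ℤ}
    (h : ∀ P : Finpartition (Finset.univ : Finset (Fin ℓ)),
      (m : ℤ) + ∑ p ∈ P.parts, (csz σ A p : ℤ) - P.parts.card * m ≤ c) : gid m σ A ≤ c := by
  apply csSup_le
  · exact ⟨_, ⊥, rfl⟩
  · rintro v ⟨P, rfl⟩
    refine le_trans (le_of_eq ?_) (h P)
    simp only [csz]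
    push_cast
    ring

lemma gid_le_finrank (h1 : MDS1 U V)
    {σ : Fin ℓ → ℕ} {A : Fin ℓ → Finset (Fin n)}
    (hσ : ∀ i, σ i ≤ b) (hp : ∀ i, σ i + (A i).card ≤ k) :
    gid k σ A ≤ (Module.finrank F ↥(⨅ i, colSpanLT U (σ i) ⊔ colSpan V (A i)) : ℤ) := by
  classical
  apply gid_le
  intro P
  let X : Finset (Fin ℓ) → Submodule F (Fin k → F) :=
    fun p => colSpanLT U (partMin σ p) ⊔ colSpan V (interSet A p)
  have hX : ∀ p ∈ P.parts, Module.finrank F ↥(X p) = csz σ A p := by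
    intro p hpP
    obtain ⟨j, hj⟩ := P.nonempty_of_mem_parts hpP
    have a1 := partMin_le (σ := σ) hj
    have a2 := csz_le (σ := σ) (A := A) hj
    have a3 := hp j
    simp only [X]
    rw [h1 _ (a1.trans (hσ j))]
    unfold csz at *
    omega
  have hle : P.parts.inf X ≤ ⨅ i, colSpanLT U (σ i) ⊔ colSpan V (A i) := by
    refine le_iInf fun i => ?_
    obtain ⟨p, hpP, hi⟩ := P.exists_mem (Finset.mem_univ i)
    refine (Finset.inf_le hpP).trans (sup_le_sup (colSpanLT_mono (partMin_le hi))
      (colSpan_mono fun x hx => mem_interSet.1 hx i hi))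
  have c1 := codim_inf_le P.parts X
  have c2 := Submodule.finrank_mono hle
  have c3 : ∑ p ∈ P.parts, ((k : ℤ) - Module.finrank F ↥(X p)) =
      P.parts.card * k - ∑ p ∈ P.parts, (csz σ A p : ℤ) := by
    rw [Finset.sum_sub_distrib]
    congr 1
    · simp
    · exact Finset.sum_congr rfl fun p hp => by rw [hX p hp]
  rw [c3] at c1
  have c2' : (Module.finrank F ↥(P.parts.inf X) : ℤ) ≤
    Module.finrank F ↥(⨅ i, colSpanLT U (σ i) ⊔ colSpan V (A i)) := by exact_mod_cast c2
  linarith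

lemma finrank_le_gid (hℓ : 1 ≤ ℓ) (h1 : MDS1 U V) (h2 : MaxVan ℓ U V)
    {σ : Fin ℓ → ℕ} {A : Fin ℓ → Finset (Fin n)}
    (hσ : ∀ i, σ i ≤ b) (hp : ∀ i, σ i + (A i).card ≤ k) :
    (Module.finrank F ↥(⨅ i, colSpanLT U (σ i) ⊔ colSpan V (A i)) : ℤ) ≤ gid k σ A := by
  classical
  obtain ⟨δ, P, hF, hP, -⟩ := exists_tight_partition hp
  have hsum : ∑ p ∈ P.parts, csz σ A p + ∑ i, δ i = P.parts.card * k := by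
    rw [← sum_parts P, ← Finset.sum_add_distrib]
    exact Finset.sum_const_nat hP
  have hup := upper hℓ h1 h2 (k - ∑ i, δ i) hσ hp hF (by omega)
  have hg := le_gid k σ A P
  have hsum' : ∑ p ∈ P.parts, (csz σ A p : ℤ) + ((∑ i, δ i : ℕ) : ℤ) = P.parts.card * k := by
    exact_mod_cast hsum
  have hg0 : 0 ≤ gid k σ A := by
    have hne : (Finset.univ : Finset (Fin ℓ)) ≠ ⊥ := by
      have : (Finset.univ : Finset (Fin ℓ)).Nonempty := ⟨⟨0, hℓ⟩, by simp⟩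
      exact this.ne_empty
    have := le_gid k σ A (Finpartition.indiscrete hne)
    simp at this
    omega
  omega

end lin

/-- For an `MDSb(1)` pair `(U, V)`, being `MDSb(ℓ)` (the dimension formula for all
proper configurations) is equivalent to the vanishing of the intersections for all
maximal configurations. -/
theorem MDSb_iff_maximal_configurations
    (F : Type*) [Field F] (b k n ℓ : ℕ) (hb : 1 ≤ b) (hbk : b ≤ k) (hn : 1 ≤ n)
    (hℓ : 1 ≤ ℓ)
    (U : Matrix (Fin k) (Fin b) F) (V : Matrix (Fin k) (Fin n) F)
    (hMDSb1 : ∀ σ : ℕ, σ ≤ b → ∀ A : Finset (Fin n),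
      Module.finrank F ↥(colSpanLT U σ ⊔ colSpan V A) = min (σ + A.card) k) :
    (∀ (σ : Fin ℓ → ℕ) (A : Fin ℓ → Finset (Fin n)),
        (∀ i, σ i ≤ b) → (∀ i, σ i + (A i).card ≤ k) →
        (Module.finrank F ↥(⨅ i, colSpanLT U (σ i) ⊔ colSpan V (A i)) : ℤ) = gid k σ A)
    ↔ (∀ (σ : Fin ℓ → ℕ) (A : Fin ℓ → Finset (Fin n)),
        (∀ i, σ i ≤ b) → (∀ i, σ i + (A i).card ≤ k) →
        (∑ i, (σ i + (A i).card)) = (ℓ - 1) * k →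
        (∀ P : Finpartition (Finset.univ : Finset (Fin ℓ)),
          ∑ p ∈ P.parts, (partMin σ p + (interSet A p).card) ≤ (P.parts.card - 1) * k) →
        (⨅ i, colSpanLT U (σ i) ⊔ colSpan V (A i)) = ⊥) := by
  constructor
  · intro ha σ A hσ hp _ hP
    have h := ha σ A hσ hp
    have hg : gid k σ A ≤ 0 := by
      apply gid_le
      intro P
      have h1 := hP P
      have hpos : 1 ≤ P.parts.card := by
        obtain ⟨p, hp, _⟩ := P.exists_mem (Finset.mem_univ (⟨0, hℓ⟩ : Fin ℓ))
        exact Finset.card_pos.2 ⟨p, hp⟩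
      have h2 : ((∑ p ∈ P.parts, csz σ A p : ℕ) : ℤ) ≤ ((P.parts.card - 1) * k : ℕ) := by
        exact_mod_cast h1
      push_cast [hpos] at h2
      linarith
    have h0 : Module.finrank F ↥(⨅ i, colSpanLT U (σ i) ⊔ colSpan V (A i)) = 0 := by omega
    exact Submodule.finrank_eq_zero.1 h0
  · intro hb' σ A hσ hp
    exact le_antisymm (finrank_le_gid hℓ hMDSb1 hb' hσ hp) (gid_le_finrank hMDSb1 hσ hp)
end
end

section
/- Let F be a field, let k, n, r ≥ 1, and let f_1, …, f_k ∈ F[x_1,…,x_r] (multivariate polynomials, MvPolynomial (Fin r) F) be linearly independent over F. Let K := FractionField (MvPolynomial (Fin n × Fin r) F) and for j = 1,…,n let α_j ∈ K^r be the tuple whose t-th coordinate is the image of the variable X_{(j,t)}. Let V ∈ K^{k×n} be the matrix V_{i,j} := f_i(α_j) (evaluation via the algebra map into K). Then for every ℓ ≥ 2 and every family A_1, …, A_ℓ of subsets of {1,…,n} with |A_i| ≤ k for all i, with |A_1| + ⋯ + |A_ℓ| = (ℓ−1)·k, and having the dimension-k null intersection property, the intersection V_{A_1} ∩ ⋯ ∩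 V_{A_ℓ} of the column-span subspaces is the zero subspace of K^k. (In other words, generic polynomial codes are MDS(ℓ) for all ℓ ≥ 2.) -/
open Finset Matrix

noncomputable section

/-- A prime ideal of a domain embedded in a field is the centre of a valuation ring. -/
theorem exists_place {B K : Type*} [CommRing B] [Field K] (ψ : B →+* K)
    (hψ : Function.Injective ψ) (P : Ideal B) [P.IsPrime] :
    ∃ (O : ValuationSubring K) (h : ∀ b, ψ b ∈ O),
      ∀ b, (⟨ψ b, h b⟩ : O) ∈ IsLocalRing.maximalIdeal O ↔ b ∈ P := by
  have hu : ∀ y : P.primeCompl, IsUnit (ψ y) := by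
    intro y
    rw [isUnit_iff_ne_zero]
    intro h0
    have : (y : B) = 0 := hψ (by simpa using h0)
    exact y.2 (this ▸ P.zero_mem)
  let g : Localization.AtPrime P →+* K := IsLocalization.lift (M := P.primeCompl) hu
  obtain ⟨O, h, hl⟩ := IsLocalRing.exists_factor_valuationRing g
  have hg : ∀ b, g (algebraMap B _ b) = ψ b := fun b => by simp [g]
  refine ⟨O, fun b => hg b ▸ h _, fun b => ?_⟩
  have e : (⟨ψ b, hg b ▸ h _⟩ : O) = (g.codRestrict O.toSubring h) (algebraMap B _ b) := by
    apply Subtype.ext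
    exact (hg b).symm
  rw [e, IsLocalRing.mem_maximalIdeal, mem_nonunits_iff]
  have h2 : IsUnit ((g.codRestrict O.toSubring h) (algebraMap B _ b)) ↔
      IsUnit (algebraMap B (Localization.AtPrime P) b) :=
    ⟨fun hh => hl.map_nonunit _ hh, fun hh => hh.map _⟩
  refine (not_congr h2).trans ?_
  rw [IsLocalization.AtPrime.isUnit_to_map_iff (Localization.AtPrime P) P b]
  simp [Ideal.primeCompl]

/-- Scaling a finite nonzero family into a valuation ring, one entry becoming `1`. -/
theorem exists_scale {K X : Type*} [Field K] [Finite X] (O : ValuationSubring K)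
    (c : X → K) (hc : ∃ x, c x ≠ 0) :
    ∃ (a : K) (c' : X → O), (∀ x, (c' x : K) = a * c x) ∧ ∃ x, c' x = 1 := by
  classical
  obtain ⟨x1, hx1⟩ := hc
  have : Nonempty X := ⟨x1⟩
  obtain ⟨x0, h0⟩ := Finite.exists_max (fun x => O.valuation (c x))
  have hx0 : c x0 ≠ 0 := by
    intro h
    have := h0 x1
    rw [h, map_zero, le_zero_iff, map_eq_zero] at this
    exact hx1 this
  have hm : ∀ x, (c x0)⁻¹ * c x ∈ O := by
    intro x
    rw [← O.valuation_le_one_iff, map_mul, map_inv₀]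
    have hv : O.valuation (c x0) ≠ 0 := by simpa using hx0
    rw [mul_comm]
    exact mul_inv_le_one_of_le₀ (h0 x) zero_le
  refine ⟨(c x0)⁻¹, fun x => ⟨_, hm x⟩, fun x => rfl, x0, ?_⟩
  apply Subtype.ext
  simp [hx0]

/-- Reduction of a finite nonzero family along a specialization `φ` of algebraically
independent elements. -/
theorem exists_reduction {F K τ X D : Type*} [Field F] [Field K] [Algebra F K]
    [CommRing D] [IsDomain D] [Algebra F D] [Finite X]
    (x : τ → K) (hx : AlgebraicIndependent F x) (φ : MvPolynomial τ F →ₐ[F] D)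
    (c : X → K) (hc : ∃ y, c y ≠ 0) :
    ∃ (O : ValuationSubring K) (_ : Algebra F (IsLocalRing.ResidueField O))
      (ψ : MvPolynomial τ F →+* O)
      (ρ : MvPolynomial τ F →ₐ[F] IsLocalRing.ResidueField O)
      (a : K) (c' : X → O),
      (∀ b, (ψ b : K) = MvPolynomial.aeval x b) ∧
      (∀ b, ρ b = IsLocalRing.residue O (ψ b)) ∧
      (∀ b, ρ b = 0 ↔ φ b = 0) ∧
      (∀ y, (c' y : K) = a * c y) ∧ ∃ y, c' y = 1 := by
  have hker : (RingHom.ker φ.toRingHom).IsPrime := RingHom.ker_isPrime φ.toRingHom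
  obtain ⟨O, h, hP⟩ := exists_place (MvPolynomial.aeval x : MvPolynomial τ F →ₐ[F] K).toRingHom hx
    (RingHom.ker φ.toRingHom)
  obtain ⟨a, c', h1, h2⟩ := exists_scale O c hc
  let ψ : MvPolynomial τ F →+* O :=
    (MvPolynomial.aeval x : MvPolynomial τ F →ₐ[F] K).toRingHom.codRestrict O.toSubring h
  let ρ0 : MvPolynomial τ F →+* IsLocalRing.ResidueField O := (IsLocalRing.residue O).comp ψ
  let alg : Algebra F (IsLocalRing.ResidueField O) := (ρ0.comp MvPolynomial.C).toAlgebra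
  let ρ : MvPolynomial τ F →ₐ[F] IsLocalRing.ResidueField O :=
    { ρ0 with commutes' := fun r => rfl }
  refine ⟨O, alg, ψ, ρ, a, c', fun b => rfl, fun b => rfl, fun b => ?_, h1, h2⟩
  have := hP b
  change IsLocalRing.residue O (ψ b) = 0 ↔ _
  rw [IsLocalRing.residue_eq_zero_iff]
  exact this

/-- `c` is the coefficient vector of a polynomial in the `σ`-th step of the flag vanishing at
the points of `A`. -/
def InP {F K ι : Type*} [Field F] [Field K] [Algebra F K] {k : ℕ} (f : Fin k → Polynomial F)
    (α : ι → K) (σ : ℕ) (A : Finset ι) (c : Fin k → K) : Prop :=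
  (∀ s : Fin k, (s : ℕ) < σ → c s = 0) ∧
    ∀ x ∈ A, ∑ s, c s * Polynomial.aeval (α x) (f s) = 0

/-- Specializing one of the generic points to the origin. -/
theorem merge {F : Type*} {K : Type*} {ι μ : Type*} [Field F] [Field K] [Algebra F K]
    [DecidableEq ι] [Finite μ] {k : ℕ} (d : Fin k → ℕ) (hd : StrictMono d)
    (u : Fin k → Polynomial F) (hu : ∀ s, (u s).coeff 0 ≠ 0)
    (α : ι → K) (J : Finset ι) (hα : AlgebraicIndependent F (fun x : J => α x))
    (j : ι) (hj : j ∈ J) (S : Finset μ) (σ : μ → ℕ) (A : μ → Finset ι)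
    (hA : ∀ i ∈ S, A i ⊆ J) (c : μ → Fin k → K)
    (hc : ∀ i ∈ S, InP (fun s => Polynomial.X ^ d s * u s) α (σ i) (A i) (c i))
    (hsum : ∑ i ∈ S, c i = 0) (hne : ∃ i ∈ S, c i ≠ 0) :
    ∃ (O : ValuationSubring K) (_ : Algebra F (IsLocalRing.ResidueField O))
      (α' : ι → IsLocalRing.ResidueField O) (c' : μ → Fin k → IsLocalRing.ResidueField O),
      AlgebraicIndependent F (fun x : (J.erase j : Finset ι) => α' x) ∧
      (∀ i ∈ S, InP (fun s => Polynomial.X ^ d s * u s) α'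
        (σ i + if j ∈ A i then 1 else 0) ((A i).erase j) (c' i)) ∧
      ∑ i ∈ S, c' i = 0 ∧ ∃ i ∈ S, c' i ≠ 0 := by
  classical
  let φ : MvPolynomial J F →ₐ[F] MvPolynomial J F :=
    MvPolynomial.aeval (fun x : J => if (x : ι) = j then 0 else MvPolynomial.X x)
  obtain ⟨i1, hi1, hc1⟩ := hne
  obtain ⟨s1, hs1⟩ := Function.ne_iff.mp hc1
  obtain ⟨O, alg, ψ, ρ, a, c', hψ, hρ, hker, hcc, ⟨⟨i0, hi0⟩, s0⟩, h01⟩ :=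
    exists_reduction (fun x : J => α x) hα φ (fun y : {i // i ∈ S} × Fin k => c y.1 y.2)
      ⟨(⟨i1, hi1⟩, s1), hs1⟩
  let π := IsLocalRing.residue O
  let α' : ι → IsLocalRing.ResidueField O := fun x =>
    if h : x ∈ J then ρ (MvPolynomial.X ⟨x, h⟩) else 0
  let c'' : μ → Fin k → IsLocalRing.ResidueField O := fun i s =>
    if h : i ∈ S then π (c' (⟨i, h⟩, s)) else 0
  have hα' : ∀ x (h : x ∈ J), α' x = ρ (MvPolynomial.X ⟨x, h⟩) := fun x h => dif_pos h
  have hc'' : ∀ i (h : i ∈ S) s, c'' i s = π (c' (⟨i, h⟩, s)) := fun i h s => dif_pos h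
  have hρX : ∀ (x : J) (p : Polynomial F), ρ (Polynomial.aeval (MvPolynomial.X x) p) =
      Polynomial.aeval (ρ (MvPolynomial.X x)) p := fun x p =>
    (Polynomial.aeval_algHom_apply ρ _ _).symm
  have hψX : ∀ (x : J) (p : Polynomial F), (ψ (Polynomial.aeval (MvPolynomial.X x) p) : K) =
      Polynomial.aeval (α x) p := fun x p => by
    rw [hψ, ← Polynomial.aeval_algHom_apply]
    simp
  refine ⟨O, alg, α', c'', ?_, ?_, ?_, ?_⟩
  · -- independence of the remaining points
    let inc : ↥(J.erase j) → J := fun x => ⟨x, Finset.mem_of_mem_erase x.2⟩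
    have hinc : Function.Injective inc := fun x y h => Subtype.ext (congrArg (fun z : J => (z : ι)) h)
    have e1 : ∀ q : MvPolynomial (J.erase j : Finset ι) F,
        MvPolynomial.aeval (fun x : (J.erase j : Finset ι) => α' x) q =
          ρ (MvPolynomial.rename inc q) := by
      intro q
      have : (MvPolynomial.aeval (fun x : (J.erase j : Finset ι) => α' x) :
          MvPolynomial (J.erase j : Finset ι) F →ₐ[F] _) = ρ.comp (MvPolynomial.rename inc) := by
        apply MvPolynomial.algHom_ext
        intro x
        simp [hα' x (Finset.mem_of_mem_erase x.2), inc]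
      rw [this]; rfl
    have e2 : ∀ q : MvPolynomial (J.erase j : Finset ι) F,
        φ (MvPolynomial.rename inc q) = MvPolynomial.rename inc q := by
      intro q
      have : φ.comp (MvPolynomial.rename inc) = MvPolynomial.rename inc := by
        apply MvPolynomial.algHom_ext
        intro x
        have := Finset.ne_of_mem_erase x.2
        simp [φ, inc, this]
      exact congrArg (fun g => g q) this
    change Function.Injective _
    rw [injective_iff_map_eq_zero]
    intro q hq
    rw [e1, hker, e2] at hq
    exact MvPolynomial.rename_injective inc hinc (by simpa using hq)
  · intro i hi
    obtain ⟨hz, hv⟩ := hc i hi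
    -- vanishing relations in `O`
    have hO : ∀ x (hx : x ∈ J), x ∈ A i → ∑ s, c' (⟨i, hi⟩, s) *
        ψ (Polynomial.aeval (MvPolynomial.X ⟨x, hx⟩) (Polynomial.X ^ d s * u s)) = 0 := by
      intro x hx hxA
      apply Subtype.ext
      have := hv x hxA
      push_cast
      simp only [hψX, hcc, mul_assoc, ← Finset.mul_sum]
      rw [this, mul_zero]
    have hzO : ∀ s : Fin k, (s : ℕ) < σ i → c' (⟨i, hi⟩, s) = 0 := by
      intro s hs
      apply Subtype.ext
      rw [hcc]
      simp [hz s hs]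
    refine ⟨?_, ?_⟩
    · intro s hs
      rw [hc'' i hi]
      by_cases hlt : (s : ℕ) < σ i
      · rw [hzO s hlt, map_zero]
      · have hjA : j ∈ A i := by
          by_contra hjA
          simp only [hjA, if_false] at hs
          omega
        simp only [hjA, if_true] at hs
        have hsσ : (s : ℕ) = σ i := by omega
        have hrel := hO j hj hjA
        set t : O := ψ (MvPolynomial.X ⟨j, hj⟩) with ht
        have ht0 : t ≠ 0 := by
          intro h0
          have h1 : (t : K) = 0 := by rw [h0]; rfl
          rw [ht, hψ] at h1
          have h2 : (MvPolynomial.X ⟨j, hj⟩ : MvPolynomial J F) = 0 := by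
            apply hα
            simpa using h1
          exact MvPolynomial.X_ne_zero _ h2
        have hπt : π t = 0 := by
          change π (ψ _) = 0
          rw [← hρ, hker]
          simp [φ]
        let w : Fin k → O := fun s' => ψ (Polynomial.aeval (MvPolynomial.X ⟨j, hj⟩) (u s'))
        have hw : ∀ s', ψ (Polynomial.aeval (MvPolynomial.X ⟨j, hj⟩)
            (Polynomial.X ^ d s' * u s')) = t ^ d s' * w s' := by
          intro s'
          simp [w, t]
        have hterm : ∀ s', c' (⟨i, hi⟩, s') * (t ^ d s' * w s') = t ^ d s *
            (if s' = s then c' (⟨i, hi⟩, s) * w s else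
              t * (c' (⟨i, hi⟩, s') * t ^ (d s' - d s - 1) * w s')) := by
          intro s'
          split_ifs with h
          · subst h; ring
          · rcases lt_or_gt_of_ne h with h' | h'
            · rw [hzO s' (by rw [← hsσ]; exact h')]; ring
            · have h3 : d s' = d s + 1 + (d s' - d s - 1) := by
                have := hd h'; omega
              have h4 : t ^ d s' = t ^ d s * t * t ^ (d s' - d s - 1) := by
                conv_lhs => rw [h3]
                rw [pow_add, pow_succ]
              rw [h4]; ring
        simp only [hw, hterm, ← Finset.mul_sum] at hrel
        have h5 := (mul_eq_zero.mp hrel).resolve_left (pow_ne_zero _ ht0)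
        have h6 := congrArg π h5
        rw [map_sum, map_zero, Finset.sum_eq_single s] at h6
        · simp only [if_true, map_mul] at h6
          refine (mul_eq_zero.mp h6).resolve_right ?_
          have h7 : π (w s) = Polynomial.aeval (π t) (u s) := by
            change π (ψ _) = Polynomial.aeval (π (ψ _)) _
            rw [← hρ, hρX, ← hρ]
          rw [h7, hπt, ← Polynomial.coeff_zero_eq_aeval_zero']
          simpa using hu s
        · intro s' _ hs'
          simp [hs', hπt]
        · simp
    · intro x hx
      have hxA := Finset.mem_of_mem_erase hx
      have hxJ := hA i hi hxA
      have := congrArg π (hO x hxJ hxA)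
      rw [map_sum, map_zero] at this
      rw [← this]
      refine Finset.sum_congr rfl fun s _ => ?_
      rw [hc'' i hi, hα' x hxJ, ← hρX, hρ]
      exact (map_mul π _ _).symm
  · funext s
    have h1 : ∑ i : {i // i ∈ S}, c' (i, s) = 0 := by
      apply Subtype.ext
      push_cast
      simp only [hcc, ← Finset.mul_sum]
      have h2 := congrFun hsum s
      rw [Finset.sum_apply, ← Finset.sum_coe_sort] at h2
      rw [h2]; simp
    rw [Finset.sum_apply, ← Finset.sum_coe_sort]
    have h3 : ∀ i : {i // i ∈ S}, c'' i s = π (c' (i, s)) := fun i => hc'' i i.2 s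
    simp only [h3, ← map_sum, h1, map_zero, Pi.zero_apply]
  · refine ⟨i0, hi0, fun h => ?_⟩
    have := congrFun h s0
    rw [hc'' i0 hi0, h01] at this
    simp at this

/-- Generic points impose independent conditions. -/
theorem inP_zero.{u, v, w} {F : Type u} {ι : Type w} [Field F]
    [DecidableEq ι] {k : ℕ} (d : Fin k → ℕ) (hd : StrictMono d)
    (p : Fin k → Polynomial F) (hp : ∀ s, (p s).coeff 0 ≠ 0) (N : ℕ) :
    ∀ (K : Type v) [Field K] [Algebra F K] (α : ι → K) (A : Finset ι) (σ : ℕ) (c : Fin k → K),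
      A.card = N → AlgebraicIndependent F (fun x : A => α x) → σ + A.card = k →
      InP (fun s => Polynomial.X ^ d s * p s) α σ A c → c = 0 := by
  induction N with
  | zero =>
    intro K _ _ α A σ c hN _ hk hc
    funext s
    exact hc.1 s (by have := s.2; omega)
  | succ N ih =>
    intro K _ _ α A σ c hN hα hk hc
    by_contra hne
    obtain ⟨j, hj⟩ := Finset.card_pos.mp (by omega : 0 < A.card)
    obtain ⟨O, alg, α', c', h1, h2, -, i, -, h4⟩ := merge d hd p hp α A hα j hj
      (Finset.univ : Finset Bool) (fun _ => σ) (fun _ => A) (fun _ _ => subset_rfl)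
      (fun b => if b then c else -c)
      (by
        intro i _
        cases i
        · refine ⟨fun s hs => by simp [hc.1 s hs], fun x hx => ?_⟩
          have := hc.2 x hx
          simpa using this
        · simpa using hc)
      (by simp) ⟨true, Finset.mem_univ _, by simpa using hne⟩
    have hcard := Finset.card_erase_of_mem hj
    have h5 := h2 i (Finset.mem_univ _)
    simp only [hj, if_true] at h5
    exact h4 (ih _ α' (A.erase j) (σ + 1) (c' i) (by omega) h1 (by omega) h5)

/-- The GM-MDS type condition. -/
def GMCond {ι μ : Type*} [DecidableEq ι] (k : ℕ) (J : Finset ι) (S : Finset μ) (σ : μ → ℕ)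
    (A : μ → Finset ι) (e : μ → ℕ) : Prop :=
  ∀ I ⊆ S, I.Nonempty →
    ∃ i ∈ I, σ i + (J.filter fun x => ∀ a ∈ I, x ∈ A a).card + ∑ a ∈ I, e a ≤ k

/-- The generalized GM-MDS theorem, with flags. -/
theorem gm_mds.{u, v, w} {F : Type u} {ι μ : Type w} [Field F]
    [DecidableEq ι] [DecidableEq μ] [Finite μ] {k : ℕ} (d : Fin k → ℕ) (hd : StrictMono d)
    (p : Fin k → Polynomial F) (hp : ∀ s, (p s).coeff 0 ≠ 0) (N : ℕ) :
    ∀ (K : Type v) [Field K] [Algebra F K] (α : ι → K) (J : Finset ι) (S : Finset μ)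
      (σ : μ → ℕ) (A : μ → Finset ι) (e : μ → ℕ) (c : μ → Fin k → K),
      J.card + S.card + ∑ i ∈ S, (k - σ i) ≤ N →
      AlgebraicIndependent F (fun x : J => α x) →
      (∀ i ∈ S, A i ⊆ J) →
      (∀ i ∈ S, σ i + (A i).card + e i = k) →
      GMCond k J S σ A e →
      (∀ i ∈ S, InP (fun s => Polynomial.X ^ d s * p s) α (σ i) (A i) (c i)) →
      ∑ i ∈ S, c i = 0 → ∀ i ∈ S, c i = 0 := by
  induction N with
  | zero =>
    intro K _ _ α J S σ A e c hN _ _ _ _ _ _ i hi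
    have : S = ∅ := Finset.card_eq_zero.mp (by omega)
    simp [this] at hi
  | succ N ih =>
    intro K _ _ α J S σ A e c hN hα hA he hG hc hsum
    -- drop trivial members
    by_cases hz : ∃ i ∈ S, e i = 0
    · obtain ⟨i0, hi0, he0⟩ := hz
      have hc0 : c i0 = 0 := by
        have h1 : AlgebraicIndependent F (fun x : (A i0) => α x) :=
          hα.comp (fun x : A i0 => (⟨x, hA i0 hi0 x.2⟩ : J))
            (fun x y h => Subtype.ext (congrArg (fun z : J => (z : ι)) h))
        exact inP_zero d hd p hp _ K α (A i0) (σ i0) (c i0) rfl h1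
          (by have := he i0 hi0; omega) (hc i0 hi0)
      have hcard := Finset.card_erase_of_mem hi0
      have hpos := Finset.card_pos.mpr ⟨i0, hi0⟩
      have hs2 := Finset.add_sum_erase S (fun i => k - σ i) hi0
      have hs3 := Finset.add_sum_erase S c hi0
      have hsub : ∀ i ∈ S.erase i0, i ∈ S := fun i => Finset.mem_of_mem_erase
      have := ih K α J (S.erase i0) σ A e c (by omega) hα
        (fun i hi => hA i (hsub i hi)) (fun i hi => he i (hsub i hi))
        (fun I hI => hG I (hI.trans hsub)) (fun i hi => hc i (hsub i hi))
        (by rw [hc0, zero_add] at hs3; rw [hs3, hsum])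
      intro i hi
      by_cases h : i = i0
      · rw [h, hc0]
      · exact this i (Finset.mem_erase.mpr ⟨h, hi⟩)
    push Not at hz
    -- tight proper subsets
    by_cases ht : ∃ I ⊆ S, 2 ≤ I.card ∧ I ≠ S ∧
        ∀ i ∈ I, k ≤ σ i + (J.filter fun x => ∀ a ∈ I, x ∈ A a).card + ∑ a ∈ I, e a
    · obtain ⟨I, hIS, hI2, hne, htight⟩ := ht
      have hIcard : I.card < S.card := Finset.card_lt_card (Finset.ssubset_iff_subset_ne.mpr ⟨hIS, hne⟩)
      obtain ⟨m, hm, hmin⟩ := Finset.exists_min_image I σ (Finset.card_pos.mp (by omega))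
      set B := J.filter fun x => ∀ a ∈ I, x ∈ A a with hB
      set E := ∑ a ∈ I, e a with hE
      have hexact : σ m + B.card + E = k := by
        obtain ⟨i, hi, h1⟩ := hG I hIS ⟨m, hm⟩
        have h2 : σ i + B.card + E ≤ k := h1
        have := hmin i hi
        have := htight m hm
        omega
      let S' := insert m (S \ I)
      have hmS : m ∉ S \ I := by simp [hm]
      have hnm : ∀ i ∈ S \ I, i ≠ m := fun i hi h => hmS (h ▸ hi)
      have hsS : ∀ i ∈ S \ I, i ∈ S := fun i hi => (Finset.mem_sdiff.mp hi).1
      have hcS' : S'.card = S.card - I.card + 1 := by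
        rw [Finset.card_insert_of_notMem hmS, Finset.card_sdiff_of_subset hIS]
      have h1 : ∀ i ∈ S', Function.update c m (∑ i ∈ I, c i) i = 0 := by
        refine ih K α J S' σ (Function.update A m B) (Function.update e m E)
          (Function.update c m (∑ i ∈ I, c i)) ?_ hα ?_ ?_ ?_ ?_ ?_
        · have h3 : ∑ i ∈ S', (k - σ i) ≤ ∑ i ∈ S, (k - σ i) := by
            apply Finset.sum_le_sum_of_subset
            intro i hi
            rcases Finset.mem_insert.mp hi with rfl | hi
            · exact hIS hm
            · exact hsS i hi
          omega
        · intro i hi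
          rcases Finset.mem_insert.mp hi with rfl | hi
          · rw [Function.update_self]; exact Finset.filter_subset _ _
          · rw [Function.update_of_ne (hnm i hi)]; exact hA i (hsS i hi)
        · intro i hi
          rcases Finset.mem_insert.mp hi with rfl | hi
          · rw [Function.update_self, Function.update_self]; exact hexact
          · rw [Function.update_of_ne (hnm i hi), Function.update_of_ne (hnm i hi)]; exact he i (hsS i hi)
        · intro I' hI' hI'ne
          by_cases hmI : m ∈ I'
          · obtain ⟨i, hi, h2⟩ := hG (I'.erase m ∪ I) (by
              intro i hi
              rcases Finset.mem_union.mp hi with hi | hi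
              · have := hI' (Finset.mem_of_mem_erase hi)
                rcases Finset.mem_insert.mp this with h | h
                · exact absurd h (Finset.ne_of_mem_erase hi)
                · exact hsS i h
              · exact hIS hi) ⟨m, Finset.mem_union_right _ hm⟩
            have hdis : ∀ a ∈ I'.erase m, a ∈ S \ I := fun a ha =>
              Finset.mem_of_mem_insert_of_ne (hI' (Finset.mem_of_mem_erase ha))
                (Finset.ne_of_mem_erase ha)
            have hd1 : Disjoint (I'.erase m) I :=
              Finset.disjoint_left.mpr fun a ha => (Finset.mem_sdiff.mp (hdis a ha)).2
            have e1 : ∑ a ∈ I', Function.update e m E a = ∑ a ∈ I'.erase m ∪ I, e a := by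
              rw [Finset.sum_union hd1, ← Finset.add_sum_erase _ _ hmI, Function.update_self,
                Finset.sum_congr rfl (fun i hi => Function.update_of_ne (hnm i (hdis i hi)) E e),
                add_comm]
            have e2 : (J.filter fun x => ∀ a ∈ I', x ∈ Function.update A m B a) =
                (J.filter fun x => ∀ a ∈ I'.erase m ∪ I, x ∈ A a) := by
              ext x
              simp only [Finset.mem_filter]
              refine and_congr_right fun hxJ => ⟨fun h a ha => ?_, fun h a ha => ?_⟩
              · rcases Finset.mem_union.mp ha with ha | ha
                · have := h a (Finset.mem_of_mem_erase ha)
                  rwa [Function.update_of_ne (Finset.ne_of_mem_erase ha)] at this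
                · have := h m hmI
                  rw [Function.update_self] at this
                  exact (Finset.mem_filter.mp this).2 a ha
              · by_cases ham : a = m
                · subst ham
                  rw [Function.update_self]
                  exact Finset.mem_filter.mpr ⟨hxJ, fun b hb => h b (Finset.mem_union_right _ hb)⟩
                · rw [Function.update_of_ne ham]
                  exact h a (Finset.mem_union_left _ (Finset.mem_erase.mpr ⟨ham, ha⟩))
            rw [e1, e2]
            rcases Finset.mem_union.mp hi with hi | hi
            · exact ⟨i, Finset.mem_of_mem_erase hi, h2⟩
            · refine ⟨m, hmI, ?_⟩
              have := hmin i hi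
              omega
          · have hsub : ∀ a ∈ I', a ∈ S \ I := fun a ha =>
              Finset.mem_of_mem_insert_of_ne (hI' ha) (fun h => hmI (h ▸ ha))
            obtain ⟨i, hi, h2⟩ := hG I' (fun a ha => hsS a (hsub a ha)) hI'ne
            refine ⟨i, hi, ?_⟩
            rw [Finset.sum_congr rfl (fun i hi => Function.update_of_ne (hnm i (hsub i hi)) E e)]
            have e2 : (J.filter fun x => ∀ a ∈ I', x ∈ Function.update A m B a) =
                (J.filter fun x => ∀ a ∈ I', x ∈ A a) := by
              apply Finset.filter_congr
              intro x _
              refine forall₂_congr fun a ha => ?_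
              rw [Function.update_of_ne (hnm a (hsub a ha))]
            rw [e2]
            exact h2
        · intro i hi
          rcases Finset.mem_insert.mp hi with rfl | hi
          · rw [Function.update_self, Function.update_self]
            refine ⟨fun s hs => ?_, fun x hx => ?_⟩
            · rw [Finset.sum_apply]
              refine Finset.sum_eq_zero fun a ha => (hc a (hIS ha)).1 s ?_
              exact lt_of_lt_of_le hs (hmin a ha)
            · simp only [Finset.sum_apply, Finset.sum_mul]
              rw [Finset.sum_comm]
              refine Finset.sum_eq_zero fun a ha => (hc a (hIS ha)).2 x ?_
              exact (Finset.mem_filter.mp hx).2 a ha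
          · rw [Function.update_of_ne (hnm i hi), Function.update_of_ne (hnm i hi)]; exact hc i (hsS i hi)
        · rw [Finset.sum_insert hmS, Function.update_self,
            Finset.sum_congr rfl (fun i hi => Function.update_of_ne (hnm i hi) _ c), add_comm, Finset.sum_sdiff hIS, hsum]
      have h2 := h1 m (Finset.mem_insert_self _ _)
      rw [Function.update_self] at h2
      have h3 := ih K α J I σ A e c (by
          have := Finset.sum_le_sum_of_subset (f := fun i => k - σ i) hIS
          omega) hα (fun i hi => hA i (hIS hi)) (fun i hi => he i (hIS hi))
        (fun I' hI' => hG I' (hI'.trans hIS)) (fun i hi => hc i (hIS hi)) h2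
      intro i hi
      by_cases hiI : i ∈ I
      · exact h3 i hiI
      · have hi' : i ∈ S \ I := Finset.mem_sdiff.mpr ⟨hi, hiI⟩
        have h4 := h1 i (Finset.mem_insert_of_mem hi')
        rwa [Function.update_of_ne (hnm i hi')] at h4
    push Not at ht
    rcases S.eq_empty_or_nonempty with hSe | hSne
    · intro i hi
      simp [hSe] at hi
    obtain ⟨m, hm, hmin⟩ := Finset.exists_min_image S σ hSne
    by_cases hmerge : ∃ i ∈ S, σ i = σ m ∧ ∃ j ∈ J, j ∉ A i
    · -- specialize the point `j` to the origin
      obtain ⟨i0, hi0, hσ0, j, hj, hjA⟩ := hmerge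
      by_contra hcon
      push Not at hcon
      obtain ⟨O, alg, α', c', h1, h2, h3, i1, hi1, h4⟩ :=
        merge d hd p hp α J hα j hj S σ A hA c hc hsum hcon
      refine h4 (ih _ α' (J.erase j) S _ _ e c' ?_ h1 ?_ ?_ ?_ h2 h3 i1 hi1)
      · have hcard := Finset.card_erase_of_mem hj
        have hpos := Finset.card_pos.mpr ⟨j, hj⟩
        have : ∑ i ∈ S, (k - (σ i + if j ∈ A i then 1 else 0)) ≤ ∑ i ∈ S, (k - σ i) :=
          Finset.sum_le_sum fun i _ => by omega
        omega
      · intro i hi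
        exact Finset.erase_subset_erase j (hA i hi)
      · intro i hi
        have h5 := he i hi
        by_cases hji : j ∈ A i
        · have hcard := Finset.card_erase_of_mem hji
          have hpos := Finset.card_pos.mpr ⟨j, hji⟩
          simp only [hji, if_true]
          omega
        · simp only [hji, if_false, Finset.erase_eq_of_notMem hji]
          omega
      · intro I hI hIne
        have hle : ((J.erase j).filter fun x => ∀ a ∈ I, x ∈ (A a).erase j).card ≤
            (J.filter fun x => ∀ a ∈ I, x ∈ A a).card := by
          apply Finset.card_le_card
          intro x hx
          rw [Finset.mem_filter] at hx ⊢
          exact ⟨Finset.mem_of_mem_erase hx.1, fun a ha => Finset.mem_of_mem_erase (hx.2 a ha)⟩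
        by_cases hIS : I = S
        · subst hIS
          obtain ⟨i, hi, h5⟩ := hG I hI hIne
          refine ⟨i0, hi0, ?_⟩
          have := hmin i hi
          simp only [hjA, if_false]
          omega
        by_cases hI2 : 2 ≤ I.card
        · obtain ⟨i, hi, h5⟩ := ht I hI hI2 hIS
          refine ⟨i, hi, ?_⟩
          have : (if j ∈ A i then 1 else 0) ≤ 1 := by split_ifs <;> omega
          beta_reduce
          omega
        · have hI1 : I.card = 1 := by
            have := Finset.card_pos.mpr hIne
            omega
          obtain ⟨i, rfl⟩ := Finset.card_eq_one.mp hI1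
          refine ⟨i, Finset.mem_singleton_self i, ?_⟩
          have hi : i ∈ S := hI (Finset.mem_singleton_self i)
          have h5 := he i hi
          have h6 : ((J.erase j).filter fun x => ∀ a ∈ ({i} : Finset μ), x ∈ (A a).erase j).card ≤
              ((A i).erase j).card := by
            apply Finset.card_le_card
            intro x hx
            exact (Finset.mem_filter.mp hx).2 i (Finset.mem_singleton_self i)
          rw [Finset.sum_singleton]
          by_cases hji : j ∈ A i
          · have hcard := Finset.card_erase_of_mem hji
            have hpos := Finset.card_pos.mpr ⟨j, hji⟩
            simp only [hji, if_true]
            omega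
          · rw [Finset.erase_eq_of_notMem hji] at h6
            simp only [hji, if_false]
            omega
    · push Not at hmerge
      have hfull : ∀ i ∈ S, σ i = σ m → A i = J := fun i hi h =>
        Finset.Subset.antisymm (hA i hi) (hmerge i hi h)
      have hAm := hfull m hm rfl
      have hem := hz m hm
      have hbig : ∀ i ∈ S, i ≠ m → σ m + 1 ≤ σ i := by
        intro i hi hne
        by_contra hlt
        have h1 := hmin i hi
        have h2 : σ i = σ m := by omega
        have h3 := hfull i hi h2
        obtain ⟨a, ha, h4⟩ := hG {m, i} (by
          intro a ha
          rcases Finset.mem_insert.mp ha with rfl | ha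
          · exact hm
          · rw [Finset.mem_singleton.mp ha]; exact hi) ⟨m, Finset.mem_insert_self _ _⟩
        rw [Finset.sum_pair (Ne.symm hne), Finset.filter_true_of_mem] at h4
        · have h5 := he m hm
          have h6 := hz i hi
          have h7 : σ a = σ m := by
            rcases Finset.mem_insert.mp ha with rfl | ha
            · rfl
            · rw [Finset.mem_singleton.mp ha]; exact h2
          rw [hAm] at h5
          omega
        · intro x hx b hb
          rcases Finset.mem_insert.mp hb with rfl | hb
          · rw [hAm]; exact hx
          · rw [Finset.mem_singleton.mp hb, h3]; exact hx
      have hem' := he m hm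
      refine ih K α J S (Function.update σ m (σ m + 1)) A (Function.update e m (e m - 1)) c
        ?_ hα hA ?_ ?_ ?_ hsum
      · rw [← Finset.add_sum_erase _ _ hm, Function.update_self]
        rw [← Finset.add_sum_erase _ _ hm] at hN
        have : ∑ i ∈ S.erase m, (k - Function.update σ m (σ m + 1) i) =
            ∑ i ∈ S.erase m, (k - σ i) := by
          refine Finset.sum_congr rfl fun i hi => ?_
          rw [Function.update_of_ne (Finset.ne_of_mem_erase hi)]
        omega
      · intro i hi
        by_cases h : i = m
        · subst h
          rw [Function.update_self, Function.update_self]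
          omega
        · rw [Function.update_of_ne h, Function.update_of_ne h]
          exact he i hi
      · intro I hI hIne
        obtain ⟨i, hi, h5⟩ := hG I hI hIne
        refine ⟨i, hi, ?_⟩
        by_cases hmI : m ∈ I
        · rw [← Finset.add_sum_erase _ _ hmI] at h5
          rw [← Finset.add_sum_erase _ _ hmI, Function.update_self]
          have : ∑ a ∈ I.erase m, Function.update e m (e m - 1) a = ∑ a ∈ I.erase m, e a := by
            refine Finset.sum_congr rfl fun i hi => ?_
            rw [Function.update_of_ne (Finset.ne_of_mem_erase hi)]
          rw [this]
          have h6 : Function.update σ m (σ m + 1) i ≤ σ i + 1 := by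
            by_cases h : i = m
            · subst h; rw [Function.update_self]
            · rw [Function.update_of_ne h]; omega
          omega
        · have h6 : ∀ a ∈ I, a ≠ m := fun a ha h => hmI (h ▸ ha)
          rw [Finset.sum_congr rfl (fun a ha => Function.update_of_ne (h6 a ha) (e m - 1) e),
            Function.update_of_ne (h6 i hi)]
          exact h5
      · intro i hi
        by_cases h : i = m
        · subst h
          rw [Function.update_self]
          refine ⟨fun s hs => ?_, (hc i hi).2⟩
          have h7 := congrFun hsum s
          rw [Finset.sum_apply, Finset.sum_eq_single i] at h7
          · exact h7
          · intro b hb hbi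
            refine (hc b hb).1 s ?_
            have := hbig b hb hbi
            omega
          · exact fun h => absurd hi h
        · rw [Function.update_of_ne h]
          exact hc i hi

/-- Echelon basis of a finite dimensional space of polynomials, with respect to the order of
vanishing at the origin. -/
theorem exists_echelon {F : Type*} [Field F] (k : ℕ) :
    ∀ (W : Submodule F (Polynomial F)) [FiniteDimensional F W] (b : ℕ), Module.finrank F W = k →
      (∀ q ∈ W, Polynomial.X ^ b ∣ q) →
      ∃ (d : Fin k → ℕ) (p : Fin k → Polynomial F), StrictMono d ∧ (∀ s, b ≤ d s) ∧
        (∀ s, (p s).coeff 0 ≠ 0) ∧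
        W = Submodule.span F (Set.range fun s => Polynomial.X ^ d s * p s) := by
  induction k with
  | zero =>
    intro W _ b hW _
    refine ⟨Fin.elim0, Fin.elim0, fun s => s.elim0, fun s => s.elim0, fun s => s.elim0, ?_⟩
    rw [Submodule.finrank_eq_zero] at hW
    simp [hW, Set.range_eq_empty]
  | succ k ih =>
    intro W _ b hW hb
    classical
    have hex : ∃ m, ∃ q ∈ W, q.coeff m ≠ 0 := by
      have : W ≠ ⊥ := by
        intro h
        rw [h, finrank_bot] at hW
        omega
      obtain ⟨q, hq, hq0⟩ := Submodule.exists_mem_ne_zero_of_ne_bot this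
      by_contra hcon
      push Not at hcon
      exact hq0 (Polynomial.ext fun m => by simpa using hcon m q hq)
    let m := Nat.find hex
    obtain ⟨q, hq, hqm⟩ : ∃ q ∈ W, q.coeff m ≠ 0 := Nat.find_spec hex
    have hmin : ∀ q' ∈ W, ∀ i < m, q'.coeff i = 0 := by
      intro q' hq' i hi
      by_contra h
      exact Nat.find_min hex hi ⟨q', hq', h⟩
    have hdvd : ∀ q' ∈ W, Polynomial.X ^ m ∣ q' := fun q' hq' =>
      Polynomial.X_pow_dvd_iff.mpr (hmin q' hq')
    have hbm : b ≤ m := by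
      by_contra h
      exact hqm (Polynomial.X_pow_dvd_iff.mp (hb q hq) m (by omega))
    let W' : Submodule F (Polynomial F) := W ⊓ LinearMap.ker (Polynomial.lcoeff F m)
    have hfd : FiniteDimensional F W' := Submodule.finiteDimensional_inf_left _ _
    have hdecomp : W = Submodule.span F {q} ⊔ W' := by
      apply le_antisymm
      · intro x hx
        rw [Submodule.mem_sup]
        refine ⟨(x.coeff m / q.coeff m) • q, Submodule.mem_span_singleton.mpr ⟨_, rfl⟩,
          x - (x.coeff m / q.coeff m) • q, ⟨W.sub_mem hx (W.smul_mem _ hq), ?_⟩, by ring⟩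
        simp [hqm]
      · refine sup_le ?_ inf_le_left
        rw [Submodule.span_singleton_le_iff_mem]
        exact hq
    have hq0 : q ≠ 0 := fun h => hqm (by simp [h])
    have hinf : Submodule.span F {q} ⊓ W' = ⊥ := by
      rw [Submodule.eq_bot_iff]
      rintro x ⟨hx1, hx2⟩
      obtain ⟨a, rfl⟩ := Submodule.mem_span_singleton.mp hx1
      have h3 : a * q.coeff m = 0 := by simpa using hx2.2
      rw [(mul_eq_zero.mp h3).resolve_right hqm, zero_smul]
    have hfin : Module.finrank F W' = k := by
      have h1 := Submodule.finrank_sup_add_finrank_inf_eq (Submodule.span F {q}) W'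
      rw [← hdecomp, hinf, finrank_bot, finrank_span_singleton hq0, hW] at h1
      omega
    obtain ⟨d, p, hd, hbd, hp, hspan⟩ := ih W' (m + 1) hfin (by
      intro q' hq'
      rw [Polynomial.X_pow_dvd_iff]
      intro i hi
      rcases Nat.lt_succ_iff_lt_or_eq.mp hi with h | h
      · exact hmin q' hq'.1 i h
      · rw [h]; simpa using hq'.2)
    obtain ⟨q1, hq1⟩ := hdvd q hq
    refine ⟨Fin.cons m d, Fin.cons q1 p, ?_, ?_, ?_, ?_⟩
    · intro x y hxy
      induction y using Fin.cases with
      | zero => exact absurd hxy (Fin.not_lt_zero x)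
      | succ y =>
        induction x using Fin.cases with
        | zero =>
          have := hbd y
          simp only [Fin.cons_zero, Fin.cons_succ]
          omega
        | succ x =>
          simp only [Fin.cons_succ]
          exact hd (Fin.succ_lt_succ_iff.mp hxy)
    · intro s
      refine Fin.cases ?_ (fun s => ?_) s
      · simpa using hbm
      · have := hbd s
        simp only [Fin.cons_succ]; omega
    · intro s
      refine Fin.cases ?_ (fun s => ?_) s
      · have := hqm
        rw [hq1] at this
        simpa [Polynomial.coeff_X_pow_mul'] using this
      · simpa using hp s
    · have : (fun s : Fin (k+1) => (Polynomial.X : Polynomial F) ^ (Fin.cons m d : Fin (k+1) → ℕ) s *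
          (Fin.cons q1 p : Fin (k+1) → Polynomial F) s) =
          Fin.cons q (fun s => Polynomial.X ^ d s * p s) := by
        funext s
        refine Fin.cases ?_ (fun s => ?_) s
        · simp [hq1]
        · simp
      rw [this, Fin.range_cons, Submodule.span_insert, ← hspan]
      exact hdecomp

/-- Kronecker substitution keeps linear independence. -/
theorem exists_kronecker {F : Type*} [Field F] {k r : ℕ} (f : Fin k → MvPolynomial (Fin r) F)
    (hf : LinearIndependent F f) :
    ∃ w : Fin r → ℕ, (∀ t : Fin r, (t : ℕ) = 0 → w t = 1) ∧ LinearIndependent F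
      (fun i => MvPolynomial.aeval (fun t => (Polynomial.X : Polynomial F) ^ w t) (f i)) := by
  classical
  let D := (∑ i, (f i).totalDegree) + 1
  refine ⟨fun t => D ^ (t : ℕ), fun t ht => by simp [ht], ?_⟩
  rw [Fintype.linearIndependent_iff] at *
  intro g hg
  apply hf g
  set q := ∑ i, g i • f i with hq
  have hφ : MvPolynomial.aeval (fun t : Fin r => (Polynomial.X : Polynomial F) ^ (D ^ (t : ℕ))) q = 0 := by
    rw [hq, map_sum, ← hg]
    simp
  have hdeg : ∀ m ∈ q.support, ∀ t, m t < D := by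
    intro m hm t
    have h1 : m t ≤ q.totalDegree := by
      refine le_trans ?_ (MvPolynomial.le_totalDegree hm)
      by_cases h : m t = 0
      · omega
      · exact Finset.single_le_sum (f := fun i => m i) (fun _ _ => Nat.zero_le _)
          (Finsupp.mem_support_iff.mpr h)
    have h2 : q.totalDegree ≤ ∑ i, (f i).totalDegree := by
      refine MvPolynomial.totalDegree_finsetSum_le fun i _ => ?_
      refine (MvPolynomial.totalDegree_smul_le _ _).trans ?_
      exact Finset.single_le_sum (f := fun i => (f i).totalDegree) (fun _ _ => Nat.zero_le _)
          (Finset.mem_univ i)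
    omega
  let val : (Fin r →₀ ℕ) → ℕ := fun m => ∑ t, m t * D ^ (t : ℕ)
  have hinj : ∀ m ∈ q.support, ∀ m' ∈ q.support, val m = val m' → m = m' := by
    intro m hm m' hm' h
    have h1 : (fun t => (⟨m t, hdeg m hm t⟩ : Fin D)) = fun t => ⟨m' t, hdeg m' hm' t⟩ := by
      apply finFunctionFinEquiv.injective
      apply Fin.ext
      simp only [finFunctionFinEquiv_apply]
      exact h
    ext t
    exact congrArg Fin.val (congrFun h1 t)
  have hexp : MvPolynomial.aeval (fun t : Fin r => (Polynomial.X : Polynomial F) ^ (D ^ (t : ℕ))) q =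
      ∑ m ∈ q.support, Polynomial.monomial (val m) (q.coeff m) := by
    rw [MvPolynomial.aeval_def, MvPolynomial.eval₂_eq']
    refine Finset.sum_congr rfl fun m _ => ?_
    simp only [← pow_mul, Finset.prod_pow_eq_pow_sum]
    rw [← Polynomial.C_mul_X_pow_eq_monomial]
    congr 2
    exact Finset.sum_congr rfl fun t _ => mul_comm _ _
  rw [hexp] at hφ
  by_contra hq0
  obtain ⟨m, hm⟩ := MvPolynomial.support_nonempty.mpr hq0
  have h1 := congrArg (fun P => Polynomial.coeff P (val m)) hφ
  simp only [Polynomial.finsetSum_coeff, Polynomial.coeff_monomial, Polynomial.coeff_zero] at h1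
  rw [Finset.sum_eq_single m] at h1
  · rw [if_pos rfl] at h1
    exact MvPolynomial.mem_support_iff.mp hm h1
  · intro m' hm' hne
    exact if_neg fun h => hne (hinj m' hm' m hm h)
  · exact fun h => absurd hm h

/-- The null intersection property implies the GM-MDS condition. -/
theorem gmCond_of_nullInter {ℓ n k : ℕ} (hℓ : 2 ≤ ℓ) (A : Fin ℓ → Finset (Fin n))
    (hA : ∀ i, (A i).card ≤ k) (hsum : (∑ i, (A i).card) = (ℓ - 1) * k) (hN : NullInter k A) :
    GMCond k Finset.univ Finset.univ (fun _ => 0) A (fun i => k - (A i).card) := by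
  intro I _ hI
  obtain ⟨i, hi⟩ := id hI
  refine ⟨i, hi, ?_⟩
  have hIb : I ≠ ⊥ := Finset.nonempty_iff_ne_empty.mp hI
  let Q : Finpartition (Finset.univ : Finset (Fin ℓ)) :=
    (⊥ : Finpartition (Iᶜ : Finset (Fin ℓ))).extend hIb disjoint_compl_left (by simp)
  have hQ : Q.parts = insert I (⊥ : Finpartition (Iᶜ : Finset (Fin ℓ))).parts := rfl
  have hnot : I ∉ (⊥ : Finpartition (Iᶜ : Finset (Fin ℓ))).parts := by
    intro h
    have h1 : I ≤ Iᶜ := (⊥ : Finpartition (Iᶜ : Finset (Fin ℓ))).le h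
    exact (Finset.mem_compl.mp (h1 hi)) hi
  have h := hN Q
  rw [hQ, Finset.sum_insert hnot, Finset.card_insert_of_notMem hnot, Finpartition.card_bot,
    Finpartition.parts_bot, Finset.sum_map] at h
  have hs : ∀ a : Fin ℓ, interSet A {a} = A a := by
    intro a
    ext x
    simp [interSet]
  simp only [Function.Embedding.coeFn_mk, hs, Nat.add_sub_cancel] at h
  have h1 : (∑ a ∈ I, (A a).card) + ∑ a ∈ Iᶜ, (A a).card = (ℓ - 1) * k := by
    rw [Finset.sum_add_sum_compl, hsum]
  have h2 : ∑ a ∈ I, (k - (A a).card) + ∑ a ∈ I, (A a).card = I.card * k := by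
    rw [← Finset.sum_add_distrib, ← smul_eq_mul, ← Finset.sum_const]
    exact Finset.sum_congr rfl fun a _ => Nat.sub_add_cancel (hA a)
  have h3 : I.card * k + (Iᶜ).card * k = (ℓ - 1) * k + k := by
    rw [← add_mul, Finset.card_add_card_compl, Fintype.card_fin]
    obtain ⟨m, rfl⟩ : ∃ m, ℓ = m + 1 := ⟨ℓ - 1, by omega⟩
    simp; ring
  have h4 : (interSet A I).card = (Finset.univ.filter fun x => ∀ a ∈ I, x ∈ A a).card := by
    unfold interSet
    congr
  have h5 : 0 + (interSet A I).card + ∑ a ∈ I, (k - (A a).card) ≤ k := by omega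
  rw [h4] at h5
  convert h5

/-- Independence of the dual spaces, for multivariate polynomials at generic points. -/
theorem generic_indep.{u, v} {F : Type u} {K : Type v} [Field F] [Field K] [Algebra F K]
    {k n r ℓ : ℕ}
    (hr : 1 ≤ r) (f : Fin k → MvPolynomial (Fin r) F) (hf : LinearIndependent F f)
    (x : Fin n × Fin r → K) (hx : AlgebraicIndependent F x) (A : Fin ℓ → Finset (Fin n))
    (hA : ∀ i, (A i).card ≤ k)
    (hG : GMCond k Finset.univ Finset.univ (fun _ => 0) A (fun i => k - (A i).card))
    (c : Fin ℓ → Fin k → K)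
    (hc : ∀ i, ∀ y ∈ A i, ∑ s, c i s * MvPolynomial.aeval (fun t => x (y, t)) (f s) = 0)
    (hsum : ∑ i, c i = 0) : ∀ i, c i = 0 := by
  classical
  by_contra hcon
  push Not at hcon
  obtain ⟨i1, hi1⟩ := hcon
  obtain ⟨s1, hs1⟩ := Function.ne_iff.mp hi1
  obtain ⟨w, hw0, hw⟩ := exists_kronecker f hf
  set g : Fin k → Polynomial F :=
    fun i => MvPolynomial.aeval (fun t => (Polynomial.X : Polynomial F) ^ w t) (f i) with hg
  -- echelon form
  have hfd : FiniteDimensional F (Submodule.span F (Set.range g)) :=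
    FiniteDimensional.span_of_finite F (Set.finite_range g)
  obtain ⟨d, p, hd, -, hp, hspan⟩ := exists_echelon k (Submodule.span F (Set.range g)) 0
    (by rw [finrank_span_eq_card hw, Fintype.card_fin]) (by simp)
  set h : Fin k → Polynomial F := fun s => Polynomial.X ^ d s * p s with hh
  have hM : ∀ s, ∃ a : Fin k → F, ∑ i, a i • g i = h s := by
    intro s
    have : h s ∈ Submodule.span F (Set.range g) := hspan ▸ Submodule.subset_span ⟨s, rfl⟩
    exact (Submodule.mem_span_range_iff_exists_fun F).mp this
  have hNm : ∀ s, ∃ a : Fin k → F, ∑ i, a i • h i = g s := by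
    intro s
    have : g s ∈ Submodule.span F (Set.range h) := hspan ▸ Submodule.subset_span ⟨s, rfl⟩
    exact (Submodule.mem_span_range_iff_exists_fun F).mp this
  choose M hM using hM
  choose R hR using hNm
  have hRM : ∀ s i, ∑ q, R s q * M q i = if i = s then 1 else 0 := by
    intro s i
    have h1 : ∑ i, (∑ q, R s q * M q i) • g i = ∑ i, (if i = s then (1 : F) else 0) • g i := by
      simp only [ite_smul, one_smul, zero_smul, Finset.sum_ite_eq', Finset.mem_univ, if_true]
      rw [← hR s]
      simp only [← hM, Finset.smul_sum, Finset.sum_smul, smul_smul]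
      rw [Finset.sum_comm]
    have h2 : ∑ i, ((∑ q, R s q * M q i) - (if i = s then (1 : F) else 0)) • g i = 0 := by
      simp only [sub_smul, Finset.sum_sub_distrib, h1, sub_self]
    exact sub_eq_zero.mp (Fintype.linearIndependent_iff.mp hw _ h2 i)
  -- specialization
  let φ : MvPolynomial (Fin n × Fin r) F →ₐ[F] MvPolynomial (Fin n) F :=
    MvPolynomial.aeval (fun y => MvPolynomial.X y.1 ^ w y.2)
  obtain ⟨O, alg, ψ, ρ, a, c', hψ, hρ, hker, hcc, ⟨i0, s0⟩, h01⟩ :=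
    exists_reduction x hx φ (fun y : Fin ℓ × Fin k => c y.1 y.2) ⟨(i1, s1), hs1⟩
  let π := IsLocalRing.residue O
  let z : Fin r := ⟨0, by omega⟩
  let α' : Fin n → IsLocalRing.ResidueField O := fun y => ρ (MvPolynomial.X (y, z))
  have hα' : AlgebraicIndependent F α' := by
    change Function.Injective _
    rw [injective_iff_map_eq_zero]
    intro q hq
    have e1 : MvPolynomial.aeval α' q = ρ (MvPolynomial.rename (fun y => (y, z)) q) := by
      have : (MvPolynomial.aeval α' : MvPolynomial (Fin n) F →ₐ[F] _) =
          ρ.comp (MvPolynomial.rename (fun y => (y, z))) := by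
        apply MvPolynomial.algHom_ext
        intro y
        simp [α']
      rw [this]; rfl
    have e2 : φ (MvPolynomial.rename (fun y => (y, z)) q) = q := by
      have : φ.comp (MvPolynomial.rename (fun y => (y, z))) = AlgHom.id F _ := by
        apply MvPolynomial.algHom_ext
        intro y
        simp [φ, hw0 z rfl]
      exact congrArg (fun g => g q) this
    rw [e1, hker, e2] at hq
    exact hq
  have hpow : ∀ y t, ρ (MvPolynomial.X (y, t)) = α' y ^ w t := by
    intro y t
    have : φ (MvPolynomial.X (y, t) - MvPolynomial.X (y, z) ^ w t) = 0 := by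
      simp [φ, hw0 z rfl]
    rw [← hker, map_sub, map_pow, sub_eq_zero] at this
    exact this
  have hev : ∀ y s, ρ (MvPolynomial.aeval (fun t => MvPolynomial.X (y, t)) (f s)) =
      Polynomial.aeval (α' y) (g s) := by
    intro y s
    have : ρ.comp (MvPolynomial.aeval (fun t => MvPolynomial.X (y, t))) =
        (Polynomial.aeval (α' y)).comp
          (MvPolynomial.aeval (fun t => (Polynomial.X : Polynomial F) ^ w t)) := by
      apply MvPolynomial.algHom_ext
      intro t
      simp [hpow]
    exact congrArg (fun g => g (f s)) this
  have hevK : ∀ y s, (ψ (MvPolynomial.aeval (fun t => MvPolynomial.X (y, t)) (f s)) : K) =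
      MvPolynomial.aeval (fun t => x (y, t)) (f s) := by
    intro y s
    rw [hψ]
    have : (MvPolynomial.aeval x).comp (MvPolynomial.aeval (fun t => MvPolynomial.X (y, t))) =
        (MvPolynomial.aeval (fun t => x (y, t)) : MvPolynomial (Fin r) F →ₐ[F] K) := by
      apply MvPolynomial.algHom_ext
      intro t
      simp
    exact congrArg (fun g => g (f s)) this
  let am := algebraMap F (IsLocalRing.ResidueField O)
  let c'' : Fin ℓ → Fin k → IsLocalRing.ResidueField O := fun i q => ∑ s, π (c' (i, s)) * am (R s q)
  have hrel : ∀ i, ∀ y ∈ A i, ∑ s, π (c' (i, s)) * Polynomial.aeval (α' y) (g s) = 0 := by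
    intro i y hy
    have h1 : ∑ s, c' (i, s) * ψ (MvPolynomial.aeval (fun t => MvPolynomial.X (y, t)) (f s)) = 0 := by
      apply Subtype.ext
      push_cast
      simp only [hevK, hcc, mul_assoc, ← Finset.mul_sum]
      rw [hc i y hy, mul_zero]
    have h2 := congrArg π h1
    rw [map_sum, map_zero] at h2
    rw [← h2]
    refine Finset.sum_congr rfl fun s _ => ?_
    rw [← hev, hρ]
    exact (map_mul π _ _).symm
  have hsum' : ∀ s, ∑ i, π (c' (i, s)) = 0 := by
    intro s
    have h1 : ∑ i, c' (i, s) = 0 := by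
      apply Subtype.ext
      push_cast
      simp only [hcc, ← Finset.mul_sum]
      have h2 := congrFun hsum s
      rw [Finset.sum_apply] at h2
      rw [h2]; simp
    rw [← map_sum, h1, map_zero]
  have hmain := gm_mds d hd p hp _ (IsLocalRing.ResidueField O) α' Finset.univ
    (Finset.univ : Finset (Fin ℓ)) (fun _ => 0) A (fun i => k - (A i).card) c'' le_rfl
    (hα'.comp (fun y : (Finset.univ : Finset (Fin n)) => (y : Fin n)) Subtype.val_injective)
    (fun i _ => Finset.subset_univ _) (fun i _ => by have := hA i; omega) hG
    (by
      intro i _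
      refine ⟨fun s hs => absurd hs (Nat.not_lt_zero _), fun y hy => ?_⟩
      rw [← hrel i y hy]
      have e : ∀ s, Polynomial.aeval (α' y) (g s) = ∑ q, am (R s q) * Polynomial.aeval (α' y) (h q) := by
        intro s
        rw [← hR s, map_sum]
        refine Finset.sum_congr rfl fun q _ => ?_
        rw [map_smul, Algebra.smul_def]
      simp only [e, c'', Finset.sum_mul, Finset.mul_sum]
      rw [Finset.sum_comm]
      refine Finset.sum_congr rfl fun s _ => Finset.sum_congr rfl fun q _ => ?_
      ring)
    (by
      funext q
      rw [Finset.sum_apply]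
      simp only [c'']
      rw [Finset.sum_comm]
      simp only [← Finset.sum_mul, hsum', zero_mul, Finset.sum_const_zero, Pi.zero_apply])
    i0 (Finset.mem_univ _)
  -- invert the change of basis
  have hfin : π (c' (i0, s0)) = 0 := by
    have h1 : ∑ q, c'' i0 q * am (M q s0) = 0 := by simp [hmain]
    simp only [c'', Finset.sum_mul] at h1
    rw [Finset.sum_comm] at h1
    have h2 : ∀ s, ∑ q, π (c' (i0, s)) * am (R s q) * am (M q s0) =
        π (c' (i0, s)) * (if s0 = s then 1 else 0) := by
      intro s
      have h3 := congrArg am (hRM s s0)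
      rw [map_sum] at h3
      simp only [mul_assoc, ← Finset.mul_sum, ← map_mul]
      rw [h3]
      split_ifs <;> simp
    simp only [h2] at h1
    simpa using h1
  rw [h01, map_one] at hfin
  exact one_ne_zero hfin

/-- From independence of the dual spaces to trivial intersection. -/
theorem iInf_colSpan_eq_bot {K : Type*} [Field K] {k n ℓ : ℕ} (hℓ : 2 ≤ ℓ)
    (V : Matrix (Fin k) (Fin n) K) (A : Fin ℓ → Finset (Fin n))
    (hA : ∀ i, (A i).card ≤ k) (hsum : (∑ i, (A i).card) = (ℓ - 1) * k)
    (hind : ∀ c : Fin ℓ → Fin k → K, (∀ i, ∀ y ∈ A i, ∑ s, c i s * V s y = 0) →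
      ∑ i, c i = 0 → ∀ i, c i = 0) :
    (⨅ i, colSpan V (A i)) = ⊥ := by
  let L : ∀ i, (Fin k → K) →ₗ[K] (A i → K) := fun i =>
    Matrix.mulVecLin (Matrix.of fun (y : A i) s => V s y)
  let Q : ∀ i, Submodule K (Fin k → K) := fun i => LinearMap.ker (L i)
  have hmem : ∀ i c, c ∈ Q i ↔ ∀ y ∈ A i, ∑ s, c s * V s y = 0 := by
    intro i c
    simp only [Q, L, LinearMap.mem_ker, Matrix.mulVecLin_apply, funext_iff, Matrix.mulVec,
      dotProduct, Matrix.of_apply, Pi.zero_apply, Subtype.forall, mul_comm (c _)]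
  have hdim : ∀ i, k - (A i).card ≤ Module.finrank K (Q i) := by
    intro i
    have h1 := LinearMap.finrank_range_add_finrank_ker (L i)
    have h2 := Submodule.finrank_le (LinearMap.range (L i))
    simp only [Module.finrank_fintype_fun_eq_card, Fintype.card_fin, Fintype.card_coe] at h1 h2
    change _ ≤ Module.finrank K (LinearMap.ker (L i))
    omega
  let Φ : (∀ i, Q i) →ₗ[K] (Fin k → K) := ∑ i, (Q i).subtype ∘ₗ LinearMap.proj i
  have hΦ : ∀ c, Φ c = ∑ i, (c i : Fin k → K) := by
    intro c
    simp [Φ]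
  have hinj : Function.Injective Φ := by
    rw [injective_iff_map_eq_zero]
    intro c hc
    rw [hΦ] at hc
    have := hind (fun i => c i) (fun i => (hmem i _).mp (c i).2) hc
    funext i
    exact Subtype.ext (this i)
  have hfr : Module.finrank K (∀ i, Q i) = Module.finrank K (Fin k → K) := by
    apply le_antisymm (LinearMap.finrank_le_finrank_of_injective hinj)
    rw [Module.finrank_fintype_fun_eq_card, Fintype.card_fin, Module.finrank_pi_fintype]
    refine le_trans ?_ (Finset.sum_le_sum fun i _ => hdim i)
    have h2 : ∑ a, (k - (A a).card) + ∑ a, (A a).card = ℓ * k := by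
      rw [← Finset.sum_add_distrib, Finset.sum_congr rfl fun a _ => Nat.sub_add_cancel (hA a)]
      simp
    obtain ⟨m, rfl⟩ : ∃ m, ℓ = m + 1 := ⟨ℓ - 1, by omega⟩
    rw [hsum, Nat.add_sub_cancel, add_mul] at h2
    omega
  have hsurj := (LinearMap.injective_iff_surjective_of_finrank_eq_finrank hfr).mp hinj
  have hkill : ∀ i, ∀ c ∈ Q i, ∀ v ∈ colSpan V (A i), c ⬝ᵥ v = 0 := by
    intro i c hc v h1
    unfold colSpan at h1
    induction h1 using Submodule.span_induction with
    | mem w hw =>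
      obtain ⟨y, hy, rfl⟩ := hw
      exact (hmem i c).mp hc y hy
    | zero => simp
    | add a b _ _ ha hb => rw [dotProduct_add, ha, hb, add_zero]
    | smul t a _ ha => rw [dotProduct_smul, ha, smul_zero]
  rw [Submodule.eq_bot_iff]
  intro v hv
  rw [Submodule.mem_iInf] at hv
  funext s
  obtain ⟨c, hc⟩ := hsurj (Pi.single s 1)
  have h1 : (Pi.single s 1 : Fin k → K) ⬝ᵥ v = 0 := by
    rw [← hc, hΦ, sum_dotProduct]
    exact Finset.sum_eq_zero fun i _ => hkill i _ (c i).2 v (hv i)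
  simpa using h1

/-- Generic polynomial codes are `MDS(ℓ)` for all `ℓ ≥ 2`. -/
theorem generic_polynomial_codes_MDS
    (F : Type*) [Field F] (k n r : ℕ) (hk : 1 ≤ k) (hn : 1 ≤ n) (hr : 1 ≤ r)
    (f : Fin k → MvPolynomial (Fin r) F) (hf : LinearIndependent F f)
    (V : Matrix (Fin k) (Fin n) (FractionRing (MvPolynomial (Fin n × Fin r) F)))
    (hV : ∀ i j, V i j = MvPolynomial.eval₂
      ((algebraMap (MvPolynomial (Fin n × Fin r) F)
        (FractionRing (MvPolynomial (Fin n × Fin r) F))).comp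
        (MvPolynomial.C : F →+* MvPolynomial (Fin n × Fin r) F))
      (fun t => algebraMap (MvPolynomial (Fin n × Fin r) F)
        (FractionRing (MvPolynomial (Fin n × Fin r) F)) (MvPolynomial.X (j, t)))
      (f i)) :
    ∀ ℓ : ℕ, 2 ≤ ℓ → ∀ A : Fin ℓ → Finset (Fin n),
      (∀ i, (A i).card ≤ k) →
      (∑ i, (A i).card) = (ℓ - 1) * k →
      NullInter k A →
      (⨅ i, colSpan V (A i)) = ⊥ := by
  intro ℓ hℓ A hA hsum hN
  classical
  have hx : AlgebraicIndependent F (fun y : Fin n × Fin r =>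
      algebraMap (MvPolynomial (Fin n × Fin r) F)
        (FractionRing (MvPolynomial (Fin n × Fin r) F)) (MvPolynomial.X y)) := by
    have : (MvPolynomial.aeval (fun y : Fin n × Fin r =>
        algebraMap (MvPolynomial (Fin n × Fin r) F)
        (FractionRing (MvPolynomial (Fin n × Fin r) F)) (MvPolynomial.X y)) :
        MvPolynomial (Fin n × Fin r) F →ₐ[F] _) =
        IsScalarTower.toAlgHom F (MvPolynomial (Fin n × Fin r) F)
          (FractionRing (MvPolynomial (Fin n × Fin r) F)) := by
      apply MvPolynomial.algHom_ext
      intro y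
      simp
    change Function.Injective _
    rw [this]
    exact IsFractionRing.injective (MvPolynomial (Fin n × Fin r) F)
          (FractionRing (MvPolynomial (Fin n × Fin r) F))
  have hG := gmCond_of_nullInter hℓ A hA hsum hN
  have hind := generic_indep hr f hf _ hx A hA hG
  have hV' : ∀ i j, V i j = MvPolynomial.aeval (fun t => algebraMap (MvPolynomial (Fin n × Fin r) F)
        (FractionRing (MvPolynomial (Fin n × Fin r) F)) (MvPolynomial.X (j, t))) (f i) := by
    intro i j
    rw [hV, MvPolynomial.aeval_def]
    rfl
  simp only [← hV'] at hind
  exact iInf_colSpan_eq_bot hℓ V A hA hsum hind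
end
end

section
/- Let F be a field, let 1 ≤ k ≤ n and r ≥ 1, and let f_1, …, f_k ∈ F[x_1,…,x_r] (MvPolynomial (Fin r) F) be linearly independent over F. Let K := FractionField (MvPolynomial (Fin n × Fin r) F) and for j = 1,…,n let α_j ∈ K^r be the tuple whose t-th coordinate is the image of the variable X_{(j,t)}. Let V ∈ K^{k×n} with V_{i,j} := f_i(α_j). Then V has rank k, and every dual matrix Q ∈ K^{(n−k)×n} of V (rank n−k with V · Qᵀ = 0) satisfies: for every ℓ ≥ 2 and every family A_1, …, A_ℓ of subsets of {1,…,n} with |A_i| ≤ n−k for all i, with |A_1| + ⋯ + |A_ℓ| = (ℓ−1)·(n−k), and having the dimension-(n−k) null intersection property, the intersection Q_{A_1} ∩ ⋯ ∩ Q_{A_ℓ} of column-span subspaces is zero. (In other words, duals of generic polynomial codes are MDS(ℓ) for all ℓ, equivalently generic polynomial codes are LD-MDS(≤ L) for all L.) -/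
open Finset Matrix

noncomputable section

/-- Total weight of the edges induced on `I`. -/
def wt {ι : Type*} [DecidableEq ι] {n : ℕ} (e : Fin n → Finset ι) (I : Finset ι) : ℕ :=
  ∑ x, ((I ∩ e x).card - 1)

/-- A sparse system with ground vertex `o`. -/
structure Sys {ι : Type*} [DecidableEq ι] {n : ℕ} (k : ℕ) (U : Finset ι) (o : ι)
    (e : Fin n → Finset ι) (σ : ι → ℕ) : Prop where
  ho : o ∈ U
  hso : σ o = k
  hs : ∀ i ∈ U, σ i ≤ k
  sp : ∀ I, I ⊆ U → I.Nonempty → wt e I + ∑ i ∈ I, σ i + k ≤ k * I.card + I.sup σ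
  full : wt e U + ∑ i ∈ U, σ i + k = k * U.card + k

section comb
lemma sup_eq_val_of_max {ι : Type*} {I : Finset ι} {σ : ι → ℕ} {i : ι} (hi : i ∈ I) (h : ∀ j ∈ I, σ j ≤ σ i) :
    I.sup σ = σ i :=
  le_antisymm (Finset.sup_le h) (Finset.le_sup hi)

variable {ι : Type*} [DecidableEq ι] {n k : ℕ}

lemma Sys.restrict {U I : Finset ι} {o i : ι} {e : Fin n → Finset ι} {σ : ι → ℕ}
    (h : Sys k U o e σ) (hI : I ⊆ U) (hi : i ∈ I) (hmax : ∀ j ∈ I, σ j ≤ σ i)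
    (ht : wt e I + ∑ i ∈ I, σ i + k = k * I.card + I.sup σ) :
    Sys k I i e (Function.update σ i k) := by
  have key : ∀ J, J ⊆ I → i ∈ J → ∑ j ∈ J, Function.update σ i k j + σ i = ∑ j ∈ J, σ j + k := by
    intro J hJ hiJ
    rw [← Finset.add_sum_erase J _ hiJ, ← Finset.add_sum_erase J σ hiJ]
    have : ∑ x ∈ J.erase i, Function.update σ i k x = ∑ x ∈ J.erase i, σ x :=
      Finset.sum_congr rfl fun x hx => by
        rw [Function.update_of_ne (Finset.ne_of_mem_erase hx)]
    rw [this]; simp; ring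
  have hle : ∀ j ∈ I, Function.update σ i k j ≤ k := by
    intro j hj
    by_cases hji : j = i
    · subst hji; simp
    · rw [Function.update_of_ne hji]; exact h.hs j (hI hj)
  refine ⟨hi, by simp, hle, ?_, ?_⟩
  · intro J hJ hne
    have hb := h.sp J (hJ.trans hI) hne
    by_cases hiJ : i ∈ J
    · have h1 := key J hJ hiJ
      have h2 : J.sup σ = σ i := sup_eq_val_of_max hiJ fun j hj => hmax j (hJ hj)
      have h3 : J.sup (Function.update σ i k) = k := by
        rw [sup_eq_val_of_max hiJ]
        · simp
        · intro j hj; simpa using hle j (hJ hj)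
      rw [h3]; omega
    · have h1 : ∀ j ∈ J, Function.update σ i k j = σ j := by
        intro j hj
        rw [Function.update_of_ne]; rintro rfl; exact hiJ hj
      rw [Finset.sum_congr rfl h1, Finset.sup_congr rfl h1]
      exact hb
  · have h1 := key I (Finset.Subset.refl _) hi
    have h2 : I.sup σ = σ i := sup_eq_val_of_max hi hmax
    omega

/-- contracted edges -/
def contr (I : Finset ι) (i : ι) (e : Fin n → Finset ι) (x : Fin n) : Finset ι :=
  if (I ∩ e x).Nonempty then insert i (e x) else e x

lemma contr_card {I J : Finset ι} {i : ι} (hi : i ∈ I) (hJ : ∀ j ∈ J, j ∈ I → j = i)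
    (hiJ : i ∈ J) (e : Fin n → Finset ι) :
    wt (contr I i e) J + wt e I = wt e (J ∪ I) := by
  unfold wt
  rw [← Finset.sum_add_distrib]
  refine Finset.sum_congr rfl fun x _ => ?_
  unfold contr
  split_ifs with hne
  · have h1 : J ∩ insert i (e x) = insert i ((J \ I) ∩ e x) := by
      ext y; simp only [mem_inter, mem_insert, mem_sdiff]
      constructor
      · rintro ⟨a, b⟩
        by_cases hy : y ∈ I
        · exact Or.inl (hJ y a hy)
        · rcases b with rfl | b
          · exact Or.inl rfl
          · exact Or.inr ⟨⟨a, hy⟩, b⟩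
      · rintro (rfl | ⟨⟨a, _⟩, b⟩)
        · exact ⟨hiJ, Or.inl rfl⟩
        · exact ⟨a, Or.inr b⟩
    have h2 : (J ∪ I) ∩ e x = ((J \ I) ∩ e x) ∪ (I ∩ e x) := by
      ext y; simp only [mem_inter, mem_union, mem_sdiff]; tauto
    have h3 : Disjoint ((J \ I) ∩ e x) (I ∩ e x) := by
      rw [Finset.disjoint_left]; intro y; simp only [mem_inter, mem_sdiff]; tauto
    rw [h1, h2, Finset.card_union_of_disjoint h3, Finset.card_insert_of_notMem (by simp [hi])]
    have := hne.card_pos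
    omega
  · rw [Finset.not_nonempty_iff_eq_empty] at hne
    have h2 : (J ∪ I) ∩ e x = J ∩ e x := by
      rw [Finset.union_inter_distrib_right, hne, Finset.union_empty]
    rw [h2, hne]; simp

lemma contr_card' {I J : Finset ι} {i : ι} (hiJ : i ∉ J) (e : Fin n → Finset ι) :
    wt (contr I i e) J = wt e J := by
  unfold wt
  refine Finset.sum_congr rfl fun x _ => ?_
  unfold contr
  split_ifs with hne
  · rw [Finset.inter_insert_of_notMem hiJ]
  · rfl

lemma Sys.contract {U I : Finset ι} {o i : ι} {e : Fin n → Finset ι} {σ : ι → ℕ}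
    (h : Sys k U o e σ) (hI : I ⊆ U) (hi : i ∈ I) (hmax : ∀ j ∈ I, σ j ≤ σ i)
    (hio : o ∈ I → i = o)
    (ht : wt e I + ∑ i ∈ I, σ i + k = k * I.card + I.sup σ) :
    Sys k (insert i (U \ I)) o (contr I i e) σ := by
  have hsub : insert i (U \ I) ⊆ U :=
    Finset.insert_subset (hI hi) Finset.sdiff_subset
  have hsI : I.sup σ = σ i := sup_eq_val_of_max hi hmax
  have hJ0 : ∀ J, J ⊆ insert i (U \ I) → ∀ j ∈ J, j ∈ I → j = i := by
    intro J hJ j hj hjI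
    have := hJ hj
    simp only [mem_insert, mem_sdiff] at this
    tauto
  have hcomb : ∀ J, J ⊆ insert i (U \ I) → i ∈ J →
      (∑ j ∈ J ∪ I, σ j + σ i = ∑ j ∈ J, σ j + ∑ j ∈ I, σ j) ∧
      ((J ∪ I).card + 1 = J.card + I.card) := by
    intro J hJ hiJ
    have hint : J ∩ I = {i} := by
      ext y; simp only [mem_inter, mem_singleton]
      exact ⟨fun ⟨a, b⟩ => hJ0 J hJ y a b, by rintro rfl; exact ⟨hiJ, hi⟩⟩
    constructor
    · have := Finset.sum_union_inter (s₁ := J) (s₂ := I) (f := σ)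
      rw [hint, Finset.sum_singleton] at this
      exact this
    · have := Finset.card_union_add_card_inter J I
      rw [hint, Finset.card_singleton] at this
      exact this
  refine ⟨?_, h.hso, fun j hj => h.hs j (hsub hj), ?_, ?_⟩
  · by_cases hoI : o ∈ I
    · rw [← hio hoI]; simp
    · simp [hoI, h.ho]
  · intro J hJ hne
    by_cases hiJ : i ∈ J
    · have hb := h.sp (J ∪ I) (Finset.union_subset (hJ.trans hsub) hI)
        (hne.mono Finset.subset_union_left)
      obtain ⟨h1, h2⟩ := hcomb J hJ hiJ
      have h3 := contr_card hi (hJ0 J hJ) hiJ e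
      have h4 : (J ∪ I).sup σ = J.sup σ := by
        rw [Finset.sup_union, hsI]
        exact sup_eq_left.2 (Finset.le_sup hiJ)
      have h5 : k * (J ∪ I).card + k = k * J.card + k * I.card := by
        rw [← mul_add, ← h2]; ring
      rw [h4] at hb
      omega
    · rw [contr_card' hiJ]
      exact h.sp J (hJ.trans hsub) hne
  · have hU : insert i (U \ I) ∪ I = U := by
      ext y; simp only [mem_union, mem_insert, mem_sdiff]
      constructor
      · rintro ((rfl | hy) | hy)
        · exact hI hi
        · exact hy.1
        · exact hI hy
      · intro hy; by_cases y ∈ I <;> tauto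
    have hiJ : i ∈ insert i (U \ I) := by simp
    obtain ⟨h1, h2⟩ := hcomb _ (Finset.Subset.refl _) hiJ
    have h3 := contr_card hi (hJ0 _ (Finset.Subset.refl _)) hiJ e
    rw [hU] at h1 h2 h3
    have hf := h.full
    have h5 : k * U.card + k = k * (insert i (U \ I)).card + k * I.card := by
      rw [← mul_add, ← h2]; ring
    omega

lemma Sys.base {U : Finset ι} {o : ι} {e : Fin 0 → Finset ι} {σ : ι → ℕ}
    (h : Sys k U o e σ) : ∀ i ∈ U, σ i = k := by
  have hf := h.full
  have : ∑ i ∈ U, σ i = ∑ i ∈ U, k := by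
    simp [wt] at hf ⊢; rw [hf]; ring
  exact (Finset.sum_eq_sum_iff_of_le h.hs).1 this

lemma Sys.exists_edge {U : Finset ι} {o j : ι} {e : Fin n → Finset ι} {σ : ι → ℕ}
    (h : Sys k U o e σ) (hj : j ∈ U) (hjo : j ≠ o)
    (hlt : ∀ i ∈ U, i ≠ o → σ i < k) : ∃ x, o ∈ e x := by
  by_contra hcon
  push Not at hcon
  have hne : (U.erase o).Nonempty := ⟨j, by simp [hj, hjo]⟩
  have hb := h.sp (U.erase o) (Finset.erase_subset _ _) hne
  have hw : wt e (U.erase o) = wt e U := by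
    unfold wt
    refine Finset.sum_congr rfl fun x _ => ?_
    rw [Finset.erase_inter, Finset.erase_eq_of_notMem]
    simp [hcon x]
  have h1 := Finset.add_sum_erase U σ h.ho
  have h2 := Finset.card_erase_add_one h.ho
  have h3 : (U.erase o).sup σ < k := by
    rw [Finset.sup_lt_iff]
    · intro i hi
      exact hlt i (Finset.mem_of_mem_erase hi) (Finset.ne_of_mem_erase hi)
    · exact lt_of_le_of_lt (Nat.zero_le _) (hlt j hj hjo)
  have hf := h.full
  have h4 : k * U.card = k * (U.erase o).card + k := by rw [← h2]; ring
  have := h.hso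
  omega

lemma Sys.tight_pair {U : Finset ι} {o j : ι} {e : Fin n → Finset ι} {σ : ι → ℕ}
    (h : Sys k U o e σ) (hj : j ∈ U) (hjo : j ≠ o) (hk : σ j = k) :
    wt e {o, j} + ∑ i ∈ {o, j}, σ i + k = k * ({o, j} : Finset ι).card + ({o, j} : Finset ι).sup σ := by
  have hb := h.sp {o, j} (by intro y; simp; rintro (rfl | rfl); exacts [h.ho, hj]) (by simp)
  have h1 : ({o, j} : Finset ι).card = 2 := Finset.card_pair hjo.symm
  have h2 : ∑ i ∈ {o, j}, σ i = 2 * k := by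
    rw [Finset.sum_pair hjo.symm, h.hso, hk]; ring
  have h3 : ({o, j} : Finset ι).sup σ = k := by simp [h.hso, hk]
  rw [h1, h2, h3] at hb; rw [h1, h2, h3]
  omega

/-- degenerated levels -/
def bump (σ : ι → ℕ) (o : ι) (E : Finset ι) (j : ι) : ℕ :=
  if j ∈ E ∧ j ≠ o then σ j + 1 else σ j

lemma Sys.merge {U : Finset ι} {o : ι} {e : Fin (n + 1) → Finset ι} {σ : ι → ℕ}
    (h : Sys k U o e σ) (hlt : ∀ i ∈ U, i ≠ o → σ i < k)
    (hnt : ∀ I, I ⊆ U → I ≠ U → 2 ≤ I.card →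
      wt e I + ∑ i ∈ I, σ i + k ≠ k * I.card + I.sup σ)
    (x : Fin (n + 1)) (hx : o ∈ e x) :
    Sys k U o (fun y => e (x.succAbove y)) (bump σ o (e x)) := by
  have hw : ∀ I, wt e I = ((I ∩ e x).card - 1) + wt (fun y => e (x.succAbove y)) I := by
    intro I; unfold wt; rw [Fin.sum_univ_succAbove _ x]
  have hsum : ∀ I : Finset ι, ∑ j ∈ I, bump σ o (e x) j = ∑ j ∈ I, σ j + ((I ∩ e x).erase o).card := by
    intro I
    have : ∀ j, bump σ o (e x) j = σ j + if j ∈ e x ∧ j ≠ o then 1 else 0 := by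
      intro j; unfold bump; split_ifs <;> rfl
    simp_rw [this]
    rw [Finset.sum_add_distrib, Finset.sum_boole]
    congr 2
    congr 1
    ext y; simp; tauto
  have hge : ∀ j, σ j ≤ bump σ o (e x) j := by
    intro j; unfold bump; split_ifs <;> omega
  have hsup : ∀ I : Finset ι, I.sup σ ≤ I.sup (bump σ o (e x)) := fun I =>
    Finset.sup_mono_fun fun j _ => hge j
  refine ⟨h.ho, by simp [bump, h.hso], ?_, ?_, ?_⟩
  · intro j hj
    unfold bump
    split_ifs with hc
    · exact hlt j hj hc.2
    · exact h.hs j hj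
  · intro I hI hne
    by_cases hoI : o ∈ I
    · have h1 : ((I ∩ e x).erase o).card = (I ∩ e x).card - 1 :=
        Finset.card_erase_of_mem (by simp [hoI, hx])
      have h2 := h.sp I hI hne
      rw [hsum, h1]
      have := hw I
      have := hsup I
      omega
    · have h1 : ((I ∩ e x).erase o).card = (I ∩ e x).card := by
        rw [Finset.erase_eq_of_notMem]; simp [hoI]
      by_cases h2 : 2 ≤ I.card
      · have h3 := h.sp I hI hne
        have h4 := hnt I hI (by rintro rfl; exact hoI h.ho) h2
        have := hw I
        have := hsup I
        rw [hsum, h1]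
        omega
      · have : I.card = 1 := by have := hne.card_pos; omega
        obtain ⟨j, rfl⟩ := Finset.card_eq_one.1 this
        have h0 : wt (fun y => e (x.succAbove y)) {j} = 0 := by
          unfold wt
          refine Finset.sum_eq_zero fun y _ => ?_
          have : ({j} ∩ e (x.succAbove y)).card ≤ ({j} : Finset ι).card :=
            Finset.card_le_card Finset.inter_subset_left
          rw [Finset.card_singleton] at this
          exact Nat.sub_eq_zero_of_le this
        rw [h0]; simp; omega
  · have h1 : ((U ∩ e x).erase o).card = (U ∩ e x).card - 1 :=
        Finset.card_erase_of_mem (by simp [h.ho, hx])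
    rw [hsum, h1]
    have := hw U
    have := h.full
    omega

end comb

open MvPolynomial in
/-- Echelon form. -/
lemma exists_echelon_s14 {F : Type*} [Field F] {r : ℕ} (m : MonomialOrder (Fin r)) :
    ∀ (k : ℕ) (W : Submodule F (MvPolynomial (Fin r) F)), FiniteDimensional F W →
      Module.finrank F W = k →
      ∃ (f : Fin k → MvPolynomial (Fin r) F) (d : Fin k → (Fin r →₀ ℕ)),
        (∀ t, f t ∈ W) ∧ LinearIndependent F f ∧
        (∀ s t, s ≤ t → m.toSyn (m.degree (f t)) ≤ m.toSyn (d s)) ∧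
        (∀ s, coeff (d s) (f s) ≠ 0) ∧ (∀ s t, s < t → coeff (d s) (f t) = 0) := by
  intro k
  induction k with
  | zero =>
    intro W _ _
    exact ⟨Fin.elim0, Fin.elim0, fun t => t.elim0, linearIndependent_empty_type,
      fun t => t.elim0, fun t => t.elim0, fun t => t.elim0⟩
  | succ k ih =>
    intro W hW hk
    let b := Module.finBasisOfFinrankEq F W hk
    obtain ⟨i0, -, hi0⟩ := Finset.exists_max_image (Finset.univ : Finset (Fin (k+1)))
      (fun i => m.toSyn (m.degree (b i : MvPolynomial (Fin r) F))) ⟨0, by simp⟩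
    set D := m.degree (b i0 : MvPolynomial (Fin r) F) with hD
    have hdegW : ∀ w ∈ W, m.toSyn (m.degree w) ≤ m.toSyn D := by
      intro w hw
      have h1 : w = ∑ i, b.repr ⟨w, hw⟩ i • (b i : MvPolynomial (Fin r) F) := by
        have := congrArg W.subtype (b.sum_repr ⟨w, hw⟩)
        rw [map_sum] at this
        exact this.symm
      rw [h1]
      refine m.degree_sum_le.trans (Finset.sup_le fun i _ => ?_)
      exact m.degree_smul_le.trans (hi0 i (Finset.mem_univ i))
    have hb0 : (b i0 : MvPolynomial (Fin r) F) ≠ 0 := by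
      have := b.ne_zero i0
      simpa using this
    have hcD : coeff D (b i0 : MvPolynomial (Fin r) F) ≠ 0 := m.coeff_degree_ne_zero_iff.2 hb0
    let φ : Module.Dual F W := (lcoeff F D).comp W.subtype
    have hφ : φ ≠ 0 := by
      intro h
      exact hcD (by simpa [φ] using congrArg (fun g => g (b i0)) h)
    have hker := Module.Dual.finrank_ker_add_one_of_ne_zero hφ
    let W' := (LinearMap.ker φ).map W.subtype
    have hW' : ∀ w ∈ W', w ∈ W ∧ coeff D w = 0 := by
      rintro w ⟨y, hy, rfl⟩
      refine ⟨y.2, ?_⟩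
      simpa [φ] using hy
    have hfr : Module.finrank F W' = k := by
      have : Module.finrank F W' = Module.finrank F (LinearMap.ker φ) :=
        (Submodule.equivMapOfInjective W.subtype W.injective_subtype _).finrank_eq.symm
      omega
    obtain ⟨f, d, h1, h2, h3, h4, h5⟩ := ih W' inferInstance hfr
    refine ⟨Fin.cons (b i0 : MvPolynomial (Fin r) F) f, Fin.cons D d, ?_, ?_, ?_, ?_, ?_⟩
    · intro t
      refine Fin.cases ?_ (fun t => ?_) t
      · exact (b i0).2
      · exact (hW' _ (h1 t)).1
    · rw [linearIndependent_finCons]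
      refine ⟨h2, fun hmem => ?_⟩
      have : Submodule.span F (Set.range f) ≤ W' := by
        rw [Submodule.span_le]; rintro _ ⟨t, rfl⟩; exact h1 t
      exact hcD (hW' _ (this hmem)).2
    · intro s t
      refine Fin.cases ?_ (fun s => ?_) s
      · intro _
        refine Fin.cases ?_ (fun t => ?_) t
        · exact le_rfl
        · exact hdegW _ (hW' _ (h1 t)).1
      · refine Fin.cases ?_ (fun t => ?_) t
        · intro h; exact absurd h (by simp)
        · intro h; exact h3 s t (by simpa using h)
    · intro s
      refine Fin.cases ?_ (fun s => ?_) s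
      · exact hcD
      · exact h4 s
    · intro s t
      refine Fin.cases ?_ (fun s => ?_) s
      · refine Fin.cases ?_ (fun t => ?_) t
        · intro h; exact absurd h (by simp)
        · intro _; exact (hW' _ (h1 t)).2
      · refine Fin.cases ?_ (fun t => ?_) t
        · intro h; exact absurd h (by simp)
        · intro h; exact h5 s t (by simpa using h)

open MvPolynomial in
/-- Singling out the variables of the `x`-th point. -/
def sep (F : Type*) [Field F] {n : ℕ} (r : ℕ) (x : Fin (n + 1)) :
    MvPolynomial (Fin (n + 1) × Fin r) F →ₐ[F]
      MvPolynomial (Fin r) (MvPolynomial (Fin n × Fin r) F) :=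
  aeval fun p => Fin.insertNth (α := fun _ => MvPolynomial (Fin r) (MvPolynomial (Fin n × Fin r) F))
    x (X p.2) (fun j => C (X (j, p.2))) p.1

open MvPolynomial in
lemma sep_same {F : Type*} [Field F] {n r : ℕ} (x : Fin (n + 1)) (t : Fin r) :
    sep F r x (X (x, t)) = X t := by
  simp [sep]

open MvPolynomial in
lemma sep_other {F : Type*} [Field F] {n r : ℕ} (x : Fin (n + 1)) (j : Fin n) (t : Fin r) :
    sep F r x (X (x.succAbove j, t)) = C (X (j, t)) := by
  simp [sep]

open MvPolynomial in
lemma sep_injective (F : Type*) [Field F] {n : ℕ} (r : ℕ) (x : Fin (n + 1)) :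
    Function.Injective (sep F r x) := by
  let ψ : MvPolynomial (Fin r) (MvPolynomial (Fin n × Fin r) F) →+*
      MvPolynomial (Fin (n + 1) × Fin r) F :=
    eval₂Hom (rename (fun p : Fin n × Fin r => (x.succAbove p.1, p.2)) :
      MvPolynomial (Fin n × Fin r) F →ₐ[F] MvPolynomial (Fin (n + 1) × Fin r) F).toRingHom
      (fun t => X (x, t))
  have h : ψ.comp (sep F r x).toRingHom = RingHom.id _ := by
    apply MvPolynomial.ringHom_ext
    · intro c
      have : (sep F r x) (C c) = C (C c) := by
        simp [sep]
      simp [this, ψ]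
    · rintro ⟨y, t⟩
      rcases Fin.eq_self_or_eq_succAbove x y with rfl | ⟨j, rfl⟩
      · simp [sep_same, ψ]
      · simp [sep_other, ψ]
  intro p q hpq
  have hp := congrArg (fun g => g p) h
  have hq := congrArg (fun g => g q) h
  simp at hp hq
  rw [← hp, ← hq, hpq]

open MvPolynomial in
lemma sep_aeval_same {F : Type*} [Field F] {n r : ℕ} (x : Fin (n + 1)) (f : MvPolynomial (Fin r) F) :
    sep F r x (aeval (fun t => X (x, t)) f) = map (C : F →+* MvPolynomial (Fin n × Fin r) F) f := by
  induction f using MvPolynomial.induction_on with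
  | C c => simp [sep]
  | add p q hp hq => rw [map_add, map_add, map_add, hp, hq]
  | mul_X p t hp => rw [map_mul, map_mul, map_mul, hp, aeval_X, sep_same, map_X]

open MvPolynomial in
lemma sep_aeval_other {F : Type*} [Field F] {n r : ℕ} (x : Fin (n + 1)) (j : Fin n)
    (f : MvPolynomial (Fin r) F) :
    sep F r x (aeval (fun t => X (x.succAbove j, t)) f) =
      C (aeval (fun t => (X (j, t) : MvPolynomial (Fin n × Fin r) F)) f) := by
  induction f using MvPolynomial.induction_on with
  | C c => simp [sep]
  | add p q hp hq => rw [map_add, map_add, map_add, hp, hq, map_add]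
  | mul_X p t hp => rw [map_mul, map_mul, map_mul, hp, aeval_X, aeval_X, sep_other, map_mul]

open MvPolynomial in
lemma degenerate {F : Type*} [Field F] {r k n : ℕ} {ι : Type*}
    (m : MonomialOrder (Fin r))
    (f : Fin k → MvPolynomial (Fin r) F) (d : Fin k → (Fin r →₀ ℕ))
    (hdeg : ∀ s t, s ≤ t → m.toSyn (m.degree (f t)) ≤ m.toSyn (d s))
    (hlead : ∀ s, coeff (d s) (f s) ≠ 0) (h0 : ∀ s t, s < t → coeff (d s) (f t) = 0)
    [DecidableEq ι] (U : Finset ι) (o : ι) (e : Fin (n + 1) → Finset ι) (σ : ι → ℕ)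
    (ho : o ∈ U) (x : Fin (n + 1)) (hx : o ∈ e x)
    (g : ι → Fin k → MvPolynomial (Fin (n + 1) × Fin r) F) (hgo : g o = 0)
    (hgσ : ∀ i ∈ U, ∀ t : Fin k, (t : ℕ) < σ i → g i t = 0)
    (hge : ∀ x, ∀ i ∈ U, i ∈ e x → ∀ j ∈ U, j ∈ e x →
      ∑ t, (g i t - g j t) * aeval (fun s => X (x, s)) (f t) = 0)
    (hne : ∃ i ∈ U, g i ≠ 0) :
    ∃ g' : ι → Fin k → MvPolynomial (Fin n × Fin r) F, g' o = 0 ∧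
      (∀ i ∈ U, ∀ t : Fin k, (t : ℕ) < bump σ o (e x) i → g' i t = 0) ∧
      (∀ y, ∀ i ∈ U, i ∈ e (x.succAbove y) → ∀ j ∈ U, j ∈ e (x.succAbove y) →
        ∑ t, (g' i t - g' j t) * aeval (fun s => X (y, s)) (f t) = 0) ∧
      ∃ i ∈ U, g' i ≠ 0 := by
  classical
  have hdm : ∀ s t, s ≤ t → m.toSyn (m.degree (MvPolynomial.map
      (C : F →+* MvPolynomial (Fin n × Fin r) F) (f t))) ≤ m.toSyn (d s) := by
    intro s t hst
    rw [m.degree_le_iff]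
    intro c hc
    exact (m.le_degree (MvPolynomial.support_map_subset _ _ hc)).trans (hdeg s t hst)
  let G : ι → Fin k → MvPolynomial (Fin r) (MvPolynomial (Fin n × Fin r) F) :=
    fun i t => sep F r x (g i t)
  obtain ⟨i1, hi1, hgi1⟩ := hne
  obtain ⟨t1, ht1⟩ := Function.ne_iff.1 hgi1
  let S : Finset (ι × Fin k) := (U ×ˢ Finset.univ).filter fun p => G p.1 p.2 ≠ 0
  have hS : S.Nonempty := by
    refine ⟨(i1, t1), ?_⟩
    simp only [S, G, Finset.mem_filter, Finset.mem_product, Finset.mem_univ, hi1, true_and]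
    exact fun h => ht1 ((map_eq_zero_iff _ (sep_injective F r x)).1 h)
  obtain ⟨⟨i0, t0⟩, hmem, hmax⟩ := Finset.exists_max_image S
    (fun p => m.toSyn (m.degree (G p.1 p.2))) hS
  simp only [S, Finset.mem_filter, Finset.mem_product, Finset.mem_univ, and_true] at hmem
  set D := m.degree (G i0 t0) with hD
  have hDle : ∀ i ∈ U, ∀ t, m.toSyn (m.degree (G i t)) ≤ m.toSyn D := by
    intro i hi t
    by_cases hz : G i t = 0
    · rw [hz, m.degree_zero, map_zero]; exact m.zero_le _
    · exact hmax (i, t) (by simp [S, hi, hz])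
  refine ⟨fun i t => coeff D (G i t), ?_, ?_, ?_, i0, hmem.1, ?_⟩
  · funext t; simp [G, hgo]
  · intro i hi t ht
    by_cases hlt : (t : ℕ) < σ i
    · simp [G, hgσ i hi t hlt]
    · unfold bump at ht
      split_ifs at ht with hc
      swap
      · exact absurd ht hlt
      have hti : (t : ℕ) = σ i := by omega
      have h1 := congrArg (sep F r x) (hge x i hi hc.1 o ho hx)
      simp only [hgo, Pi.zero_apply, sub_zero, map_sum, map_mul, map_zero, sep_aeval_same] at h1
      have h2 := congrArg (coeff (D + d t)) h1
      rw [coeff_sum, coeff_zero, Finset.sum_eq_single t] at h2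
      · rw [m.coeff_mul_of_add_of_degree_le (hDle i hi t), coeff_map] at h2
        · rcases mul_eq_zero.1 h2 with h | h
          · exact h
          · exact absurd (C_eq_zero.1 h) (hlead t)
        · exact hdm t t le_rfl
      · intro s _ hst
        rcases lt_or_gt_of_ne hst with hs | hs
        · rw [hgσ i hi s (by rw [← hti]; exact hs)]; simp
        · rw [m.coeff_mul_of_add_of_degree_le (hDle i hi s), coeff_map, h0 t s hs]
          · simp
          · exact hdm t s hs.le
      · simp
  · intro y i hi hiy j hj hjy
    have h1 := congrArg (sep F r x) (hge (x.succAbove y) i hi hiy j hj hjy)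
    simp only [map_sum, map_mul, map_zero, map_sub, sep_aeval_other] at h1
    have h2 := congrArg (coeff D) h1
    simp only [coeff_sum, mul_comm _ (C _), coeff_C_mul, coeff_sub, coeff_zero] at h2
    simp only [mul_comm _ (aeval _ _)]
    exact h2
  · intro h
    have := congrFun h t0
    exact m.coeff_degree_ne_zero_iff.2 hmem.2 this

open MvPolynomial in
theorem core {F : Type*} [Field F] {r k : ℕ} {ι : Type*}
    (m : MonomialOrder (Fin r))
    (f : Fin k → MvPolynomial (Fin r) F) (d : Fin k → (Fin r →₀ ℕ))
    (hdeg : ∀ s t, s ≤ t → m.toSyn (m.degree (f t)) ≤ m.toSyn (d s))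
    (hlead : ∀ s, coeff (d s) (f s) ≠ 0) (h0 : ∀ s t, s < t → coeff (d s) (f t) = 0)
    [DecidableEq ι] : ∀ (n : ℕ) (U : Finset ι) (o : ι) (e : Fin n → Finset ι) (σ : ι → ℕ),
    Sys k U o e σ →
    ∀ g : ι → Fin k → MvPolynomial (Fin n × Fin r) F, g o = 0 →
    (∀ i ∈ U, ∀ t : Fin k, (t : ℕ) < σ i → g i t = 0) →
    (∀ x, ∀ i ∈ U, i ∈ e x → ∀ j ∈ U, j ∈ e x →
      ∑ t, (g i t - g j t) * aeval (fun s => X (x, s)) (f t) = 0) →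
    ∀ i ∈ U, g i = 0 := by
  intro n
  induction n with
  | zero =>
    intro U o e σ h g _ hgσ _ i hi
    funext t
    exact hgσ i hi t (by rw [h.base i hi]; exact t.2)
  | succ n ihn =>
    intro U
    induction U using Finset.strongInduction with
    | H U ih =>
    intro o e σ h g hgo hgσ hge
    by_cases htight : ∃ I, I ⊆ U ∧ I ≠ U ∧ 2 ≤ I.card ∧
      wt e I + ∑ i ∈ I, σ i + k = k * I.card + I.sup σ
    · obtain ⟨I, hIU, hIne, hI2, ht⟩ := htight
      obtain ⟨i, hi, hmax, hio⟩ : ∃ i ∈ I, (∀ j ∈ I, σ j ≤ σ i) ∧ (o ∈ I → i = o) := by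
        by_cases hoI : o ∈ I
        · exact ⟨o, hoI, fun j hj => by rw [h.hso]; exact h.hs j (hIU hj), fun _ => rfl⟩
        · obtain ⟨i, hi, hm⟩ := Finset.exists_max_image I σ (Finset.card_pos.1 (by omega))
          exact ⟨i, hi, hm, fun hh => absurd hh hoI⟩
      have hconst : ∀ j ∈ I, g j = g i := by
        have := ih I (Finset.ssubset_iff_subset_ne.2 ⟨hIU, hIne⟩) i e _
          (h.restrict hIU hi hmax ht) (fun j => g j - g i) (by simp) ?_ ?_
        · intro j hj; exact sub_eq_zero.1 (this j hj)
        · intro j hj t htj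
          by_cases hji : j = i
          · subst hji; simp
          · rw [Function.update_of_ne hji] at htj
            simp [hgσ j (hIU hj) t htj, hgσ i (hIU hi) t (lt_of_lt_of_le htj (hmax j hj))]
        · intro x a ha hax b hb hbx
          have := hge x a (hIU ha) hax b (hIU hb) hbx
          simpa using this
      have hsub : insert i (U \ I) ⊆ U :=
        Finset.insert_subset (hIU hi) Finset.sdiff_subset
      have hss : insert i (U \ I) ⊂ U := by
        refine Finset.ssubset_iff_subset_ne.2 ⟨hsub, fun heq => ?_⟩
        obtain ⟨j, hj, hji⟩ := Finset.exists_mem_ne (by omega : 1 < I.card) i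
        have : j ∈ insert i (U \ I) := by rw [heq]; exact hIU hj
        simp [hji, hj] at this
      have hmem : ∀ x a, a ∈ insert i (U \ I) → a ∈ contr I i e x →
          ∃ a' ∈ U, a' ∈ e x ∧ g a = g a' := by
        intro x a ha hax
        unfold contr at hax
        split_ifs at hax with hc
        · rcases Finset.mem_insert.1 hax with rfl | hax
          · obtain ⟨a', ha'⟩ := hc
            rw [Finset.mem_inter] at ha'
            exact ⟨a', hIU ha'.1, ha'.2, (hconst a' ha'.1).symm⟩
          · exact ⟨a, hsub ha, hax, rfl⟩
        · exact ⟨a, hsub ha, hax, rfl⟩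
      have hfin := ih _ hss o (contr I i e) σ (h.contract hIU hi hmax hio ht) g hgo
        (fun j hj => hgσ j (hsub hj)) (by
          intro x a ha hax b hb hbx
          obtain ⟨a', h1, h2, h3⟩ := hmem x a ha hax
          obtain ⟨b', h4, h5, h6⟩ := hmem x b hb hbx
          rw [h3, h6]
          exact hge x a' h1 h2 b' h4 h5)
      intro j hj
      by_cases hjI : j ∈ I
      · rw [hconst j hjI]; exact hfin i (by simp)
      · exact hfin j (by simp [hj, hjI])
    · have hnt : ∀ I, I ⊆ U → I ≠ U → 2 ≤ I.card →
          wt e I + ∑ i ∈ I, σ i + k ≠ k * I.card + I.sup σ :=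
        fun I h1 h2 h3 h4 => htight ⟨I, h1, h2, h3, h4⟩
      by_cases hone : ∃ j ∈ U, j ≠ o
      swap
      · push Not at hone
        intro i hi; rw [hone i hi]; exact hgo
      obtain ⟨j, hj, hjo⟩ := hone
      by_cases hcap : ∃ j ∈ U, j ≠ o ∧ σ j = k
      · obtain ⟨j, hj, hjo, hjk⟩ := hcap
        have hU : ({o, j} : Finset ι) = U := by
          by_contra hne
          refine hnt _ ?_ hne (by rw [Finset.card_pair hjo.symm]) (h.tight_pair hj hjo hjk)
          intro y hy
          rcases Finset.mem_insert.1 hy with rfl | hy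
          · exact h.ho
          · rw [Finset.mem_singleton.1 hy]; exact hj
        intro i hi
        rw [← hU] at hi
        rcases Finset.mem_insert.1 hi with rfl | hi
        · exact hgo
        · rw [Finset.mem_singleton.1 hi]
          funext t
          exact hgσ j hj t (by rw [hjk]; exact t.2)
      · have hlt : ∀ i ∈ U, i ≠ o → σ i < k := fun i hi hio =>
          lt_of_le_of_ne (h.hs i hi) fun hh => hcap ⟨i, hi, hio, hh⟩
        obtain ⟨x, hx⟩ := h.exists_edge hj hjo hlt
        by_contra hcon
        push Not at hcon
        obtain ⟨g', a1, a2, a3, i, hi, a4⟩ := degenerate m f d hdeg hlead h0 U o e σ h.ho x hx g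
          hgo hgσ hge hcon
        exact a4 (ihn U o _ _ (h.merge hlt hnt x hx) g' a1 a2 a3 i hi)

open MvPolynomial in
theorem rigid {F : Type*} [Field F] {k n r : ℕ}
    {K : Type*} [Field K] [Algebra (MvPolynomial (Fin n × Fin r) F) K] [IsFractionRing (MvPolynomial (Fin n × Fin r) F) K]
    (f : Fin k → MvPolynomial (Fin r) F) (hf : LinearIndependent F f)
    (V : Matrix (Fin k) (Fin n) K)
    (hV : ∀ i j, V i j = algebraMap (MvPolynomial (Fin n × Fin r) F) K
      (aeval (fun t => X (j, t)) (f i)))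
    {ℓ : ℕ} (e : Fin n → Finset (Fin ℓ)) (o : Fin ℓ)
    (hsp : ∀ I : Finset (Fin ℓ), I.Nonempty → wt e I + k ≤ k * I.card)
    (hfull : wt e Finset.univ + k = k * ℓ)
    (c : Fin ℓ → Fin k → K)
    (hc : ∀ x, ∀ i ∈ e x, ∀ j ∈ e x, ∑ t, (c i t - c j t) * V t x = 0) :
    ∀ i, c i = c o := by
  classical
  let m : MonomialOrder (Fin r) := MonomialOrder.lex
  let W := Submodule.span F (Set.range f)
  have hfr : Module.finrank F W = k := by
    have := finrank_span_eq_card hf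
    simpa using this
  have hWfd : FiniteDimensional F W := FiniteDimensional.span_of_finite F (Set.finite_range f)
  obtain ⟨f', d, hfW, hli, hdeg, hlead, h0⟩ := exists_echelon_s14 m k W hWfd hfr
  have hspan : Submodule.span F (Set.range f') = W := by
    refine Submodule.eq_of_le_of_finrank_eq ?_ ?_
    · rw [Submodule.span_le]; rintro _ ⟨t, rfl⟩; exact hfW t
    · rw [hfr]; simpa using finrank_span_eq_card hli
  have hM : ∀ t, ∃ a : Fin k → F, ∑ s, a s • f' s = f t := by
    intro t
    rw [← Submodule.mem_span_range_iff_exists_fun, hspan]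
    exact Submodule.subset_span ⟨t, rfl⟩
  have hN : ∀ t, ∃ a : Fin k → F, ∑ s, a s • f s = f' t := by
    intro t
    rw [← Submodule.mem_span_range_iff_exists_fun]
    exact hfW t
  choose M hM using hM
  choose N hN using hN
  have hMN : ∀ t u, ∑ s, M t s * N s u = if t = u then 1 else 0 := by
    intro t u
    have h1 : ∑ u, (∑ s, M t s * N s u) • f u = ∑ u, (if t = u then (1 : F) else 0) • f u := by
      simp only [ite_smul, one_smul, zero_smul, Finset.sum_ite_eq, Finset.mem_univ, if_true]
      rw [← hM t]
      simp only [← hN, Finset.sum_smul, Finset.smul_sum, smul_smul]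
      rw [Finset.sum_comm]
    have h2 := Fintype.linearIndependent_iff.1 hf
      (fun u => (∑ s, M t s * N s u) - (if t = u then (1 : F) else 0))
      (by simp only [sub_smul, Finset.sum_sub_distrib]; rw [h1, sub_self]) u
    exact sub_eq_zero.1 h2
  let a : F →+* K := (algebraMap (MvPolynomial (Fin n × Fin r) F) K).comp (C : F →+* (MvPolynomial (Fin n × Fin r) F))
  let c' : Fin ℓ → Fin k → K := fun i s => ∑ t, (c i t - c o t) * a (M t s)
  obtain ⟨b, hb⟩ := IsLocalization.exist_integer_multiples_of_finite (nonZeroDivisors (MvPolynomial (Fin n × Fin r) F))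
    (fun p : Fin ℓ × Fin k => c' p.1 p.2)
  choose g0 hg0 using hb
  let g : Fin ℓ → Fin k → (MvPolynomial (Fin n × Fin r) F) := fun i s => g0 (i, s)
  have hg : ∀ i s, algebraMap (MvPolynomial (Fin n × Fin r) F) K (g i s) = algebraMap (MvPolynomial (Fin n × Fin r) F) K b * c' i s := by
    intro i s
    rw [← Algebra.smul_def]
    exact hg0 (i, s)
  have hinj : Function.Injective (algebraMap (MvPolynomial (Fin n × Fin r) F) K) := IsFractionRing.injective (MvPolynomial (Fin n × Fin r) F) K
  have hb0 : algebraMap (MvPolynomial (Fin n × Fin r) F) K b ≠ 0 := by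
    intro h
    exact nonZeroDivisors.coe_ne_zero b ((map_eq_zero_iff _ hinj).1 h)
  have hVe : ∀ t x, V t x = ∑ s, a (M t s) *
      algebraMap (MvPolynomial (Fin n × Fin r) F) K (aeval (fun u => X (x, u)) (f' s)) := by
    intro t x
    rw [hV, ← hM t, map_sum, map_sum]
    refine Finset.sum_congr rfl fun s _ => ?_
    rw [map_smul, MvPolynomial.smul_eq_C_mul, map_mul]
    rfl
  have hsys : Sys k Finset.univ o e (fun i => if i = o then k else 0) := by
    refine ⟨Finset.mem_univ _, by simp, ?_, ?_, ?_⟩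
    · intro i _; split_ifs <;> omega
    · intro I _ hne
      have h1 := hsp I hne
      have h2 : ∑ i ∈ I, (if i = o then k else 0) ≤ I.sup (fun i => if i = o then k else 0) := by
        rw [Finset.sum_ite_eq']
        split_ifs with ho
        · have := Finset.le_sup (f := fun i => if i = o then k else 0) ho
          simpa using this
        · exact Nat.zero_le _
      omega
    · simp; omega
  have hcore := core m f' d hdeg hlead h0 n Finset.univ o e _ hsys g ?_ ?_ ?_
  · intro i
    have hz : ∀ s, c' i s = 0 := by
      intro s
      have := hg i s
      rw [hcore i (Finset.mem_univ _)] at this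
      simp only [Pi.zero_apply, map_zero] at this
      rcases mul_eq_zero.1 this.symm with h | h
      · exact absurd h hb0
      · exact h
    funext u
    have h1 : ∑ s, c' i s * a (N s u) = c i u - c o u := by
      simp only [c', Finset.sum_mul]
      rw [Finset.sum_comm]
      have : ∀ t, ∑ s, (c i t - c o t) * a (M t s) * a (N s u) =
          (c i t - c o t) * if t = u then 1 else 0 := by
        intro t
        have h3 : (if t = u then (1 : K) else 0) = a (if t = u then 1 else 0) := by
          split_ifs <;> simp
        rw [h3, ← hMN t u, map_sum, Finset.mul_sum]
        refine Finset.sum_congr rfl fun s _ => ?_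
        rw [map_mul, mul_assoc]
      simp only [this]
      simp
    simp only [hz, zero_mul, Finset.sum_const_zero] at h1
    exact (sub_eq_zero.1 h1.symm)
  · funext s
    apply hinj
    rw [hg]
    simp [c']
  · intro i _ t ht
    split_ifs at ht with hio
    · subst hio
      apply hinj
      rw [hg]
      simp [c']
    · omega
  · intro x i _ hi j _ hj
    apply hinj
    rw [map_sum, map_zero]
    have h1 := hc x i hi j hj
    have h2 : ∑ s, (c' i s - c' j s) * algebraMap (MvPolynomial (Fin n × Fin r) F) K (aeval (fun u => X (x, u)) (f' s)) = 0 := by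
      rw [← h1]
      simp only [hVe, c', ← Finset.sum_sub_distrib, Finset.sum_mul, Finset.mul_sum]
      rw [Finset.sum_comm]
      refine Finset.sum_congr rfl fun t _ => Finset.sum_congr rfl fun s _ => ?_
      ring
    have h3 : ∀ s, algebraMap (MvPolynomial (Fin n × Fin r) F) K ((g i s - g j s) * aeval (fun u => X (x, u)) (f' s)) =
        algebraMap (MvPolynomial (Fin n × Fin r) F) K b * ((c' i s - c' j s) *
          algebraMap (MvPolynomial (Fin n × Fin r) F) K (aeval (fun u => X (x, u)) (f' s))) := by
      intro s
      rw [map_mul, map_sub, hg, hg]; ring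
    rw [Finset.sum_congr rfl fun s _ => h3 s, ← Finset.mul_sum, h2, mul_zero]

lemma wt_complement {n ℓ : ℕ} (A : Fin ℓ → Finset (Fin n)) (I : Finset (Fin ℓ)) :
    wt (fun x => Finset.univ.filter fun i => x ∉ A i) I + n + ∑ i ∈ I, (A i).card
      = n * I.card + (interSet A I).card := by
  classical
  have h1 : ∀ x : Fin n, ((I ∩ Finset.univ.filter fun i => x ∉ A i).card - 1) + 1
      = (I ∩ Finset.univ.filter fun i => x ∉ A i).card + if x ∈ interSet A I then 1 else 0 := by
    intro x
    have : x ∈ interSet A I ↔ (I ∩ Finset.univ.filter fun i => x ∉ A i).card = 0 := by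
      rw [Finset.card_eq_zero, Finset.eq_empty_iff_forall_notMem]
      simp [interSet]
    split_ifs with h
    · rw [this.1 h]
    · rw [this] at h; omega
  have h2 := Finset.sum_congr rfl fun (x : Fin n) (_ : x ∈ Finset.univ) => h1 x
  rw [Finset.sum_add_distrib, Finset.sum_add_distrib] at h2
  simp only [Finset.sum_const, Finset.card_univ, Fintype.card_fin, smul_eq_mul, mul_one,
    Finset.sum_boole, Finset.filter_mem_eq_inter, Finset.univ_inter, Nat.cast_id] at h2
  have h3 : ∑ x : Fin n, (I ∩ Finset.univ.filter fun i => x ∉ A i).card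
      = ∑ i ∈ I, (A i)ᶜ.card := by
    have : ∀ x : Fin n, (I ∩ Finset.univ.filter fun i => x ∉ A i).card
        = ∑ i ∈ I, if x ∉ A i then 1 else 0 := by
      intro x
      rw [Finset.sum_boole, Nat.cast_id]
      congr 1
      ext i; simp
    simp only [this]
    rw [Finset.sum_comm]
    refine Finset.sum_congr rfl fun i _ => ?_
    rw [Finset.sum_boole, Nat.cast_id]
    congr 1
    ext x; simp
  have h4 : ∑ i ∈ I, (A i)ᶜ.card + ∑ i ∈ I, (A i).card = n * I.card := by
    rw [← Finset.sum_add_distrib]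
    have : ∀ i ∈ I, (A i)ᶜ.card + (A i).card = n := by
      intro i _
      have := Finset.card_compl_add_card (A i)
      simpa using this
    rw [Finset.sum_congr rfl this]; simp [mul_comm]
  have h5 : wt (fun x => Finset.univ.filter fun i => x ∉ A i) I
      = ∑ x : Fin n, ((I ∩ Finset.univ.filter fun i => x ∉ A i).card - 1) := by
    unfold wt; rfl
  rw [h5]
  omega

lemma nullInter_single {n ℓ q : ℕ} (A : Fin ℓ → Finset (Fin n)) (h : NullInter q A)
    (I : Finset (Fin ℓ)) (hI : I.Nonempty) :
    (interSet A I).card + ∑ i ∈ Iᶜ, (A i).card ≤ Iᶜ.card * q := by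
  classical
  let P : Finpartition (Finset.univ : Finset (Fin ℓ)) :=
    (⊥ : Finpartition Iᶜ).extend (b := I) (by simpa using hI.ne_empty)
      disjoint_compl_left (by simp)
  have hP := h P
  have hparts : P.parts = insert I (⊥ : Finpartition Iᶜ).parts := rfl
  have hnot : I ∉ (⊥ : Finpartition Iᶜ).parts := by
    intro hmem
    have := (⊥ : Finpartition Iᶜ).le hmem
    obtain ⟨i, hi⟩ := hI
    have := this hi
    simp [hi] at this
  rw [hparts, Finset.sum_insert hnot, Finset.card_insert_of_notMem hnot,
    Finpartition.card_bot, Finpartition.parts_bot, Finset.sum_map] at hP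
  have hs : ∀ i : Fin ℓ, interSet A {i} = A i := by
    intro i; ext x; simp [interSet]
  simpa [hs] using hP

lemma colSpan_exists {K : Type*} [Field K] {k n : ℕ} (Q : Matrix (Fin k) (Fin n) K)
    (A : Finset (Fin n)) (z : Fin k → K) (hz : z ∈ colSpan Q A) :
    ∃ w : Fin n → K, (∀ x, x ∉ A → w x = 0) ∧ Q *ᵥ w = z := by
  classical
  unfold colSpan at hz
  induction hz using Submodule.span_induction with
  | mem z hz =>
    obtain ⟨j, hj, rfl⟩ := hz
    refine ⟨Pi.single j 1, ?_, ?_⟩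
    · intro x hx
      rw [Pi.single_eq_of_ne]
      rintro rfl
      exact hx (by simpa using hj)
    · funext i; simp
  | zero => exact ⟨0, by simp, by simp⟩
  | add a b _ _ ha hb =>
    obtain ⟨u, hu, rfl⟩ := ha
    obtain ⟨v, hv, rfl⟩ := hb
    exact ⟨u + v, fun x hx => by simp [hu x hx, hv x hx], Matrix.mulVec_add _ _ _⟩
  | smul c a _ ha =>
    obtain ⟨u, hu, rfl⟩ := ha
    exact ⟨c • u, fun x hx => by simp [hu x hx], Matrix.mulVec_smul _ _ _⟩

lemma ker_eq_range {K : Type*} [Field K] {k n : ℕ} (hkn : k ≤ n) (V : Matrix (Fin k) (Fin n) K)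
    (Q : Matrix (Fin (n - k)) (Fin n) K) (hV : V.rank = k) (hQ : Q.rank = n - k)
    (hVQ : V * Qᵀ = 0) (w : Fin n → K) (hw : Q *ᵥ w = 0) : ∃ c : Fin k → K, Vᵀ *ᵥ c = w := by
  have hQV : Q * Vᵀ = 0 := by
    have := congrArg Matrix.transpose hVQ
    simpa [Matrix.transpose_mul] using this
  have hle : LinearMap.range Vᵀ.mulVecLin ≤ LinearMap.ker Q.mulVecLin := by
    rintro _ ⟨c, rfl⟩
    rw [LinearMap.mem_ker, Matrix.mulVecLin_apply, Matrix.mulVecLin_apply, Matrix.mulVec_mulVec,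
      hQV, Matrix.zero_mulVec]
  have h1 : Module.finrank K (LinearMap.range Vᵀ.mulVecLin) = k := by
    have := Matrix.rank_transpose V
    rw [hV] at this
    exact this
  have h2 : Module.finrank K (LinearMap.ker Q.mulVecLin) = k := by
    have h3 := LinearMap.finrank_range_add_finrank_ker Q.mulVecLin
    have h4 : Module.finrank K (LinearMap.range Q.mulVecLin) = n - k := hQ
    simp only [Module.finrank_fin_fun] at h3
    omega
  have heq := Submodule.eq_of_le_of_finrank_eq hle (h1.trans h2.symm)
  have : w ∈ LinearMap.range Vᵀ.mulVecLin := by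
    rw [heq]; simpa using hw
  obtain ⟨c, hc⟩ := this
  exact ⟨c, hc⟩

/-- Duals of generic polynomial codes are `MDS(ℓ)` for all `ℓ ≥ 2`; equivalently,
generic polynomial codes are `LD-MDS(≤ L)` for all `L`. -/
theorem generic_polynomial_codes_LD_MDS
    (F : Type*) [Field F] (k n r : ℕ) (hk : 1 ≤ k) (hkn : k ≤ n) (hr : 1 ≤ r)
    (f : Fin k → MvPolynomial (Fin r) F) (hf : LinearIndependent F f)
    (V : Matrix (Fin k) (Fin n) (FractionRing (MvPolynomial (Fin n × Fin r) F)))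
    (hV : ∀ i j, V i j = MvPolynomial.eval₂
      ((algebraMap (MvPolynomial (Fin n × Fin r) F)
        (FractionRing (MvPolynomial (Fin n × Fin r) F))).comp
        (MvPolynomial.C : F →+* MvPolynomial (Fin n × Fin r) F))
      (fun t => algebraMap (MvPolynomial (Fin n × Fin r) F)
        (FractionRing (MvPolynomial (Fin n × Fin r) F)) (MvPolynomial.X (j, t)))
      (f i)) :
    V.rank = k ∧
    ∀ Q : Matrix (Fin (n - k)) (Fin n) (FractionRing (MvPolynomial (Fin n × Fin r) F)),
      Q.rank = n - k → V * Qᵀ = 0 →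
      ∀ ℓ : ℕ, 2 ≤ ℓ → ∀ A : Fin ℓ → Finset (Fin n),
        (∀ i, (A i).card ≤ n - k) →
        (∑ i, (A i).card) = (ℓ - 1) * (n - k) →
        NullInter (n - k) A →
        (⨅ i, colSpan Q (A i)) = ⊥ := by
  classical
  have hV' : ∀ i j, V i j = algebraMap (MvPolynomial (Fin n × Fin r) F)
      (FractionRing (MvPolynomial (Fin n × Fin r) F))
      (MvPolynomial.aeval (fun t => MvPolynomial.X (j, t)) (f i)) := by
    intro i j
    rw [hV, MvPolynomial.aeval_def, MvPolynomial.hom_eval₂]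
    rfl
  have hrank : V.rank = k := by
    have hli : LinearIndependent (FractionRing (MvPolynomial (Fin n × Fin r) F)) V.row := by
      rw [Fintype.linearIndependent_iff]
      intro c hc
      have hw : ∀ I : Finset (Fin 2),
          wt (fun x : Fin n => if (x : ℕ) < k then (Finset.univ : Finset (Fin 2)) else ∅) I
            = k * (I.card - 1) := by
        intro I
        unfold wt
        have : ∀ x : Fin n, (I ∩ if (x : ℕ) < k then (Finset.univ : Finset (Fin 2)) else ∅).card - 1
            = if (x : ℕ) < k then I.card - 1 else 0 := by
          intro x; split_ifs <;> simp
        simp only [this]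
        rw [← Finset.sum_filter, Finset.sum_const, smul_eq_mul]
        congr 1
        rw [Fin.card_filter_val_lt]
        omega
      have hr2 := rigid f hf V hV'
        (fun x : Fin n => if (x : ℕ) < k then (Finset.univ : Finset (Fin 2)) else ∅) 0
        (by
          intro I hI
          rw [hw]
          have := hI.card_pos
          obtain ⟨q, hq⟩ : ∃ q, I.card = q + 1 := ⟨I.card - 1, by omega⟩
          rw [hq]
          simp [mul_add])
        (by rw [hw]; simp; ring)
        ![0, c]
        (by
          have h0 : ∀ x, ∑ t, c t * V t x = 0 := by
            intro x
            have := congrFun hc x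
            simpa [Matrix.row] using this
          intro x i _ j _
          fin_cases i <;> fin_cases j <;> simp [h0])
        1
      intro i
      have := congrFun hr2 i
      simpa using this
    have := hli.rank_matrix
    simpa using this
  refine ⟨hrank, ?_⟩
  intro Q hQ hVQ ℓ hℓ A _ hsum hnull
  have hlow : ∀ I : Finset (Fin ℓ), I.Nonempty →
      wt (fun x => Finset.univ.filter fun i => x ∉ A i) I + k ≤ k * I.card := by
    intro I hI
    have h1 := wt_complement A I
    have h2 := nullInter_single A hnull I hI
    have h3 := Finset.sum_add_sum_compl I (fun i => (A i).card)
    have h4 := Finset.card_add_card_compl I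
    rw [Fintype.card_fin] at h4
    obtain ⟨q, hq⟩ : ∃ q, n = k + q := ⟨n - k, by omega⟩
    obtain ⟨p, hp⟩ : ∃ p, ℓ = p + 1 := ⟨ℓ - 1, by omega⟩
    have hq' : n - k = q := by omega
    rw [hsum, hq'] at h3
    rw [hq'] at h2
    have hp' : ℓ - 1 = p := by omega
    rw [hp'] at h3
    have h5 : n * I.card = k * I.card + q * I.card := by rw [hq]; ring
    have h6 : q * I.card + Iᶜ.card * q = p * q + q := by
      have : I.card + Iᶜ.card = p + 1 := by omega
      calc _ = (I.card + Iᶜ.card) * q := by ring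
        _ = _ := by rw [this]; ring
    omega
  let o : Fin ℓ := ⟨0, by omega⟩
  have huniv : (interSet A Finset.univ).card = 0 := by
    have := nullInter_single A hnull Finset.univ ⟨o, Finset.mem_univ _⟩
    simp at this ⊢
    exact this
  have hfull : wt (fun x => Finset.univ.filter fun i => x ∉ A i) (Finset.univ : Finset (Fin ℓ)) + k
      = k * ℓ := by
    have h1 := wt_complement A Finset.univ
    rw [huniv, hsum, Finset.card_univ, Fintype.card_fin] at h1
    obtain ⟨q, hq⟩ : ∃ q, n = k + q := ⟨n - k, by omega⟩
    obtain ⟨p, hp⟩ : ∃ p, ℓ = p + 1 := ⟨ℓ - 1, by omega⟩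
    have hq' : n - k = q := by omega
    have hp' : ℓ - 1 = p := by omega
    rw [hq', hp'] at h1
    have h5 : n * ℓ = k * ℓ + p * q + q := by rw [hq, hp]; ring
    omega
  rw [eq_bot_iff]
  intro z hz
  rw [Submodule.mem_iInf] at hz
  choose w hw hwz using fun i => colSpan_exists Q (A i) z (hz i)
  have hc : ∀ i, ∃ c : Fin k → FractionRing (MvPolynomial (Fin n × Fin r) F),
      Vᵀ *ᵥ c = w i - w o := by
    intro i
    refine ker_eq_range hkn V Q hrank hQ hVQ _ ?_
    rw [Matrix.mulVec_sub, hwz, hwz, sub_self]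
  choose c hc using hc
  have hcx : ∀ i x, ∑ t, c i t * V t x = w i x - w o x := by
    intro i x
    have := congrFun (hc i) x
    simp only [Matrix.mulVec, dotProduct, Matrix.transpose_apply, Pi.sub_apply] at this
    rw [← this]
    exact Finset.sum_congr rfl fun t _ => mul_comm _ _
  have hrig := rigid f hf V hV' (fun x => Finset.univ.filter fun i => x ∉ A i) o hlow hfull c
    (by
      intro x i hi j hj
      simp only [Finset.mem_filter, Finset.mem_univ, true_and] at hi hj
      simp only [sub_mul, Finset.sum_sub_distrib]
      rw [hcx, hcx, hw i x hi, hw j x hj, sub_self])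
  have hwo : w o = 0 := by
    funext x
    have hx : x ∉ interSet A Finset.univ := by
      rw [Finset.card_eq_zero] at huniv; simp [huniv]
    simp only [interSet, Finset.mem_filter, Finset.mem_univ, true_and, true_imp_iff, not_forall] at hx
    obtain ⟨i, hi⟩ := hx
    have h1 := hcx i x
    rw [hrig i, hcx o x, hw i x hi] at h1
    simp only [sub_self, zero_sub] at h1
    exact (neg_eq_zero.1 h1.symm)
  rw [Submodule.mem_bot, ← hwz o, hwo, Matrix.mulVec_zero]
end
end
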